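/- Let A be a C*-algebra and (Y,θ) a generating system of k nondegenerate regular A-correspondences. For 1 ≤ i ≤ k let Y_1∗⋯∗Y_i denote the product system over ℕ^i generated by (Y_1,…,Y_i,θ), and let ℰ^i Y_j denote the correspondence obtained from Y_j by i iterations of the construction ℰ (at the m-th iteration each current correspondence Z is replaced by Z ⊗ O of the current m-th correspondence, with left action induced by the current isomorphisms ℛ^{m-1}θ). Then for each i < k and each j = 1,…,k there is an isomorphism ℰ^i Y_j ≅ Y_j ⊗_A O(Y_1∗⋯∗Y_i) of correspondences over O(Y_1∗⋯∗Y_i), and, taking j = i+1, the Cuntz–Pimsner algebras satisfy O(ℰ^i Y_{i+1}) ≅ O(Y_1∗⋯∗Y_{i+1}). -/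

import Mathlib

/- ############################################################
   Common framework: C*-correspondences, interior tensor products
   (characterized relationally), representations, Cuntz–Pimsner algebras,
   product systems over ℕ^k, generating systems, and the ℰ / ℛθ
   constructions of the paper (characterized relationally).
   ############################################################ -/

noncomputable section

open Filter Topology

universe u

/-- A C*-correspondence over a (not necessarily unital) C*-algebra `A`:
a right Hilbert `A`-module `X` together with a left action of `A` by
adjointable (bounded) operators.  The rank-one operators `θ_{x,y}` are
bundled as data together with their defining property. -/
structure Corr (A : Type u) [NonUnitalCStarAlgebra A] : Type (u + 1) where
  X : Type u
  [nacg : NormedAddCommGroup X]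
  [nsp : NormedSpace ℂ X]
  [cmpl : CompleteSpace X]
  /-- right action of `A` -/
  ract : X → A → X
  /-- `A`-valued inner product -/
  inner : X → X → A
  /-- left action `φ : A → L(X)` by adjointable operators -/
  lactL : A → X →L[ℂ] X
  /-- the rank-one ("compact") operators `θ_{x,y} z = x ⬝ ⟨y, z⟩` -/
  rankOne : X → X → X →L[ℂ] X
  ract_add_left : ∀ x y a, ract (x + y) a = ract x a + ract y a
  ract_add_right : ∀ x a b, ract x (a + b) = ract x a + ract x b
  ract_mul : ∀ x a b, ract x (a * b) = ract (ract x a) b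
  ract_smul : ∀ (c : ℂ) x a, ract (c • x) a = c • ract x a
  ract_smul' : ∀ (c : ℂ) x a, ract x (c • a) = c • ract x a
  inner_add_right : ∀ x y z, inner x (y + z) = inner x y + inner x z
  inner_smul_right : ∀ (c : ℂ) x y, inner x (c • y) = c • inner x y
  inner_star : ∀ x y, star (inner x y) = inner y x
  inner_ract_right : ∀ x y a, inner x (ract y a) = inner x y * a
  norm_eq : ∀ x, ‖x‖ ^ 2 = ‖inner x x‖
  lact_add : ∀ a b, lactL (a + b) = lactL a + lactL b
  lact_mul : ∀ a b, lactL (a * b) = (lactL a).comp (lactL b)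
  lact_smul : ∀ (c : ℂ) a, lactL (c • a) = c • lactL a
  lact_adjoint : ∀ a x y, inner (lactL a x) y = inner x (lactL (star a) y)
  rankOne_apply : ∀ x y z, rankOne x y z = ract x (inner y z)

attribute [instance] Corr.nacg Corr.nsp Corr.cmpl

variable {A : Type u} [NonUnitalCStarAlgebra A]

/-- Nondegeneracy: `A·X` is (topologically) all of `X`. -/
def Corr.Nondeg (W : Corr A) : Prop :=
  closure (Submodule.span ℂ {y : W.X | ∃ a x, y = W.lactL a x} : Set W.X) = Set.univ

/-- Regularity: the left action is injective and takes values in the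
compact operators (the closed span of the rank-one operators). -/
def Corr.Regular (W : Corr A) : Prop :=
  (∀ a, W.lactL a = 0 → a = 0) ∧
    ∀ a, W.lactL a ∈
      closure (Submodule.span ℂ {T : W.X →L[ℂ] W.X | ∃ x y, T = W.rankOne x y} :
        Set (W.X →L[ℂ] W.X))

/-- standing hypotheses of the paper: nondegenerate and regular -/
def Corr.Reg (W : Corr A) : Prop := W.Nondeg ∧ W.Regular

/-- a bare function which is a continuous `ℂ`-linear map -/
structure IsCLMap {E F : Type u} [NormedAddCommGroup E] [NormedSpace ℂ E]
    [NormedAddCommGroup F] [NormedSpace ℂ F] (f : E → F) : Prop where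
  map_add : ∀ x y, f (x + y) = f x + f y
  map_smul : ∀ (c : ℂ) x, f (c • x) = c • f x
  cont : Continuous f

/-- a map of correspondences over the same algebra which is an isomorphism -/
structure IsCorrIsoFun (W Z : Corr A) (f : W.X → Z.X) : Prop where
  bijective : Function.Bijective f
  map_add : ∀ x y, f (x + y) = f x + f y
  map_smul : ∀ (c : ℂ) x, f (c • x) = c • f x
  map_inner : ∀ x y, Z.inner (f x) (f y) = W.inner x y
  map_ract : ∀ x a, f (W.ract x a) = Z.ract (f x) a
  map_lact : ∀ a x, f (W.lactL a x) = Z.lactL a (f x)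

/-- an isomorphism of correspondences over the same algebra (bundled) -/
structure CorrIso (W Z : Corr A) : Type u where
  toFun : W.X → Z.X
  invFun : Z.X → W.X
  left_inv : ∀ x, invFun (toFun x) = x
  right_inv : ∀ y, toFun (invFun y) = y
  map_add : ∀ x y, toFun (x + y) = toFun x + toFun y
  map_smul : ∀ (c : ℂ) x, toFun (c • x) = c • toFun x
  map_inner : ∀ x y, Z.inner (toFun x) (toFun y) = W.inner x y
  map_ract : ∀ x a, toFun (W.ract x a) = Z.ract (toFun x) a
  map_lact : ∀ a x, toFun (W.lactL a x) = Z.lactL a (toFun x)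

/-- an isomorphism of correspondences lying over an isomorphism `Φ` of the
coefficient algebras -/
structure CorrIsoOver {B : Type u} [NonUnitalCStarAlgebra B]
    (Φ : A → B) (W : Corr A) (Z : Corr B) : Type u where
  toFun : W.X → Z.X
  bijective : Function.Bijective toFun
  map_add : ∀ x y, toFun (x + y) = toFun x + toFun y
  map_smul : ∀ (c : ℂ) x, toFun (c • x) = c • toFun x
  map_inner : ∀ x y, Z.inner (toFun x) (toFun y) = Φ (W.inner x y)
  map_ract : ∀ x a, toFun (W.ract x a) = Z.ract (toFun x) (Φ a)
  map_lact : ∀ a x, toFun (W.lactL a x) = Z.lactL (Φ a) (toFun x)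

/-- `T`, together with the bilinear map `m`, is a realization of the
balanced (interior) tensor product `W ⊗_A V` of correspondences over `A`. -/
structure IsTensor (W V T : Corr A) (m : W.X → V.X → T.X) : Prop where
  add_left : ∀ x x' y, m (x + x') y = m x y + m x' y
  add_right : ∀ x y y', m x (y + y') = m x y + m x y'
  smul_left : ∀ (c : ℂ) x y, m (c • x) y = c • m x y
  smul_right : ∀ (c : ℂ) x y, m x (c • y) = c • m x y
  balanced : ∀ x a y, m (W.ract x a) y = m x (V.lactL a y)
  inner : ∀ x y x' y',
    T.inner (m x y) (m x' y') = V.inner y (V.lactL (W.inner x x') y')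
  ract : ∀ x y a, T.ract (m x y) a = m x (V.ract y a)
  lact : ∀ a x y, T.lactL a (m x y) = m (W.lactL a x) y
  dense : closure (Submodule.span ℂ {z : T.X | ∃ x y, z = m x y} : Set T.X) = Set.univ

variable {B : Type u} [NonUnitalCStarAlgebra B]

/-- `π : A → B` is a *-homomorphism (stated elementwise) -/
structure IsStarHom (π : A → B) : Prop where
  map_add : ∀ a b, π (a + b) = π a + π b
  map_mul : ∀ a b, π (a * b) = π a * π b
  map_star : ∀ a, π (star a) = star (π a)
  map_smul : ∀ (c : ℂ) a, π (c • a) = c • π a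

/-- `(π, t)` is a representation (Toeplitz representation) of the
correspondence `W` in the C*-algebra `B`. -/
structure IsRep (W : Corr A) (π : A → B) (t : W.X → B) : Prop where
  hom : IsStarHom π
  t_add : ∀ x y, t (x + y) = t x + t y
  t_smul : ∀ (c : ℂ) x, t (c • x) = c • t x
  lact : ∀ a x, t (W.lactL a x) = π a * t x
  ract : ∀ x a, t (W.ract x a) = t x * π a
  inner : ∀ x y, star (t x) * t y = π (W.inner x y)

/-- Cuntz–Pimsner covariance of a representation of a *regular*
correspondence: whenever `φ(a)` is approximated in norm by finite sums of
rank-one operators `θ_{x,y}`, `π(a)` is approximated by the corresponding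
sums `t(x) t(y)*`.  (For regular correspondences this is equivalent to
`π = t⁽¹⁾ ∘ φ`.) -/
def CPCov (W : Corr A) (π : A → B) (t : W.X → B) : Prop :=
  ∀ (a : A) (N : ℕ → ℕ) (x y : ∀ n, Fin (N n) → W.X),
    Tendsto (fun n => ∑ r, W.rankOne (x n r) (y n r)) atTop (𝓝 (W.lactL a)) →
    Tendsto (fun n => ∑ r, t (x n r) * star (t (y n r))) atTop (𝓝 (π a))

/-- The Cuntz–Pimsner algebra of a correspondence `W`: a C*-algebra `O`
together with a universal covariant representation `(π, t)`:  `(π,t)` is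
covariant, `π` is injective, `O` is generated by the images of `π` and `t`,
and every covariant representation factors uniquely through `O`. -/
structure CPAlg (W : Corr A) : Type (u + 1) where
  O : Type u
  [alg : NonUnitalCStarAlgebra O]
  π : A → O
  t : W.X → O
  isRep : IsRep W π t
  covariant : CPCov W π t
  inj : Function.Injective π
  gen : ∀ S : Set O, IsClosed S →
    (∀ a, π a ∈ S) → (∀ x, t x ∈ S) →
    (∀ p q, p ∈ S → q ∈ S → p + q ∈ S) →
    (∀ p q, p ∈ S → q ∈ S → p * q ∈ S) →
    (∀ (c : ℂ) p, p ∈ S → c • p ∈ S) →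
    (∀ p, p ∈ S → star p ∈ S) → ∀ z, z ∈ S
  universal : ∀ (C : Type u) [NonUnitalCStarAlgebra C],
    ∀ (π' : A → C) (t' : W.X → C), IsRep W π' t' → CPCov W π' t' →
      ∃! h : O →⋆ₙₐ[ℂ] C, (∀ a, h (π a) = π' a) ∧ ∀ x, h (t x) = t' x

attribute [instance] CPAlg.alg

/- ##################  product systems over ℕ^k  ################## -/

/-- the `i`-th standard generator of `ℕ^k` -/
def egen {k : ℕ} (i : Fin k) : Fin k → ℕ := Pi.single i 1

/-- A product system over `ℕ^k` of (nondegenerate regular) correspondences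
over `A`:  fibers `fib s`, an associative multiplication implementing
isomorphisms `fib s ⊗_A fib t ≅ fib (s+t)`, and `fib 0 = A` (witnessed by
the unit map). -/
structure PSys (A : Type u) [NonUnitalCStarAlgebra A] (k : ℕ) : Type (u + 1) where
  fib : (Fin k → ℕ) → Corr A
  reg : ∀ s, (fib s).Reg
  mul : ∀ s t, (fib s).X → (fib t).X → (fib (s + t)).X
  isTensor : ∀ s t, IsTensor (fib s) (fib t) (fib (s + t)) (mul s t)
  assoc : ∀ s t u x y z,
    HEq (mul (s + t) u (mul s t x y) z) (mul s (t + u) x (mul t u y z))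
  unit : A → (fib 0).X
  unit_bij : Function.Bijective unit
  unit_add : ∀ a b, unit (a + b) = unit a + unit b
  unit_smul : ∀ (c : ℂ) a, unit (c • a) = c • unit a
  unit_inner : ∀ a b, (fib 0).inner (unit a) (unit b) = star a * b
  unit_lact : ∀ a b, (fib 0).lactL a (unit b) = unit (a * b)
  unit_ract : ∀ a b, (fib 0).ract (unit a) b = unit (a * b)
  unit_mul_left : ∀ s a x, HEq (mul 0 s (unit a) x) ((fib s).lactL a x)
  unit_mul_right : ∀ s x a, HEq (mul s 0 x (unit a)) ((fib s).ract x a)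

/-- a representation of a product system in a C*-algebra `B` -/
structure PSRep {k : ℕ} (Xs : PSys A k) (B : Type u) [NonUnitalCStarAlgebra B] :
    Type u where
  π : A → B
  ψ : ∀ s, (Xs.fib s).X → B
  isRep : ∀ s, IsRep (Xs.fib s) π (ψ s)
  ψ_zero : ∀ a, ψ 0 (Xs.unit a) = π a
  mul : ∀ s t x y, ψ s x * ψ t y = ψ (s + t) (Xs.mul s t x y)

/-- Cuntz–Pimsner covariance of a representation of a product system -/
def PSCPCov {k : ℕ} {Xs : PSys A k} {B : Type u} [NonUnitalCStarAlgebra B]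
    (r : PSRep Xs B) : Prop :=
  ∀ s, CPCov (Xs.fib s) r.π (r.ψ s)

/-- The Cuntz–Pimsner algebra `𝒪(X)` of a product system. -/
structure PSCPAlg {k : ℕ} (Xs : PSys A k) : Type (u + 1) where
  O : Type u
  [alg : NonUnitalCStarAlgebra O]
  rep : PSRep Xs O
  covariant : PSCPCov rep
  inj : Function.Injective rep.π
  gen : ∀ S : Set O, IsClosed S →
    (∀ a, rep.π a ∈ S) → (∀ s x, rep.ψ s x ∈ S) →
    (∀ p q, p ∈ S → q ∈ S → p + q ∈ S) →
    (∀ p q, p ∈ S → q ∈ S → p * q ∈ S) →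
    (∀ (c : ℂ) p, p ∈ S → c • p ∈ S) →
    (∀ p, p ∈ S → star p ∈ S) → ∀ z, z ∈ S
  universal : ∀ (C : Type u) [NonUnitalCStarAlgebra C],
    ∀ r : PSRep Xs C, PSCPCov r →
      ∃! h : O →⋆ₙₐ[ℂ] C,
        (∀ a, h (rep.π a) = r.π a) ∧ ∀ s x, h (rep.ψ s x) = r.ψ s x

attribute [instance] PSCPAlg.alg

/- ##################  generating systems  ################## -/

/-- a realization of a triple tensor product `W1 ⊗ W2 ⊗ W3` carrying both
a left pairing `(W1 ⊗ W2) ⊗ W3` and a right pairing `W1 ⊗ (W2 ⊗ W3)` -/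
structure Trip (W1 W2 W3 : Corr A) (T12 : Corr A) (m12 : W1.X → W2.X → T12.X)
    (T23 : Corr A) (m23 : W2.X → W3.X → T23.X) (P : Corr A) : Type u where
  lp : T12.X → W3.X → P.X
  rp : W1.X → T23.X → P.X
  lt : IsTensor T12 W3 P lp
  rt : IsTensor W1 T23 P rp
  compat : ∀ x y z, lp (m12 x y) z = rp x (m23 y z)

/-- the hexagonal relation for a triple of flip isomorphisms
`θij, θil, θjl`, stated relative to arbitrary realizations of the six
triple tensor products. -/
def HexProp (Yi Yj Yl : Corr A)
    (Tij Tji Til Tli Tjl Tlj : Corr A)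
    (mij : Yi.X → Yj.X → Tij.X) (mji : Yj.X → Yi.X → Tji.X)
    (mil : Yi.X → Yl.X → Til.X) (mli : Yl.X → Yi.X → Tli.X)
    (mjl : Yj.X → Yl.X → Tjl.X) (mlj : Yl.X → Yj.X → Tlj.X)
    (θij : Tij.X → Tji.X) (θil : Til.X → Tli.X) (θjl : Tjl.X → Tlj.X) : Prop :=
  ∀ (P1 P2 P3 P4 P5 P6 : Corr A)
    (R1 : Trip Yi Yj Yl Tij mij Tjl mjl P1)
    (R2 : Trip Yj Yi Yl Tji mji Til mil P2)
    (R3 : Trip Yj Yl Yi Tjl mjl Tli mli P3)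
    (R4 : Trip Yl Yj Yi Tlj mlj Tji mji P4)
    (R5 : Trip Yi Yl Yj Til mil Tlj mlj P5)
    (R6 : Trip Yl Yi Yj Tli mli Tij mij P6)
    (F1 : P1.X → P2.X) (F2 : P2.X → P3.X) (F3 : P3.X → P4.X)
    (F4 : P1.X → P5.X) (F5 : P5.X → P6.X) (F6 : P6.X → P4.X),
    IsCLMap F1 → IsCLMap F2 → IsCLMap F3 →
    IsCLMap F4 → IsCLMap F5 → IsCLMap F6 →
    (∀ u z, F1 (R1.lp u z) = R2.lp (θij u) z) →
    (∀ y v, F2 (R2.rp y v) = R3.rp y (θil v)) →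
    (∀ u z, F3 (R3.lp u z) = R4.lp (θjl u) z) →
    (∀ x v, F4 (R1.rp x v) = R5.rp x (θjl v)) →
    (∀ u z, F5 (R5.lp u z) = R6.lp (θil u) z) →
    (∀ x v, F6 (R6.rp x v) = R4.rp x (θij v)) →
    ∀ w, F3 (F2 (F1 w)) = F6 (F5 (F4 w))

/-- A generating system `(Y, θ)` of `k` correspondences over `A`:
correspondences `Y i`, chosen realizations `T i j` of the tensor products
`Y i ⊗_A Y j`, and flip isomorphisms `θ i j : Y i ⊗ Y j → Y j ⊗ Y i` with
`θ i i = id`, `θ j i = (θ i j)⁻¹`, satisfying the hexagonal relations. -/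
structure GenSys (A : Type u) [NonUnitalCStarAlgebra A] (k : ℕ) : Type (u + 1) where
  Y : Fin k → Corr A
  reg : ∀ i, (Y i).Reg
  T : Fin k → Fin k → Corr A
  tmul : ∀ i j, (Y i).X → (Y j).X → (T i j).X
  isTensor : ∀ i j, IsTensor (Y i) (Y j) (T i j) (tmul i j)
  θ : ∀ i j, CorrIso (T i j) (T j i)
  θ_diag : ∀ i x y, (θ i i).toFun (tmul i i x y) = tmul i i x y
  θ_symm : ∀ i j z, (θ j i).toFun ((θ i j).toFun z) = z
  hex : ∀ i j l, HexProp (Y i) (Y j) (Y l) (T i j) (T j i) (T i l) (T l i)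
    (T j l) (T l j) (tmul i j) (tmul j i) (tmul i l) (tmul l i) (tmul j l)
    (tmul l j) ((θ i j).toFun) ((θ i l).toFun) ((θ j l).toFun)

/-- the generating system obtained by keeping only `Y 1, …, Y m` -/
def GenSys.restrict {k : ℕ} (G : GenSys A k) (m : ℕ) (h : m ≤ k) : GenSys A m where
  Y i := G.Y (Fin.castLE h i)
  reg i := G.reg _
  T i j := G.T (Fin.castLE h i) (Fin.castLE h j)
  tmul i j := G.tmul _ _
  isTensor i j := G.isTensor _ _
  θ i j := G.θ _ _
  θ_diag i := G.θ_diag _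
  θ_symm i j := G.θ_symm _ _
  hex i j l := G.hex _ _ _

/-- `X` is *the* product system (over `ℕ^k`) generated by the generating
system `G` (Fowler–Sims); witnessed by compatible isomorphisms on the
generating fibers. -/
structure Generates {k : ℕ} (G : GenSys A k) (Xs : PSys A k) : Type u where
  ι : ∀ i, CorrIso (G.Y i) (Xs.fib (egen i))
  κ : ∀ i j, CorrIso (G.T i j) (Xs.fib (egen i + egen j))
  κ_mul : ∀ i j x y,
    (κ i j).toFun (G.tmul i j x y) =
      Xs.mul (egen i) (egen j) ((ι i).toFun x) ((ι j).toFun y)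
  θ_compat : ∀ i j z,
    HEq ((κ j i).toFun ((G.θ i j).toFun z)) ((κ i j).toFun z)

/- ############  mixed tensor products `W ⊗_A O` and `W ⊗_A V`  ############ -/

/-- `Z` (a correspondence over the C*-algebra `O`), with map `m`, is a
realization of the right Hilbert `O`-module `W ⊗_A O`, where `O` is an
`A`-algebra via `πA`.  (No condition on the left action of `O` on `Z`.) -/
structure MixedMod (W : Corr A) (O : Type u) [NonUnitalCStarAlgebra O]
    (πA : A → O) (Z : Corr O) (m : W.X → O → Z.X) : Prop where
  add_left : ∀ x x' S, m (x + x') S = m x S + m x' S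
  add_right : ∀ x S S', m x (S + S') = m x S + m x S'
  smul_left : ∀ (c : ℂ) x S, m (c • x) S = c • m x S
  smul_right : ∀ (c : ℂ) x S, m x (c • S) = c • m x S
  balanced : ∀ x a S, m (W.ract x a) S = m x (πA a * S)
  ract : ∀ x S T, Z.ract (m x S) T = m x (S * T)
  inner : ∀ x S y T, Z.inner (m x S) (m y T) = star S * (πA (W.inner x y) * T)
  dense : closure (Submodule.span ℂ {z : Z.X | ∃ x S, z = m x S} : Set Z.X) = Set.univ

/-- `P`, with pairing `p`, is a realization of the balanced tensor product
`W ⊗_A V` where `W` is a correspondence over `A` and `V` a correspondence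
over the `A`-algebra `O` (via `πA`); the left `A`-action is `πA`-compatible. -/
structure MixedPair (W : Corr A) {O : Type u} [NonUnitalCStarAlgebra O]
    (πA : A → O) (V P : Corr O) (p : W.X → V.X → P.X) : Prop where
  add_left : ∀ x x' v, p (x + x') v = p x v + p x' v
  add_right : ∀ x v v', p x (v + v') = p x v + p x v'
  smul_left : ∀ (c : ℂ) x v, p (c • x) v = c • p x v
  smul_right : ∀ (c : ℂ) x v, p x (c • v) = c • p x v
  balanced : ∀ x a v, p (W.ract x a) v = p x (V.lactL (πA a) v)
  inner : ∀ x v x' v',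
    P.inner (p x v) (p x' v') = V.inner v (V.lactL (πA (W.inner x x')) v')
  ract : ∀ x v S, P.ract (p x v) S = p x (V.ract v S)
  lact_pi : ∀ a x v, P.lactL (πA a) (p x v) = p (W.lactL a x) v
  dense : closure (Submodule.span ℂ {z : P.X | ∃ x v, z = p x v} : Set P.X) = Set.univ

/- ############  the correspondence `ℰYᵢ = Yᵢ ⊗_A 𝒪(Y₁)`  ############ -/

/-- `Z = Yi ⊗_A 𝒪(Y1)` with the left `𝒪(Y1)`-action determined by the flip
`θ : Y1 ⊗ Yi → Yi ⊗ Y1` (`T` and `T'` are realizations of these tensor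
products):  `π(a)` acts by `φ(a) ⊗ 1`, and `t(x)·(y ⊗ S) = (1 ⊗ V)(θ ⊗ 1)
(x ⊗ y ⊗ S)`. -/
structure ECorrData (Y1 Yi : Corr A)
    (T : Corr A) (mT : Y1.X → Yi.X → T.X)
    (T' : Corr A) (mT' : Yi.X → Y1.X → T'.X)
    (θ : T.X → T'.X)
    (C : CPAlg Y1) (Z : Corr C.O) (m : Yi.X → C.O → Z.X) : Prop where
  mod : MixedMod Yi C.O C.π Z m
  lact_pi : ∀ a y S, Z.lactL (C.π a) (m y S) = m (Yi.lactL a y) S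
  lact_t : ∃ μ : T'.X → C.O → Z.X,
    (∀ S, IsCLMap fun u => μ u S) ∧
    (∀ y u S, μ (mT' y u) S = m y (C.t u * S)) ∧
    ∀ x y S, Z.lactL (C.t x) (m y S) = μ (θ (mT x y)) S

/-- `Z = Yi ⊗_A 𝒪(Y p)` for a generating system `G`, with left action
determined by `θ p i` -/
def ECorr {k : ℕ} (G : GenSys A k) (p i : Fin k) (C : CPAlg (G.Y p))
    (Z : Corr C.O) (m : (G.Y i).X → C.O → Z.X) : Prop :=
  ECorrData (G.Y p) (G.Y i) (G.T p i) (G.tmul p i) (G.T i p) (G.tmul i p)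
    ((G.θ p i).toFun) C Z m

/-- `Z = Y j ⊗_A 𝒪(Y 1 ∗ ⋯ ∗ Y m)` with the left action of the
Cuntz–Pimsner algebra of the product system determined on the generators
`σ i = ψ_{e i}` via the flips `θ i j` and the absorption maps. -/
structure EPCorr {k : ℕ} (G : GenSys A k) {m : ℕ} (hm : m ≤ k)
    (Xs : PSys A m) (gen : Generates (G.restrict m hm) Xs) (C : PSCPAlg Xs)
    (j : Fin k) (Z : Corr C.O) (mm : (G.Y j).X → C.O → Z.X) : Prop where
  mod : MixedMod (G.Y j) C.O C.rep.π Z mm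
  lact_pi : ∀ a y S, Z.lactL (C.rep.π a) (mm y S) = mm ((G.Y j).lactL a y) S
  lact_t : ∀ i : Fin m,
    ∃ μ : (G.T j (Fin.castLE hm i)).X → C.O → Z.X,
      (∀ S, IsCLMap fun u => μ u S) ∧
      (∀ y u S, μ (G.tmul j (Fin.castLE hm i) y u) S =
        mm y (C.rep.ψ (egen i) ((gen.ι i).toFun u) * S)) ∧
      ∀ x y S, Z.lactL (C.rep.ψ (egen i) ((gen.ι i).toFun x)) (mm y S) =
        μ ((G.θ (Fin.castLE hm i) j).toFun (G.tmul (Fin.castLE hm i) j x y)) S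

/- ############  the isomorphism `ℛθ = ν⁻¹ (θ ⊗ 1) ν`  ############ -/

/-- Witness data expressing that `R : Zi ⊗_O Zj → Zj ⊗_O Zi` is the map
`ℛθ_{ij} = ν_{ji}⁻¹ (θ_{ij} ⊗ 1_O) ν_{ij}` of the paper, where
`Zi = Yi ⊗_A O`, `O = 𝒪(Y1)`, and `ν_{ij} : (Yi ⊗ O) ⊗_O (Yj ⊗ O) ≅
Yi ⊗ Yj ⊗ O` is the canonical absorption isomorphism. -/
structure RTheta (O : Type u) [NonUnitalCStarAlgebra O] (πA : A → O)
    (Yi Yj : Corr A) (Tij Tji : Corr A)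
    (mij : Yi.X → Yj.X → Tij.X) (mji : Yj.X → Yi.X → Tji.X)
    (θij : Tij.X → Tji.X)
    (Zi Zj : Corr O) (mmi : Yi.X → O → Zi.X) (mmj : Yj.X → O → Zj.X)
    (TZ TZr : Corr O) (mZ : Zi.X → Zj.X → TZ.X) (mZr : Zj.X → Zi.X → TZr.X)
    (R : TZ.X → TZr.X) : Type (u + 1) where
  Pl : Corr O
  Pr : Corr O
  pij : Yi.X → Zj.X → Pl.X
  pji : Yj.X → Zi.X → Pr.X
  hp : MixedPair Yi πA Zj Pl pij
  hpr : MixedPair Yj πA Zi Pr pji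
  q : Tij.X → O → Pl.X
  qr : Tji.X → O → Pr.X
  hq : MixedMod Tij O πA Pl q
  hqr : MixedMod Tji O πA Pr qr
  q_compat : ∀ x y S, q (mij x y) S = pij x (mmj y S)
  q_compatr : ∀ y x S, qr (mji y x) S = pji y (mmi x S)
  ν : TZ.X → Pl.X
  νr : TZr.X → Pr.X
  hν : IsCLMap ν ∧ Function.Bijective ν ∧
    ∀ x S ζ, ν (mZ (mmi x S) ζ) = pij x (Zj.lactL S ζ)
  hνr : IsCLMap νr ∧ Function.Bijective νr ∧
    ∀ y S ζ, νr (mZr (mmj y S) ζ) = pji y (Zi.lactL S ζ)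
  Θ : Pl.X → Pr.X
  hΘ : IsCLMap Θ ∧ ∀ u S, Θ (q u S) = qr (θij u) S
  hR : ∀ z, νr (R z) = Θ (ν z)

/-- One step of the iterative construction `ℰ`:  from a generating system
`Gm` over `B` and the Cuntz–Pimsner algebra `C` of its `p`-th
correspondence, pass to the generating system `Gn` over `𝒪(Gm.Y p)` whose
correspondences are `ℰ(Gm.Y j) = Gm.Y j ⊗_B 𝒪(Gm.Y p)` (with left action
induced by the flips `θ p j`) and whose flips are the `ℛθ_{ij}`. -/
structure EStep {B : Type u} [NonUnitalCStarAlgebra B] {k : ℕ}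
    (Gm : GenSys B k) (p : Fin k) (C : CPAlg (Gm.Y p)) (Gn : GenSys C.O k) :
    Type (u + 1) where
  mm : ∀ j, (Gm.Y j).X → C.O → (Gn.Y j).X
  ecorr : ∀ j, ECorr Gm p j C (Gn.Y j) (mm j)
  rθ : ∀ i j, Nonempty (RTheta C.O C.π (Gm.Y i) (Gm.Y j) (Gm.T i j) (Gm.T j i)
    (Gm.tmul i j) (Gm.tmul j i) ((Gm.θ i j).toFun)
    (Gn.Y i) (Gn.Y j) (mm i) (mm j) (Gn.T i j) (Gn.T j i)
    (Gn.tmul i j) (Gn.tmul j i) ((Gn.θ i j).toFun))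

/-- A tower of `s` iterations of the construction `ℰ`, starting from the
generating system `G` over `B` and using pivots `start, start+1, …`. -/
def Tower (k : ℕ) : (s : ℕ) → (start : ℕ) → start + s ≤ k → (B : Type u) →
    (instB : NonUnitalCStarAlgebra B) → @GenSys B instB k → Type (u + 1)
  | 0, _, _, _, _, _ => PUnit
  | s + 1, start, h, B, instB, G =>
    letI := instB
    Σ (C : CPAlg (G.Y ⟨start, by omega⟩)) (G' : GenSys C.O k),
      EStep G ⟨start, by omega⟩ C G' ×
        Tower k s (start + 1) (by omega) C.O inferInstance G'

/-- the generating system (with its coefficient algebra) at the top of a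
tower of iterations of `ℰ` -/
def TowerLast (k : ℕ) : (s : ℕ) → (start : ℕ) → (h : start + s ≤ k) →
    (B : Type u) → (instB : NonUnitalCStarAlgebra B) →
    (G : @GenSys B instB k) → Tower k s start h B instB G →
    Σ (B' : Type u) (i' : NonUnitalCStarAlgebra B'), @GenSys B' i' k
  | 0, _, _, B, instB, G, _ => ⟨B, instB, G⟩
  | s + 1, _, _, _, instB, _, tw =>
    letI := instB
    TowerLast k s _ (by omega) _ inferInstance tw.2.1 tw.2.2.2

section Density

variable {E F : Type*} [NormedAddCommGroup E] [NormedSpace ℂ E]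
  [NormedAddCommGroup F] [NormedSpace ℂ F]

lemma clm_ext_of_dense {s : Set E} (hs : closure (Submodule.span ℂ s : Set E) = Set.univ)
    {f g : E →L[ℂ] F} (h : ∀ x ∈ s, f x = g x) : f = g := by
  refine ContinuousLinearMap.ext_on (s := s) (dense_iff_closure_eq.2 hs) ?_
  exact h

lemma mem_of_dense_span {s : Set E} (hs : closure (Submodule.span ℂ s : Set E) = Set.univ)
    (P : Submodule ℂ E) (hP : IsClosed (P : Set E)) (h : ∀ x ∈ s, x ∈ P) (x : E) : x ∈ P := by
  have h1 : (Submodule.span ℂ s : Set E) ⊆ P := Submodule.span_le.2 h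
  exact closure_minimal h1 hP (hs ▸ Set.mem_univ x)

lemma dense_span_of_subset {s t : Set E} (hs : closure (Submodule.span ℂ s : Set E) = Set.univ)
    (h : ∀ x ∈ s, x ∈ closure (Submodule.span ℂ t : Set E)) :
    closure (Submodule.span ℂ t : Set E) = Set.univ := by
  refine Set.eq_univ_of_forall fun x => ?_
  exact mem_of_dense_span hs (Submodule.span ℂ t).topologicalClosure
    (Submodule.isClosed_topologicalClosure _) h x

/-- A bare continuous linear function as a bundled map. -/
def IsCLMap.toCLM {E F : Type u} [NormedAddCommGroup E] [NormedSpace ℂ E]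
    [NormedAddCommGroup F] [NormedSpace ℂ F] {f : E → F} (hf : IsCLMap f) : E →L[ℂ] F :=
  ⟨⟨⟨f, hf.map_add⟩, hf.map_smul⟩, hf.cont⟩

end Density

lemma exists_approx_unit (A : Type u) [NonUnitalCStarAlgebra A] :
    ∃ l : Filter A, l.NeBot ∧ (∀ a, Tendsto (fun e => e * a) l (𝓝 a)) ∧
      (∀ a, Tendsto (fun e => a * e) l (𝓝 a)) ∧ ∀ᶠ e in l, ‖e‖ ≤ 1 := by
  let _ := CStarAlgebra.spectralOrder A
  have _ := CStarAlgebra.spectralOrderedRing A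
  have h := CStarAlgebra.increasingApproximateUnit A
  exact ⟨_, h.neBot, h.tendsto_mul_right, h.tendsto_mul_left, h.eventually_norm⟩

/-- An elementwise *-homomorphism as a bundled one. -/
def IsStarHom.toHom {π : A → B} (h : IsStarHom π) : A →⋆ₙₐ[ℂ] B where
  toFun := π
  map_smul' := h.map_smul
  map_zero' := by simpa using h.map_smul 0 0
  map_add' := h.map_add
  map_mul' := h.map_mul
  map_star' := h.map_star

lemma isStarHom_coe (π : A →⋆ₙₐ[ℂ] B) : IsStarHom π :=
  ⟨map_add π, map_mul π, map_star π, map_smul π⟩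

/-- A *-homomorphism of C*-algebras as a continuous linear map. -/
def homCLM (π : A →⋆ₙₐ[ℂ] B) : A →L[ℂ] B :=
  LinearMap.mkContinuous ⟨⟨π, map_add π⟩, map_smul π⟩ 1
    (fun a => by simpa using NonUnitalStarAlgHom.norm_apply_le π a)

@[simp] lemma homCLM_apply (π : A →⋆ₙₐ[ℂ] B) (a : A) : homCLM π a = π a := rfl

namespace Corr

section Basic

variable (W : Corr A)

lemma inner_add_left (x y z : W.X) : W.inner (x + y) z = W.inner x z + W.inner y z := by
  rw [← W.inner_star, W.inner_add_right, star_add, W.inner_star, W.inner_star]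

lemma inner_smul_left (c : ℂ) (x y : W.X) : W.inner (c • x) y = star c • W.inner x y := by
  rw [← W.inner_star, W.inner_smul_right, star_smul, W.inner_star]

lemma inner_ract_left (x : W.X) (a : A) (y : W.X) :
    W.inner (W.ract x a) y = star a * W.inner x y := by
  rw [← W.inner_star, W.inner_ract_right, star_mul, W.inner_star]

lemma inner_zero_right (x : W.X) : W.inner x 0 = 0 := by
  simpa using W.inner_smul_right 0 x 0

lemma inner_zero_left (x : W.X) : W.inner 0 x = 0 := by
  simpa using W.inner_smul_left 0 0 x

lemma inner_neg_right (x y : W.X) : W.inner x (-y) = -W.inner x y := by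
  simpa using W.inner_smul_right (-1) x y

lemma inner_sub_right (x y z : W.X) : W.inner x (y - z) = W.inner x y - W.inner x z := by
  rw [sub_eq_add_neg, W.inner_add_right, W.inner_neg_right, sub_eq_add_neg]

lemma inner_sub_left (x y z : W.X) : W.inner (x - y) z = W.inner x z - W.inner y z := by
  rw [← W.inner_star, W.inner_sub_right, star_sub, W.inner_star, W.inner_star]

lemma eq_zero_of_inner (x : W.X) (h : W.inner x x = 0) : x = 0 := by
  have := W.norm_eq x
  rw [h] at this
  simpa using this

lemma ext_inner (x y : W.X) (h : ∀ z, W.inner z x = W.inner z y) : x = y := by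
  rw [← sub_eq_zero]
  apply W.eq_zero_of_inner
  rw [W.inner_sub_right, h, sub_self]

lemma inner_polarization (x y : W.X) :
    (4 : ℂ) • W.inner x y = W.inner (x + y) (x + y) - W.inner (x - y) (x - y)
      - Complex.I • W.inner (x + Complex.I • y) (x + Complex.I • y)
      + Complex.I • W.inner (x - Complex.I • y) (x - Complex.I • y) := by
  simp only [W.inner_add_left, W.inner_add_right, W.inner_sub_left, W.inner_sub_right,
    W.inner_smul_left, W.inner_smul_right, smul_add, smul_sub, smul_smul]
  have hI : star Complex.I = -Complex.I := Complex.conj_I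
  simp only [hI]
  have : Complex.I * Complex.I = -1 := Complex.I_mul_I
  simp only [mul_neg, this, neg_neg, neg_smul, one_smul]
  module

lemma norm_inner_self (x : W.X) : ‖W.inner x x‖ = ‖x‖ ^ 2 := (W.norm_eq x).symm

/-- Cauchy–Schwarz up to a constant; positivity of the inner product is not needed. -/
lemma norm_inner_le (x y : W.X) : ‖W.inner x y‖ ≤ 4 * (‖x‖ * ‖y‖) := by
  have key : ∀ x y : W.X, ‖x‖ = 1 → ‖y‖ = 1 → ‖W.inner x y‖ ≤ 4 := by
    intro x y hx hy
    have h := congrArg norm (W.inner_polarization x y)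
    rw [norm_smul] at h
    have h4 : ‖(4 : ℂ)‖ = 4 := by norm_num
    rw [h4] at h
    have hb : ∀ z : W.X, ‖z‖ ≤ 2 → ‖W.inner z z‖ ≤ 4 := by
      intro z hz
      rw [W.norm_inner_self]
      nlinarith [norm_nonneg z]
    have hIy : ‖Complex.I • y‖ = 1 := by rw [norm_smul, Complex.norm_I, hy, one_mul]
    have b1 := hb (x + y) ((norm_add_le _ _).trans (by rw [hx, hy]; norm_num))
    have b2 := hb (x - y) ((norm_sub_le _ _).trans (by rw [hx, hy]; norm_num))
    have b3 := hb (x + Complex.I • y) ((norm_add_le _ _).trans (by rw [hx, hIy]; norm_num))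
    have b4 := hb (x - Complex.I • y) ((norm_sub_le _ _).trans (by rw [hx, hIy]; norm_num))
    have hn : ∀ a : A, ‖Complex.I • a‖ = ‖a‖ := fun a => by
      rw [norm_smul, Complex.norm_I, one_mul]
    have t1 := norm_add_le (W.inner (x + y) (x + y) - W.inner (x - y) (x - y)
      - Complex.I • W.inner (x + Complex.I • y) (x + Complex.I • y))
      (Complex.I • W.inner (x - Complex.I • y) (x - Complex.I • y))
    have t2 := norm_sub_le (W.inner (x + y) (x + y) - W.inner (x - y) (x - y))
      (Complex.I • W.inner (x + Complex.I • y) (x + Complex.I • y))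
    have t3 := norm_sub_le (W.inner (x + y) (x + y)) (W.inner (x - y) (x - y))
    rw [hn] at t1 t2
    linarith
  by_cases hx : x = 0
  · subst hx; simp [W.inner_zero_left]
  by_cases hy : y = 0
  · subst hy; simp [W.inner_zero_right]
  have hx' : ‖x‖ ≠ 0 := norm_ne_zero_iff.2 hx
  have hy' : ‖y‖ ≠ 0 := norm_ne_zero_iff.2 hy
  have h := key (((‖x‖⁻¹ : ℝ) : ℂ) • x) (((‖y‖⁻¹ : ℝ) : ℂ) • y)
    (by rw [norm_smul, Complex.norm_real, norm_inv, norm_norm, inv_mul_cancel₀ hx'])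
    (by rw [norm_smul, Complex.norm_real, norm_inv, norm_norm, inv_mul_cancel₀ hy'])
  rw [W.inner_smul_left, W.inner_smul_right, norm_smul, norm_smul, norm_star,
    Complex.norm_real, Complex.norm_real, norm_inv, norm_inv, norm_norm, norm_norm] at h
  have : ‖W.inner x y‖ = (‖x‖ * ‖y‖) * (‖x‖⁻¹ * (‖y‖⁻¹ * ‖W.inner x y‖)) := by
    field_simp
  rw [this, mul_comm 4]
  exact mul_le_mul_of_nonneg_left h (by positivity)

/-- `y ↦ ⟨x, y⟩` as a continuous linear map. -/
def innerR (x : W.X) : W.X →L[ℂ] A :=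
  LinearMap.mkContinuous ⟨⟨W.inner x, W.inner_add_right x⟩, fun c y => W.inner_smul_right c x y⟩
    (4 * ‖x‖) (fun y => by simpa [mul_assoc] using W.norm_inner_le x y)

@[simp] lemma innerR_apply (x y : W.X) : W.innerR x y = W.inner x y := rfl

lemma norm_ract_le (x : W.X) (a : A) : ‖W.ract x a‖ ≤ ‖x‖ * ‖a‖ := by
  have h : ‖W.ract x a‖ ^ 2 ≤ (‖x‖ * ‖a‖) ^ 2 := by
    rw [W.norm_eq, W.inner_ract_left, W.inner_ract_right]
    calc ‖star a * (W.inner x x * a)‖ ≤ ‖star a‖ * (‖W.inner x x‖ * ‖a‖) :=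
          (norm_mul_le _ _).trans (mul_le_mul_of_nonneg_left (norm_mul_le _ _) (norm_nonneg _))
      _ = _ := by rw [norm_star, W.norm_inner_self]; ring
  exact le_of_sq_le_sq h (by positivity)

/-- `x ↦ x · a` as a continuous linear map. -/
def ractL (a : A) : W.X →L[ℂ] W.X :=
  LinearMap.mkContinuous ⟨⟨fun x => W.ract x a, fun x y => W.ract_add_left x y a⟩,
    fun c x => W.ract_smul c x a⟩ ‖a‖ (fun x => by simpa [mul_comm] using W.norm_ract_le x a)

@[simp] lemma ractL_apply (x : W.X) (a : A) : W.ractL a x = W.ract x a := rfl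

lemma tendsto_ract {l : Filter A} (h : ∀ a, Tendsto (fun e => a * e) l (𝓝 a))
    (hb : ∀ᶠ e in l, ‖e‖ ≤ 1) (x : W.X) : Tendsto (fun e => W.ract x e) l (𝓝 x) := by
  have h1 : Tendsto (fun e => 2 * ‖W.inner x x * e - W.inner x x‖) l (𝓝 0) := by
    have := ((h (W.inner x x)).sub_const (W.inner x x)).norm.const_mul 2
    simpa using this
  have h2 : Tendsto (fun e => ‖W.ract x e - x‖ ^ 2) l (𝓝 0) := by
    refine squeeze_zero' (Eventually.of_forall fun e => by positivity) ?_ h1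
    filter_upwards [hb] with e he
    rw [W.norm_eq, W.inner_sub_left, W.inner_sub_right, W.inner_sub_right, W.inner_ract_left,
      W.inner_ract_left, W.inner_ract_right]
    have e1 : star e * (W.inner x x * e) - star e * W.inner x x -
        (W.inner x x * e - W.inner x x) =
        star e * (W.inner x x * e - W.inner x x) - (W.inner x x * e - W.inner x x) := by
      rw [mul_sub]
    rw [e1]
    refine (norm_sub_le _ _).trans ?_
    have := norm_mul_le (star e) (W.inner x x * e - W.inner x x)
    rw [norm_star] at this
    nlinarith [norm_nonneg (W.inner x x * e - W.inner x x)]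
  rw [tendsto_iff_norm_sub_tendsto_zero]
  have h3 := h2.sqrt
  simpa [Real.sqrt_sq] using h3

lemma dense_ract : closure (Submodule.span ℂ {y : W.X | ∃ x a, y = W.ract x a} : Set W.X)
    = Set.univ := by
  obtain ⟨l, hl, -, h, hb⟩ := exists_approx_unit A
  refine Set.eq_univ_of_forall fun x => ?_
  refine mem_closure_of_tendsto (W.tendsto_ract h hb x) (Eventually.of_forall fun e => ?_)
  exact Submodule.subset_span ⟨x, e, rfl⟩

end Basic

/-- A C*-algebra as a correspondence over itself. -/
def self (B : Type u) [NonUnitalCStarAlgebra B] : Corr B where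
  X := B
  ract x a := x * a
  inner x y := star x * y
  lactL a := ContinuousLinearMap.mul ℂ B a
  rankOne x y := ContinuousLinearMap.mul ℂ B (x * star y)
  ract_add_left x y a := add_mul x y a
  ract_add_right x a b := mul_add x a b
  ract_mul x a b := (mul_assoc x a b).symm
  ract_smul c x a := smul_mul_assoc c x a
  ract_smul' c x a := mul_smul_comm c x a
  inner_add_right x y z := mul_add _ y z
  inner_smul_right c x y := mul_smul_comm c _ y
  inner_star x y := by simp
  inner_ract_right x y a := (mul_assoc _ y a).symm
  norm_eq x := by rw [CStarRing.norm_star_mul_self, sq]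
  lact_add a b := map_add _ a b
  lact_mul a b := by ext x; simp [mul_assoc]
  lact_smul c a := map_smul _ c a
  lact_adjoint a x y := by simp [mul_assoc]
  rankOne_apply x y z := by simp [mul_assoc]

/-- Families with matching Gram matrices: a densely spanning family in one correspondence can be
mapped onto any family in another one, when the inner products match up to a bounded map. -/
lemma exists_extension {I : Type*} (W : Corr A) (Z : Corr B) (w : I → W.X) (z : I → Z.X)
    (Ψ : A →L[ℂ] B) (hd : closure (Submodule.span ℂ (Set.range w) : Set W.X) = Set.univ)
    (h : ∀ i j, Z.inner (z i) (z j) = Ψ (W.inner (w i) (w j))) :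
    ∃ f : W.X →L[ℂ] Z.X, (∀ i, f (w i) = z i) ∧
      ∀ x y, Z.inner (f x) (f y) = Ψ (W.inner x y) := by
  set Lw := Finsupp.linearCombination ℂ w
  set Lz := Finsupp.linearCombination ℂ z
  have hin : ∀ c d, Z.inner (Lz c) (Lz d) = Ψ (W.inner (Lw c) (Lw d)) := by
    intro c d
    induction c using Finsupp.induction_linear with
    | zero => simp [W.inner_zero_left, Z.inner_zero_left]
    | add f g hf hg => simp only [map_add, W.inner_add_left, Z.inner_add_left, hf, hg]
    | single i a =>
      induction d using Finsupp.induction_linear with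
      | zero => simp [W.inner_zero_right, Z.inner_zero_right]
      | add f g hf hg => simp only [map_add, W.inner_add_right, Z.inner_add_right, hf, hg]
      | single j b =>
        simp only [Lw, Lz, Finsupp.linearCombination_single, W.inner_smul_left, W.inner_smul_right,
          Z.inner_smul_left, Z.inner_smul_right, h, map_smul]
  have hbd : ∃ C, ∀ c, ‖Lz c‖ ≤ C * ‖Lw c‖ := by
    refine ⟨√‖Ψ‖, fun c => ?_⟩
    refine le_of_sq_le_sq ?_ (by positivity)
    rw [mul_pow, Real.sq_sqrt (norm_nonneg _), Z.norm_eq, W.norm_eq, hin]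
    exact Ψ.le_opNorm _
  have hdr : DenseRange Lw := by
    rw [DenseRange, dense_iff_closure_eq, ← hd]
    congr 1
    rw [← Finsupp.range_linearCombination]
    rfl
  let f := Lz.extendOfNorm Lw
  have hf : ∀ c, f (Lw c) = Lz c := LinearMap.extendOfNorm_eq hdr hbd
  have hfw : ∀ i, f (w i) = z i := fun i => by
    have := hf (Finsupp.single i 1)
    simpa [Lw, Lz, Finsupp.linearCombination_single] using this
  refine ⟨f, hfw, ?_⟩
  have hs1 : ∀ i y, Z.inner (z i) (f y) = Ψ (W.inner (w i) y) := by
    intro i y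
    have : (Z.innerR (z i)).comp f = Ψ.comp (W.innerR (w i)) :=
      clm_ext_of_dense hd (by rintro _ ⟨j, rfl⟩; simp [hfw, h])
    exact DFunLike.congr_fun this y
  intro x y
  have hP : ∀ c, Z.inner (f (Lw c)) (f y) = Ψ (W.inner (Lw c) y) := by
    intro c
    induction c using Finsupp.induction_linear with
    | zero => simp [W.inner_zero_left, Z.inner_zero_left]
    | add p q hp hq => simp only [map_add, W.inner_add_left, Z.inner_add_left, hp, hq]
    | single i a =>
      simp only [Lw, Finsupp.linearCombination_single, map_smul, hfw, W.inner_smul_left,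
        Z.inner_smul_left, hs1]
  refine hdr.induction_on (p := fun x => Z.inner (f x) (f y) = Ψ (W.inner x y)) x ?_ hP
  refine isClosed_eq ?_ ?_
  · have : (fun x => Z.inner (f x) (f y)) = fun x => star (Z.innerR (f y) (f x)) := by
      ext x; simp [Z.inner_star]
    rw [this]; fun_prop
  · have : (fun x => Ψ (W.inner x y)) = fun x => Ψ (star (W.innerR y x)) := by
      ext x; simp [W.inner_star]
    rw [this]; fun_prop

end Corr

namespace Corr

variable (W : Corr A)

lemma lact_zero : W.lactL 0 = 0 := by simpa using W.lact_smul 0 0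

/-- The left action as a non-unital algebra homomorphism. -/
def lactHom : A →ₙₐ[ℂ] (W.X →L[ℂ] W.X) where
  toFun := W.lactL
  map_smul' := W.lact_smul
  map_zero' := W.lact_zero
  map_add' := W.lact_add
  map_mul' := W.lact_mul

/-- The left action, extended to the unitization. -/
def lactUnit : Unitization ℂ A →ₐ[ℂ] (W.X →L[ℂ] W.X) := Unitization.lift W.lactHom

lemma lactUnit_apply (u : Unitization ℂ A) (x : W.X) :
    W.lactUnit u x = u.fst • x + W.lactL u.snd x := by
  simp [lactUnit, lactHom, Algebra.algebraMap_eq_smul_one]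

lemma inner_lactUnit (u : Unitization ℂ A) (x y : W.X) :
    W.inner (W.lactUnit u x) y = W.inner x (W.lactUnit (star u) y) := by
  simp only [lactUnit_apply, W.inner_add_left, W.inner_add_right, W.inner_smul_left,
    W.inner_smul_right, W.lact_adjoint, Unitization.fst_star, Unitization.snd_star]

lemma norm_lactUnit_unitary (u : unitary (Unitization ℂ A)) (x : W.X) :
    ‖W.lactUnit (u : Unitization ℂ A) x‖ = ‖x‖ := by
  have h : ‖W.lactUnit (u : Unitization ℂ A) x‖ ^ 2 = ‖x‖ ^ 2 := by
    rw [W.norm_eq, W.norm_eq, W.inner_lactUnit, ← mul_apply_eq_comp, ← map_mul,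
      Unitary.coe_star_mul_self, map_one, one_apply_eq_self]
  exact (sq_eq_sq₀ (norm_nonneg _) (norm_nonneg _)).1 h

lemma norm_lact_le (a : A) (x : W.X) : ‖W.lactL a x‖ ≤ 2 * ‖a‖ * ‖x‖ := by
  obtain ⟨u, c, h, hc⟩ := CStarAlgebra.exists_sum_four_unitary (a : Unitization ℂ A)
  have h1 : W.lactL a x = ∑ i, c i • W.lactUnit (u i : Unitization ℂ A) x := by
    have : W.lactL a x = W.lactUnit (a : Unitization ℂ A) x := by simp [lactUnit_apply]
    rw [this, h]
    simp [map_sum]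
  rw [h1]
  have ha : ‖(a : Unitization ℂ A)‖ = ‖a‖ := Unitization.norm_inr (𝕜 := ℂ) a
  calc ‖∑ i, c i • W.lactUnit (u i : Unitization ℂ A) x‖
      ≤ ∑ i : Fin 4, ‖a‖ / 2 * ‖x‖ := by
        refine norm_sum_le_of_le _ fun i _ => ?_
        rw [norm_smul, norm_lactUnit_unitary]
        exact mul_le_mul_of_nonneg_right (ha ▸ hc i) (norm_nonneg _)
    _ = 2 * ‖a‖ * ‖x‖ := by simp; ring

/-- `a ↦ a · x` as a continuous linear map. -/
def lactR (x : W.X) : A →L[ℂ] W.X :=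
  LinearMap.mkContinuous ⟨⟨fun a => W.lactL a x, fun a b => by simp [W.lact_add]⟩,
    fun c a => by simp [W.lact_smul]⟩ (2 * ‖x‖)
    (fun a => by have := W.norm_lact_le a x; simp only [LinearMap.coe_mk, AddHom.coe_mk]; linarith)

@[simp] lemma lactR_apply (x : W.X) (a : A) : W.lactR x a = W.lactL a x := rfl

lemma lact_ract (a : A) (x : W.X) (b : A) :
    W.lactL a (W.ract x b) = W.ract (W.lactL a x) b := by
  apply W.ext_inner
  intro z
  have h1 : ∀ y, W.inner z (W.lactL a y) = W.inner (W.lactL (star a) z) y := fun y => by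
    rw [W.lact_adjoint, star_star]
  rw [h1, W.inner_ract_right, W.inner_ract_right, h1]

end Corr

section Rep

variable {W : Corr A} {π : A →⋆ₙₐ[ℂ] B}

lemma norm_rep_le {t : W.X → B} (h : IsRep W π t) (x : W.X) : ‖t x‖ ≤ ‖x‖ := by
  have h2 : ‖t x‖ ^ 2 ≤ ‖x‖ ^ 2 := by
    rw [sq, ← CStarRing.norm_star_mul_self, h.inner, W.norm_eq]
    exact NonUnitalStarAlgHom.norm_apply_le π _
  exact le_of_sq_le_sq h2 (norm_nonneg _)

/-- The map of a representation as a continuous linear map. -/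
def IsRep.toCLM {t : W.X → B} (h : IsRep W π t) : W.X →L[ℂ] B :=
  LinearMap.mkContinuous ⟨⟨t, h.t_add⟩, h.t_smul⟩ 1 (fun x => by simpa using norm_rep_le h x)

@[simp] lemma IsRep.toCLM_apply {t : W.X → B} (h : IsRep W π t) (x : W.X) : h.toCLM x = t x := rfl

/-- The closed right ideal generated by the range of a map into a C*-algebra. -/
def rightIdeal {X : Type u} (t : X → B) : Submodule ℂ B :=
  (Submodule.span ℂ {d | ∃ x c, d = t x * c}).topologicalClosure

section RightIdeal

variable {X : Type u} {t : X → B}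

lemma isClosed_rightIdeal : IsClosed (rightIdeal t : Set B) :=
  Submodule.isClosed_topologicalClosure _

lemma mul_mem_rightIdeal (x : X) (c : B) : t x * c ∈ rightIdeal t :=
  Submodule.le_topologicalClosure _ (Submodule.subset_span ⟨x, c, rfl⟩)

lemma rightIdeal_induction (P : Submodule ℂ B) (hP : IsClosed (P : Set B))
    (h : ∀ x c, t x * c ∈ P) {d : B} (hd : d ∈ rightIdeal t) : d ∈ P := by
  refine Submodule.topologicalClosure_minimal _ ?_ hP hd
  rw [Submodule.span_le]
  rintro _ ⟨x, c, rfl⟩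
  exact h x c

lemma mul_right_mem_rightIdeal {d : B} (hd : d ∈ rightIdeal t) (c : B) :
    d * c ∈ rightIdeal t := by
  refine rightIdeal_induction
    ((rightIdeal t).comap ((ContinuousLinearMap.mul ℂ B).flip c).toLinearMap) ?_ ?_ hd
  · exact isClosed_rightIdeal.preimage ((ContinuousLinearMap.mul ℂ B).flip c).continuous
  · intro x e
    change t x * e * c ∈ rightIdeal t
    rw [mul_assoc]
    exact mul_mem_rightIdeal x _

end RightIdeal

lemma t_sum {t : W.X → B} (h : IsRep W π t) {ι : Type*} (s : Finset ι) (x : ι → W.X) :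
    t (∑ r ∈ s, x r) = ∑ r ∈ s, t (x r) := map_sum h.toCLM x s

lemma rankOne_adjoint (x y u v : W.X) :
    W.inner (W.rankOne x y u) v = W.inner u (W.rankOne y x v) := by
  rw [W.rankOne_apply, W.rankOne_apply, W.inner_ract_left, W.inner_ract_right, W.inner_star]

/-- Along any representation, `θ_{x,y} ↦ t(x) t(y)*` is bounded on finite-rank operators. -/
lemma norm_sum_rankOne_rep_le {t : W.X → B} (h : IsRep W π t) {ι : Type*} [Fintype ι]
    (x y : ι → W.X) :
    ‖∑ r, t (x r) * star (t (y r))‖ ≤ 2 * ‖∑ r, W.rankOne (x r) (y r)‖ := by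
  set S := ∑ r, t (x r) * star (t (y r)) with hS
  set T := ∑ r, W.rankOne (x r) (y r) with hT
  set T' := ∑ r, W.rankOne (y r) (x r) with hT'
  have hTa : ∀ z, T z = ∑ r, W.rankOne (x r) (y r) z := fun z => by
    simp [hT, _root_.sum_apply]
  have hTa' : ∀ z, T' z = ∑ r, W.rankOne (y r) (x r) z := fun z => by
    simp [hT', _root_.sum_apply]
  have hadj : ∀ u v, W.inner (T u) v = W.inner u (T' v) := by
    intro u v
    rw [← W.inner_star, hTa, hTa']
    have e1 := map_sum (W.innerR v) (fun r => W.rankOne (x r) (y r) u) Finset.univ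
    have e2 := map_sum (W.innerR u) (fun r => W.rankOne (y r) (x r) v) Finset.univ
    simp only [Corr.innerR_apply] at e1 e2
    rw [e1, e2, star_sum]
    simp only [W.inner_star, rankOne_adjoint]
  have hT'le : ∀ v, ‖T' v‖ ≤ 4 * ‖T‖ * ‖v‖ := by
    intro v
    by_cases h0 : ‖T' v‖ = 0
    · rw [h0]; positivity
    have h1 : ‖T' v‖ ^ 2 ≤ 4 * (‖T‖ * ‖T' v‖ * ‖v‖) := by
      rw [W.norm_eq, ← hadj]
      refine (W.norm_inner_le _ _).trans ?_
      gcongr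
      exact T.le_opNorm _
    have h2 : 0 < ‖T' v‖ := lt_of_le_of_ne (norm_nonneg _) (Ne.symm h0)
    refine le_of_mul_le_mul_right ?_ h2
    nlinarith
  have hSt : ∀ z, S * t z = t (T z) := by
    intro z
    rw [hTa, t_sum h, hS, Finset.sum_mul]
    refine Finset.sum_congr rfl fun r _ => ?_
    rw [mul_assoc, h.inner, W.rankOne_apply, h.ract]
  have hSt' : ∀ z, star S * t z = t (T' z) := by
    intro z
    rw [hTa', t_sum h, hS, star_sum, Finset.sum_mul]
    refine Finset.sum_congr rfl fun r _ => ?_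
    rw [star_mul, star_star, mul_assoc, h.inner, W.rankOne_apply, h.ract]
  set V := T.comp T'
  have hpow : ∀ n, ((S * star S : B) : Unitization ℂ B) ^ (n + 1) =
      ((∑ r, t ((V ^ n) (T (y r))) * star (t (x r)) : B) : Unitization ℂ B) := by
    intro n
    induction n with
    | zero =>
      have : S * star S = ∑ r, t (T (y r)) * star (t (x r)) := by
        conv_lhs => rw [hS, star_sum, ← hS, Finset.mul_sum]
        refine Finset.sum_congr rfl fun r _ => ?_
        rw [star_mul, star_star, ← mul_assoc, hSt]
      simp [this]
    | succ n ih =>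
      rw [pow_succ', ih, ← Unitization.inr_mul, Finset.mul_sum]
      congr 1
      refine Finset.sum_congr rfl fun r _ => ?_
      rw [← mul_assoc, mul_assoc S, hSt', hSt, pow_succ']
      rfl
  set K := ∑ r, ‖T (y r)‖ * ‖x r‖ with hK
  have hKnn : 0 ≤ K := Finset.sum_nonneg fun r _ => by positivity
  have hVle : ‖V‖ ≤ 4 * ‖T‖ ^ 2 := by
    refine V.opNorm_le_bound (by positivity) fun z => ?_
    calc ‖T (T' z)‖ ≤ ‖T‖ * ‖T' z‖ := T.le_opNorm _
      _ ≤ ‖T‖ * (4 * ‖T‖ * ‖z‖) := by gcongr; exact hT'le z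
      _ = _ := by ring
  have hVn : ∀ n, ∀ z, ‖(V ^ n) z‖ ≤ (4 * ‖T‖ ^ 2) ^ n * ‖z‖ := by
    intro n
    induction n with
    | zero => intro z; simp
    | succ n ih =>
      intro z
      rw [pow_succ', mul_apply_eq_comp]
      calc ‖V ((V ^ n) z)‖ ≤ ‖V‖ * ‖(V ^ n) z‖ := V.le_opNorm _
        _ ≤ (4 * ‖T‖ ^ 2) * ((4 * ‖T‖ ^ 2) ^ n * ‖z‖) := by gcongr; exact ih z
        _ = _ := by ring
  have hmain : ∀ n : ℕ, ‖S * star S‖ ^ 2 ^ n ≤ (4 * ‖T‖ ^ 2) ^ (2 ^ n - 1) * K := by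
    intro n
    have hsa : IsSelfAdjoint ((S * star S : B) : Unitization ℂ B) := by
      rw [isSelfAdjoint_iff, ← Unitization.inr_star]; simp
    have h1 := hsa.norm_pow_two_pow n
    rw [Unitization.norm_inr (𝕜 := ℂ)] at h1
    obtain ⟨m, hm⟩ : ∃ m, 2 ^ n = m + 1 := ⟨2 ^ n - 1, by have := Nat.one_le_two_pow (n := n); omega⟩
    rw [← h1, hm, hpow, Unitization.norm_inr (𝕜 := ℂ), Nat.add_sub_cancel, hK, Finset.mul_sum]
    refine norm_sum_le_of_le _ fun r _ => ?_
    refine (norm_mul_le _ _).trans ?_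
    rw [norm_star, ← mul_assoc]
    gcongr
    · exact (norm_rep_le h _).trans (hVn m _)
    · exact norm_rep_le h _
  have hfin : ‖S * star S‖ ≤ 4 * ‖T‖ ^ 2 := by
    refine le_of_forall_gt_imp_ge_of_dense fun v hv => ?_
    have hv0 : 0 < v := lt_of_le_of_lt (by positivity) hv
    by_contra! hlt
    have h1 : 1 < ‖S * star S‖ / v := (one_lt_div hv0).2 hlt
    have h2 : ∀ n : ℕ, (‖S * star S‖ / v) ^ n ≤ K / v := by
      intro n
      have hn : n ≤ 2 ^ n := Nat.lt_two_pow_self.le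
      refine (pow_le_pow_right₀ h1.le hn).trans ?_
      rw [div_pow, div_le_div_iff₀ (by positivity) hv0]
      have h3 := hmain n
      have h4 : (4 * ‖T‖ ^ 2) ^ (2 ^ n - 1) * K ≤ v ^ (2 ^ n - 1) * K := by gcongr
      calc _ ≤ v ^ (2 ^ n - 1) * K * v := by gcongr; exact h3.trans h4
        _ = K * v ^ (2 ^ n - 1 + 1) := by rw [pow_succ]; ring
        _ = _ := by rw [Nat.sub_add_cancel Nat.one_le_two_pow]
    obtain ⟨n, hn⟩ := (tendsto_pow_atTop_atTop_of_one_lt h1).eventually_gt_atTop (K / v) |>.exists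
    exact absurd (h2 n) (not_le.2 hn)
  rw [CStarRing.norm_self_mul_star] at hfin
  refine le_of_sq_le_sq ?_ (by positivity)
  nlinarith

/-- For a regular correspondence, covariance forces `π(A)` into the right ideal generated by the
module. -/
lemma mem_rightIdeal_of_CPCov {π : A → B} {t : W.X → B} (hW : W.Regular) (h : CPCov W π t) (a : A) :
    π a ∈ rightIdeal t := by
  obtain ⟨T, hT, hlim⟩ := mem_closure_iff_seq_limit.1 (hW.2 a)
  have key : ∀ T ∈ Submodule.span ℂ {T : W.X →L[ℂ] W.X | ∃ x y, T = W.rankOne x y},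
      ∃ (N : ℕ) (x y : Fin N → W.X), T = ∑ r, W.rankOne (x r) (y r) := by
    intro T hT
    obtain ⟨n, c, g, rfl⟩ := Submodule.mem_span_set'.1 hT
    choose x y hxy using fun i => (g i).2
    refine ⟨n, fun i => c i • x i, y, Finset.sum_congr rfl fun i _ => ?_⟩
    rw [hxy]
    ext z
    simp [W.rankOne_apply, W.ract_smul]
  choose N x y hxy using fun n => key (T n) (hT n)
  have h1 := h a N x y (by simpa only [← hxy] using hlim)
  refine isClosed_rightIdeal.mem_of_tendsto h1 (Eventually.of_forall fun n => ?_)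
  exact Submodule.sum_mem _ fun r _ => mul_mem_rightIdeal _ _

lemma CPCov_of_mem_rightIdeal {t : W.X → B} (h : IsRep W π t) (hr : ∀ a, π a ∈ rightIdeal t) :
    CPCov W π t := by
  intro a N x y hlim
  set S := fun n => ∑ r, t (x n r) * star (t (y n r))
  have hbound : ∀ n m, ‖S n - S m‖ ≤ 2 * ‖∑ r, W.rankOne (x n r) (y n r) -
      ∑ r, W.rankOne (x m r) (y m r)‖ := by
    intro n m
    have h1 := norm_sum_rankOne_rep_le h (ι := Fin (N n) ⊕ Fin (N m))
      (Sum.elim (x n) (fun r => -x m r)) (Sum.elim (y n) (y m))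
    have e1 : ∀ x y, W.rankOne (-x) y = -W.rankOne x y := fun x y => by
      ext z
      simpa [W.rankOne_apply] using W.ract_smul (-1) x (W.inner y z)
    have e2 : ∀ x, t (-x) = -t x := fun x => map_neg h.toCLM x
    simpa [Fintype.sum_sum_type, e1, e2, ← sub_eq_add_neg] using h1
  have hc : CauchySeq S := by
    rw [Metric.cauchySeq_iff]
    intro ε hε
    obtain ⟨M, hM⟩ := Metric.cauchySeq_iff.1 hlim.cauchySeq (ε / 2) (by positivity)
    refine ⟨M, fun n hn m hm => ?_⟩
    have := hM n hn m hm
    rw [dist_eq_norm] at this ⊢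
    linarith [hbound n m]
  obtain ⟨L, hL⟩ := cauchySeq_tendsto_of_complete hc
  have hLt : ∀ z, L * t z = π a * t z := by
    intro z
    refine tendsto_nhds_unique (hL.mul_const (t z)) ?_
    have e : ∀ n, S n * t z = h.toCLM ((∑ r, W.rankOne (x n r) (y n r)) z) := by
      intro n
      simp only [S, Finset.sum_mul, _root_.sum_apply, map_sum]
      refine Finset.sum_congr rfl fun r _ => ?_
      rw [mul_assoc, h.inner, W.rankOne_apply, h.toCLM_apply, h.ract]
    simp only [e]
    rw [← h.lact, ← h.toCLM_apply]
    exact (h.toCLM.continuous.tendsto _).comp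
      (((ContinuousLinearMap.apply ℂ W.X z).continuous.tendsto _).comp hlim)
  have hann : ∀ d ∈ rightIdeal t, (L - π a) * d = 0 := by
    intro d hd
    refine rightIdeal_induction (t := t) (ContinuousLinearMap.mul ℂ B (L - π a)).ker
      (ContinuousLinearMap.isClosed_ker _) ?_ hd
    intro z c
    change (L - π a) * (t z * c) = 0
    rw [← mul_assoc, sub_mul, hLt, sub_self, zero_mul]
  have hstar : star (L - π a) ∈ rightIdeal t := by
    rw [star_sub, ← map_star]
    refine Submodule.sub_mem _ ?_ (hr _)
    refine isClosed_rightIdeal.mem_of_tendsto hL.star (Eventually.of_forall fun n => ?_)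
    simp only [S, star_sum, star_mul, star_star]
    exact Submodule.sum_mem _ fun r _ => mul_mem_rightIdeal _ _
  have h0 := hann _ hstar
  rw [CStarRing.mul_star_self_eq_zero_iff, sub_eq_zero] at h0
  exact h0 ▸ hL

end Rep

lemma Corr.exists_extension_self {I : Type*} (W : Corr A) (w : I → W.X) (z : I → B)
    (Ψ : A →L[ℂ] B) (hd : closure (Submodule.span ℂ (Set.range w) : Set W.X) = Set.univ)
    (h : ∀ i j, star (z i) * z j = Ψ (W.inner (w i) (w j))) :
    ∃ f : W.X →L[ℂ] B, (∀ i, f (w i) = z i) ∧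
      ∀ x y, star (f x) * f y = Ψ (W.inner x y) :=
  Corr.exists_extension W (Corr.self B) w z Ψ hd h

section TensorRep

variable {W V T : Corr A} {m : W.X → V.X → T.X} {π : A →⋆ₙₐ[ℂ] B}

lemma rightIdeal_ext {X : Type u} {t : X → B} {E : Type*} [NormedAddCommGroup E]
    [NormedSpace ℂ E] {f g : B →L[ℂ] E} (h : ∀ x c, f (t x * c) = g (t x * c)) {d : B}
    (hd : d ∈ rightIdeal t) : f d = g d := by
  have := rightIdeal_induction (t := t) (f - g).ker (ContinuousLinearMap.isClosed_ker _)
    (fun x c => by change f (t x * c) - g (t x * c) = 0; rw [h, sub_self]) hd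
  exact sub_eq_zero.1 this

lemma IsTensor.dense_range (hT : IsTensor W V T m) :
    closure (Submodule.span ℂ (Set.range fun p : W.X × V.X => m p.1 p.2) : Set T.X)
      = Set.univ := by
  rw [← hT.dense]
  congr 3
  ext z
  simp [eq_comm]

lemma IsTensor.clm_ext (hT : IsTensor W V T m) {F : Type*} [NormedAddCommGroup F]
    [NormedSpace ℂ F] {f g : T.X →L[ℂ] F} (h : ∀ x y, f (m x y) = g (m x y)) : f = g :=
  clm_ext_of_dense hT.dense (by rintro _ ⟨x, y, rfl⟩; exact h x y)

/-- The tensor product of two representations with the same coefficient map. -/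
lemma IsTensor.exists_rep (hT : IsTensor W V T m) {t : W.X → B} {s : V.X → B}
    (ht : IsRep W π t) (hs : IsRep V π s) :
    ∃ μ : T.X →L[ℂ] B, (∀ x y, μ (m x y) = t x * s y) ∧ IsRep T π μ := by
  obtain ⟨μ, h1, h2⟩ := Corr.exists_extension_self T
    (fun p : W.X × V.X => m p.1 p.2) (fun p => t p.1 * s p.2) (homCLM π) hT.dense_range (by
      rintro ⟨x, y⟩ ⟨x', y'⟩
      rw [homCLM_apply]
      dsimp only
      rw [hT.inner, ← hs.inner, hs.lact, ← ht.inner, star_mul]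
      simp only [mul_assoc])
  have h1 : ∀ x y, μ (m x y) = t x * s y := fun x y => h1 (x, y)
  refine ⟨μ, h1, isStarHom_coe π, map_add μ, map_smul μ, fun a x => ?_, fun x a => ?_, h2⟩
  · refine DFunLike.congr_fun (hT.clm_ext (f := μ.comp (T.lactL a))
      (g := (ContinuousLinearMap.mul ℂ B (π a)).comp μ) fun x y => ?_) x
    change μ (T.lactL a (m x y)) = π a * μ (m x y)
    rw [hT.lact, h1, h1, ht.lact, mul_assoc]
  · refine DFunLike.congr_fun (hT.clm_ext (f := μ.comp (T.ractL a))
      (g := ((ContinuousLinearMap.mul ℂ B).flip (π a)).comp μ) fun x y => ?_) x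
    change μ (T.ract (m x y) a) = μ (m x y) * π a
    rw [hT.ract, h1, h1, hs.ract, mul_assoc]

lemma IsTensor.mem_rightIdeal {t : W.X → B} {s : V.X → B}
    (ht : IsRep W π t) (hct : ∀ a, π a ∈ rightIdeal t) (hcs : ∀ a, π a ∈ rightIdeal s)
    {μ : T.X → B} (hμ : ∀ x y, μ (m x y) = t x * s y) (a : A) : π a ∈ rightIdeal μ := by
  refine rightIdeal_induction (rightIdeal μ) isClosed_rightIdeal (fun x c => ?_) (hct a)
  refine mem_of_dense_span W.dense_ract
    ((rightIdeal μ).comap (((ContinuousLinearMap.mul ℂ B).flip c).comp ht.toCLM).toLinearMap)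
    (isClosed_rightIdeal.preimage (ContinuousLinearMap.continuous _)) ?_ x
  rintro _ ⟨x, b, rfl⟩
  change t (W.ract x b) * c ∈ rightIdeal μ
  rw [ht.ract]
  refine rightIdeal_induction ((rightIdeal μ).comap (((ContinuousLinearMap.mul ℂ B).flip c).comp
    (ContinuousLinearMap.mul ℂ B (t x))).toLinearMap)
    (isClosed_rightIdeal.preimage (ContinuousLinearMap.continuous _)) (fun y d => ?_) (hcs b)
  change t x * (s y * d) * c ∈ rightIdeal μ
  rw [← mul_assoc, ← hμ, mul_assoc]
  exact mul_mem_rightIdeal _ _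

end TensorRep

/-- Representations of the members of a generating system indexed by `J`, all with the same
coefficient map, Cuntz–Pimsner covariant and compatible with the flips. -/
structure GRep {k : ℕ} (G : GenSys A k) (J : Set (Fin k)) (D : Type u)
    [NonUnitalCStarAlgebra D] where
  π : A →⋆ₙₐ[ℂ] D
  t : ∀ j, (G.Y j).X →L[ℂ] D
  isRep : ∀ j ∈ J, IsRep (G.Y j) π (t j)
  cov : ∀ j ∈ J, ∀ a, π a ∈ rightIdeal (t j)
  comm : ∀ i ∈ J, ∀ j ∈ J, ∀ f : (G.T j i).X →L[ℂ] D,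
    (∀ y x, f (G.tmul j i y x) = t j y * t i x) →
    ∀ x y, t i x * t j y = f ((G.θ i j).toFun (G.tmul i j x y))

namespace CorrIso

variable {W Z : Corr A}

lemma norm_map (f : CorrIso W Z) (x : W.X) : ‖f.toFun x‖ = ‖x‖ := by
  have : ‖f.toFun x‖ ^ 2 = ‖x‖ ^ 2 := by rw [Z.norm_eq, W.norm_eq, f.map_inner]
  exact (pow_left_inj₀ (norm_nonneg _) (norm_nonneg _) two_ne_zero).1 this

/-- An isomorphism of correspondences as a continuous linear map. -/
def toCLM (f : CorrIso W Z) : W.X →L[ℂ] Z.X :=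
  LinearMap.mkContinuous ⟨⟨f.toFun, f.map_add⟩, f.map_smul⟩ 1 (fun x => by
    simpa using (f.norm_map x).le)

@[simp] lemma toCLM_apply (f : CorrIso W Z) (x : W.X) : f.toCLM x = f.toFun x := rfl

/-- The inverse of an isomorphism of correspondences. -/
def symm (f : CorrIso W Z) : CorrIso Z W where
  toFun := f.invFun
  invFun := f.toFun
  left_inv := f.right_inv
  right_inv := f.left_inv
  map_add x y := by
    rw [← f.left_inv (f.invFun x + f.invFun y), f.map_add, f.right_inv, f.right_inv]
  map_smul c x := by rw [← f.left_inv (c • f.invFun x), f.map_smul, f.right_inv]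
  map_inner x y := by rw [← f.map_inner, f.right_inv, f.right_inv]
  map_ract x a := by rw [← f.left_inv (W.ract (f.invFun x) a), f.map_ract, f.right_inv]
  map_lact a x := by rw [← f.left_inv (W.lactL a (f.invFun x)), f.map_lact, f.right_inv]

lemma isRep_comp {π : A →⋆ₙₐ[ℂ] B} {t : Z.X → B} (h : IsRep Z π t) (f : CorrIso W Z) :
    IsRep W π (fun x => t (f.toFun x)) where
  hom := h.hom
  t_add x y := by rw [f.map_add, h.t_add]
  t_smul c x := by rw [f.map_smul, h.t_smul]
  lact a x := by rw [f.map_lact, h.lact]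
  ract x a := by rw [f.map_ract, h.ract]
  inner x y := by rw [h.inner, f.map_inner]

lemma rightIdeal_comp {t : Z.X → B} (f : CorrIso W Z) :
    rightIdeal (fun x => t (f.toFun x)) = rightIdeal t := by
  unfold rightIdeal
  congr 2
  ext d
  constructor
  · rintro ⟨x, c, rfl⟩
    exact ⟨_, c, rfl⟩
  · rintro ⟨x, c, rfl⟩
    exact ⟨f.invFun x, c, by simp only [f.right_inv]⟩

end CorrIso

section Mixed

variable {W : Corr A} {V T : Corr A} {π : A →⋆ₙₐ[ℂ] B} {Z : Corr B}

lemma IsTensor.norm_le {m : W.X → V.X → T.X} (h : IsTensor W V T m) (x : W.X) (y : V.X) :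
    ‖m x y‖ ≤ 4 * (‖x‖ * ‖y‖) := by
  have h1 : ‖m x y‖ ^ 2 ≤ (4 * (‖x‖ * ‖y‖)) ^ 2 := by
    rw [T.norm_eq, h.inner]
    refine (V.norm_inner_le _ _).trans ?_
    have h2 := V.norm_lact_le (W.inner x x) y
    rw [W.norm_inner_self] at h2
    have h3 := mul_le_mul_of_nonneg_left h2 (norm_nonneg y)
    nlinarith [mul_nonneg (sq_nonneg ‖x‖) (sq_nonneg ‖y‖)]
  exact le_of_sq_le_sq h1 (by positivity)

/-- `x ↦ x ⊗ y` as a continuous linear map. -/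
def IsTensor.leftCLM {m : W.X → V.X → T.X} (h : IsTensor W V T m) (y : V.X) : W.X →L[ℂ] T.X :=
  LinearMap.mkContinuous ⟨⟨fun x => m x y, fun _ _ => h.add_left _ _ _⟩,
    fun _ _ => h.smul_left _ _ _⟩ (4 * ‖y‖) (fun x => by
      simpa [mul_assoc, mul_comm ‖x‖] using h.norm_le x y)

@[simp] lemma IsTensor.leftCLM_apply {m : W.X → V.X → T.X} (h : IsTensor W V T m) (x : W.X)
    (y : V.X) : h.leftCLM y x = m x y := rfl

/-- `y ↦ x ⊗ y` as a continuous linear map. -/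
def IsTensor.rightCLM {m : W.X → V.X → T.X} (h : IsTensor W V T m) (x : W.X) : V.X →L[ℂ] T.X :=
  LinearMap.mkContinuous ⟨⟨fun y => m x y, fun _ _ => h.add_right _ _ _⟩,
    fun _ _ => h.smul_right _ _ _⟩ (4 * ‖x‖) (fun y => by
      simpa [mul_assoc] using h.norm_le x y)

@[simp] lemma IsTensor.rightCLM_apply {m : W.X → V.X → T.X} (h : IsTensor W V T m) (x : W.X)
    (y : V.X) : h.rightCLM x y = m x y := rfl

lemma Corr.clm_ext_ract {F : Type*} [NormedAddCommGroup F] [NormedSpace ℂ F]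
    {f g : W.X →L[ℂ] F} (h : ∀ x a, f (W.ract x a) = g (W.ract x a)) : f = g :=
  clm_ext_of_dense W.dense_ract (by rintro _ ⟨x, a, rfl⟩; exact h x a)

lemma IsTensor.clm_ext_ract {m : W.X → V.X → T.X} (hT : IsTensor W V T m) {F : Type*}
    [NormedAddCommGroup F] [NormedSpace ℂ F] {f g : T.X →L[ℂ] F}
    (h : ∀ x a y, f (m (W.ract x a) y) = g (m (W.ract x a) y)) : f = g :=
  hT.clm_ext fun x y => DFunLike.congr_fun (Corr.clm_ext_ract (f := f.comp (hT.leftCLM y))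
    (g := g.comp (hT.leftCLM y)) fun x a => h x a y) x

namespace MixedMod

variable {m : W.X → B → Z.X}

lemma norm_le (h : MixedMod W B π Z m) (x : W.X) (S : B) : ‖m x S‖ ≤ ‖x‖ * ‖S‖ := by
  have h1 : ‖m x S‖ ^ 2 ≤ (‖x‖ * ‖S‖) ^ 2 := by
    rw [Z.norm_eq, h.inner]
    refine (norm_mul_le _ _).trans ?_
    rw [norm_star]
    have h2 : ‖π (W.inner x x)‖ ≤ ‖x‖ ^ 2 := by
      rw [← W.norm_inner_self]
      exact NonUnitalStarAlgHom.norm_apply_le π _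
    have h3 := norm_mul_le (π (W.inner x x)) S
    have h4 := mul_le_mul_of_nonneg_right h2 (norm_nonneg S)
    nlinarith [norm_nonneg S]
  exact le_of_sq_le_sq h1 (by positivity)

/-- `x ↦ x ⊗ S` as a continuous linear map. -/
def leftCLM (h : MixedMod W B π Z m) (S : B) : W.X →L[ℂ] Z.X :=
  LinearMap.mkContinuous ⟨⟨fun x => m x S, fun _ _ => h.add_left _ _ _⟩,
    fun _ _ => h.smul_left _ _ _⟩ ‖S‖ (fun x => by
      simpa [mul_comm ‖x‖] using h.norm_le x S)

@[simp] lemma leftCLM_apply (h : MixedMod W B π Z m) (x : W.X) (S : B) :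
    h.leftCLM S x = m x S := rfl

/-- `S ↦ x ⊗ S` as a continuous linear map. -/
def rightCLM (h : MixedMod W B π Z m) (x : W.X) : B →L[ℂ] Z.X :=
  LinearMap.mkContinuous ⟨⟨fun S => m x S, fun _ _ => h.add_right _ _ _⟩,
    fun _ _ => h.smul_right _ _ _⟩ ‖x‖ (fun S => h.norm_le x S)

@[simp] lemma rightCLM_apply (h : MixedMod W B π Z m) (x : W.X) (S : B) :
    h.rightCLM x S = m x S := rfl

lemma clm_ext (h : MixedMod W B π Z m) {F : Type*} [NormedAddCommGroup F] [NormedSpace ℂ F]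
    {f g : Z.X →L[ℂ] F} (hfg : ∀ x S, f (m x S) = g (m x S)) : f = g :=
  clm_ext_of_dense h.dense (by rintro _ ⟨x, y, rfl⟩; exact hfg x y)

lemma dense_range (h : MixedMod W B π Z m) :
    closure (Submodule.span ℂ (Set.range fun p : W.X × B => m p.1 p.2) : Set Z.X)
      = Set.univ := by
  rw [← h.dense]
  congr 3
  ext z
  simp [eq_comm]

end MixedMod

lemma Corr.dense_range_ract (W : Corr A) :
    closure (Submodule.span ℂ (Set.range fun p : W.X × A => W.ract p.1 p.2) : Set W.X)
      = Set.univ := by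
  rw [← W.dense_ract]
  congr 3
  ext z
  simp [eq_comm]

lemma Corr.Nondeg.clm_ext (hW : W.Nondeg) {F : Type*} [NormedAddCommGroup F] [NormedSpace ℂ F]
    {f g : W.X →L[ℂ] F} (hfg : ∀ a x, f (W.lactL a x) = g (W.lactL a x)) : f = g :=
  clm_ext_of_dense hW (by rintro _ ⟨x, y, rfl⟩; exact hfg x y)

/-- Two maps into an algebra which are right-linear over `π` agree as soon as they agree after
multiplication by `π(A)`. -/
lemma clm_eq_of_mul {f g : W.X →L[ℂ] B} (hf : ∀ x a, f (W.ract x a) = f x * π a)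
    (hg : ∀ x a, g (W.ract x a) = g x * π a) (h : ∀ x a, f x * π a = g x * π a) : f = g :=
  Corr.clm_ext_ract fun x a => by rw [hf, hg, h]

end Mixed

section Flip

variable {Yi Yj Tij Tji : Corr A} {mij : Yi.X → Yj.X → Tij.X} {mji : Yj.X → Yi.X → Tji.X}
  {π : A →⋆ₙₐ[ℂ] B} {θij : Tij.X → Tji.X} {Zi Zj : Corr B} {mmi : Yi.X → B → Zi.X}
  {mmj : Yj.X → B → Zj.X} {TZ TZr : Corr B} {mZ : Zi.X → Zj.X → TZ.X}
  {mZr : Zj.X → Zi.X → TZr.X} {R : TZ.X → TZr.X}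

/-- The inverse absorption maps intertwining a flip with its image under `ℛ`. -/
lemma RTheta.exists_absorption
    (E : RTheta B π Yi Yj Tij Tji mij mji θij Zi Zj mmi mmj TZ TZr mZ mZr R)
    (hT : IsTensor Yi Yj Tij mij) (hTr : IsTensor Yj Yi Tji mji)
    (hi : ∀ a y S, Zi.lactL (π a) (mmi y S) = mmi (Yi.lactL a y) S)
    (hj : ∀ a y S, Zj.lactL (π a) (mmj y S) = mmj (Yj.lactL a y) S) :
    ∃ (l : B → Tij.X →L[ℂ] TZ.X) (l' : B → Tji.X →L[ℂ] TZr.X),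
      (∀ x a y S, l S (mij (Yi.ract x a) y) = mZ (mmi x (π a)) (mmj y S)) ∧
      (∀ y a x S, l' S (mji (Yj.ract y a) x) = mZr (mmj y (π a)) (mmi x S)) ∧
      ∀ u S, R (l S u) = l' S (θij u) := by
  obtain ⟨hν, hνb, hν'⟩ := E.hν
  obtain ⟨hνr, hνrb, hνr'⟩ := E.hνr
  let e := ContinuousLinearEquiv.ofBijective hν.toCLM
    (LinearMap.ker_eq_bot.2 hνb.1) (LinearMap.range_eq_top.2 hνb.2)
  let er := ContinuousLinearEquiv.ofBijective hνr.toCLM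
    (LinearMap.ker_eq_bot.2 hνrb.1) (LinearMap.range_eq_top.2 hνrb.2)
  have he : ∀ z, E.ν (e.symm z) = z := fun z => e.apply_symm_apply z
  have her : ∀ z, E.νr (er.symm z) = z := fun z => er.apply_symm_apply z
  refine ⟨fun S => (e.symm : E.Pl.X →L[ℂ] TZ.X).comp (E.hq.leftCLM S),
    fun S => (er.symm : E.Pr.X →L[ℂ] TZr.X).comp (E.hqr.leftCLM S), ?_, ?_, ?_⟩
  · intro x a y S
    apply hνb.1
    refine (he _).trans ?_
    rw [hν', hj]
    change E.q _ _ = _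
    rw [hT.balanced, E.q_compat]
  · intro y a x S
    apply hνrb.1
    refine (her _).trans ?_
    rw [hνr', hi]
    change E.qr _ _ = _
    rw [hTr.balanced, E.q_compatr]
  · intro u S
    apply hνrb.1
    rw [E.hR]
    refine Eq.trans ?_ (her _).symm
    refine (congrArg E.Θ (he _)).trans ?_
    exact E.hΘ.2 _ _

end Flip

section Universal

variable {W : Corr A}

/-- The coefficient embedding of a Cuntz–Pimsner algebra as a *-homomorphism. -/
def CPAlg.piHom (C : CPAlg W) : A →⋆ₙₐ[ℂ] C.O := C.isRep.hom.toHom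

@[simp] lemma CPAlg.piHom_apply (C : CPAlg W) (a : A) : C.piHom a = C.π a := rfl

lemma CPAlg.isRep_piHom (C : CPAlg W) : IsRep W C.piHom C.t := C.isRep

lemma CPAlg.mem_rightIdeal_t (C : CPAlg W) (hW : W.Regular) (a : A) :
    C.piHom a ∈ rightIdeal C.t :=
  mem_rightIdeal_of_CPCov hW C.covariant a

/-- A closed subspace closed under multiplication which contains the generators and their adjoints
exhausts the Cuntz–Pimsner algebra. -/
lemma CPAlg.induction (C : CPAlg W) (S : Set C.O) (hS : IsClosed S)
    (hπ : ∀ a, C.π a ∈ S) (ht : ∀ x, C.t x ∈ S) (ht' : ∀ x, star (C.t x) ∈ S)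
    (hadd : ∀ p q, p ∈ S → q ∈ S → p + q ∈ S) (hmul : ∀ p q, p ∈ S → q ∈ S → p * q ∈ S)
    (hsmul : ∀ (c : ℂ) p, p ∈ S → c • p ∈ S) (z : C.O) : z ∈ S := by
  refine (C.gen (S ∩ star ⁻¹' S) (hS.inter (hS.preimage continuous_star)) ?_ ?_ ?_ ?_ ?_ ?_ z).1
  · refine fun a => ⟨hπ a, ?_⟩
    change star (C.π a) ∈ S
    rw [← C.isRep.hom.map_star]
    exact hπ _
  · exact fun x => ⟨ht x, ht' x⟩
  · refine fun p q hp hq => ⟨hadd _ _ hp.1 hq.1, ?_⟩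
    change star (p + q) ∈ S
    rw [star_add]
    exact hadd _ _ hp.2 hq.2
  · refine fun p q hp hq => ⟨hmul _ _ hp.1 hq.1, ?_⟩
    change star (p * q) ∈ S
    rw [star_mul]
    exact hmul _ _ hq.2 hp.2
  · refine fun c p hp => ⟨hsmul _ _ hp.1, ?_⟩
    change star (c • p) ∈ S
    rw [star_smul]
    exact hsmul _ _ hp.2
  · exact fun p hp => ⟨hp.2, by simpa using hp.1⟩

lemma mem_rightIdeal_self (π : A →⋆ₙₐ[ℂ] B) (a : A) : π a ∈ rightIdeal π := by
  obtain ⟨l, hl, h1, -⟩ := exists_approx_unit A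
  refine isClosed_rightIdeal.mem_of_tendsto
    (((homCLM π).continuous.tendsto _).comp (h1 a)) (Eventually.of_forall fun e => ?_)
  simp only [Function.comp, homCLM_apply, map_mul]
  exact mul_mem_rightIdeal _ _

lemma CPAlg.mem_rightIdeal_pi (C : CPAlg W) (hW : W.Nondeg) (b : C.O) :
    b ∈ rightIdeal C.piHom := by
  refine C.induction (rightIdeal C.piHom) isClosed_rightIdeal (mem_rightIdeal_self C.piHom)
    (fun x => ?_) (fun x => ?_) (fun p q hp hq => Submodule.add_mem _ hp hq)
    (fun p q hp _ => mul_right_mem_rightIdeal hp q) (fun c p hp => Submodule.smul_mem _ c hp) b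
  · refine mem_of_dense_span hW
      ((rightIdeal C.piHom).comap C.isRep_piHom.toCLM.toLinearMap)
      (isClosed_rightIdeal.preimage (ContinuousLinearMap.continuous _)) ?_ x
    rintro _ ⟨a, x, rfl⟩
    change C.t (W.lactL a x) ∈ rightIdeal C.piHom
    rw [C.isRep.lact]
    exact mul_mem_rightIdeal (t := C.piHom) a _
  · have h : IsClosed {x | star (C.t x) ∈ rightIdeal C.piHom} :=
      isClosed_rightIdeal.preimage (continuous_star.comp C.isRep_piHom.toCLM.continuous)
    refine mem_of_dense_span W.dense_ract
      { carrier := {x | star (C.t x) ∈ rightIdeal C.piHom}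
        add_mem' := fun {x y} hx hy => ?_
        zero_mem' := ?_
        smul_mem' := fun c x hx => ?_ } h ?_ x
    · change star (C.t (x + y)) ∈ rightIdeal C.piHom
      rw [C.isRep.t_add, star_add]
      exact Submodule.add_mem _ hx hy
    · change star (C.isRep_piHom.toCLM 0) ∈ rightIdeal C.piHom
      rw [map_zero, star_zero]
      exact Submodule.zero_mem _
    · change star (C.t (c • x)) ∈ rightIdeal C.piHom
      rw [C.isRep.t_smul, star_smul]
      exact Submodule.smul_mem _ _ hx
    · rintro _ ⟨x, a, rfl⟩
      change star (C.t (W.ract x a)) ∈ rightIdeal C.piHom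
      rw [C.isRep.ract, star_mul, ← C.isRep.hom.map_star]
      exact mul_mem_rightIdeal (t := C.piHom) _ _

lemma CPAlg.hom_ext {C : CPAlg W} {D : Type u} [NonUnitalCStarAlgebra D]
    {f g : C.O →⋆ₙₐ[ℂ] D} (hπ : ∀ a, f (C.π a) = g (C.π a)) (ht : ∀ x, f (C.t x) = g (C.t x))
    (z : C.O) : f z = g z := by
  refine C.induction {z | f z = g z}
    (isClosed_eq (homCLM f).continuous (homCLM g).continuous) hπ ht (fun x => ?_)
    (fun p q hp hq => ?_) (fun p q hp hq => ?_) (fun c p hp => ?_) z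
  · simp only [Set.mem_ofPred_eq, map_star, ht]
  all_goals simp_all

end Universal

/-- The representation `r` of `G` and the representation `r'` of an absorbed system `G'` determine
each other along `ρ` and the maps `m`. -/
structure GRep.Linked {k : ℕ} {G : GenSys A k} {G' : GenSys B k} {D : Type u}
    [NonUnitalCStarAlgebra D] {J J' : Set (Fin k)} (ρ : A →⋆ₙₐ[ℂ] B)
    (m : ∀ j, (G.Y j).X → B → (G'.Y j).X) (r : GRep G J D) (r' : GRep G' J' D) : Prop where
  pi : ∀ a, r.π a = r'.π (ρ a)
  mul : ∀ j ∈ J', ∀ y S, r.t j y * r'.π S = r'.t j (m j y S)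

lemma comm_symm {k : ℕ} {G : GenSys A k} {D : Type u} [NonUnitalCStarAlgebra D]
    {π : A →⋆ₙₐ[ℂ] D} {i j : Fin k} {ti : (G.Y i).X → D} {tj : (G.Y j).X → D}
    (hi : IsRep (G.Y i) π ti) (hj : IsRep (G.Y j) π tj)
    (h : ∀ f : (G.T j i).X →L[ℂ] D, (∀ y x, f (G.tmul j i y x) = tj y * ti x) →
      ∀ x y, ti x * tj y = f ((G.θ i j).toFun (G.tmul i j x y)))
    (f : (G.T i j).X →L[ℂ] D) (hf : ∀ x y, f (G.tmul i j x y) = ti x * tj y)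
    (y : (G.Y j).X) (x : (G.Y i).X) :
    tj y * ti x = f ((G.θ j i).toFun (G.tmul j i y x)) := by
  obtain ⟨g, hg, -⟩ := (G.isTensor j i).exists_rep hj hi
  have e : f = g.comp (G.θ i j).toCLM := (G.isTensor i j).clm_ext fun x y => by
    rw [hf, h g hg]
    rfl
  rw [e]
  change _ = g ((G.θ i j).toFun ((G.θ j i).toFun (G.tmul j i y x)))
  rw [G.θ_symm, hg]

section AbsorbComm

variable {Yi Yj Tij Tji : Corr A} {mij : Yi.X → Yj.X → Tij.X} {mji : Yj.X → Yi.X → Tji.X}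
  {ρ : A →⋆ₙₐ[ℂ] B} {Zi Zj : Corr B} {mmi : Yi.X → B → Zi.X}
  {mmj : Yj.X → B → Zj.X} {TZr : Corr B}
  {mZr : Zj.X → Zi.X → TZr.X} {D : Type u} [NonUnitalCStarAlgebra D] {ϖ : B →⋆ₙₐ[ℂ] D}

lemma absorption_apply (hTr : IsTensor Yj Yi Tji mji)
    {l' : Tji.X →L[ℂ] TZr.X} {S : B}
    (hl' : ∀ y a x, l' (mji (Yj.ract y a) x) = mZr (mmj y (ρ a)) (mmi x S))
    {ti : Yi.X → D} {tj : Yj.X → D} {τi : Zi.X → D} {τj : Zj.X → D}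
    (hi : ∀ x S, ti x * ϖ S = τi (mmi x S)) (hj : ∀ x S, tj x * ϖ S = τj (mmj x S))
    (hjr : ∀ y a, tj (Yj.ract y a) = tj y * ϖ (ρ a))
    {f : Tji.X →L[ℂ] D} (hf : ∀ y x, f (mji y x) = tj y * ti x)
    {f' : TZr.X →L[ℂ] D} (hf' : ∀ η ξ, f' (mZr η ξ) = τj η * τi ξ) (v : Tji.X) :
    f' (l' v) = f v * ϖ S := by
  refine DFunLike.congr_fun (hTr.clm_ext_ract (f := f'.comp l')
    (g := ((ContinuousLinearMap.mul ℂ D).flip (ϖ S)).comp f) fun y a x => ?_) v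
  change f' (l' (mji (Yj.ract y a) x)) = f (mji (Yj.ract y a) x) * ϖ S
  rw [hl', hf', ← hi, ← hj, hf, hjr]
  simp only [mul_assoc]

end AbsorbComm

section OneStep

variable {k : ℕ} {G : GenSys A k} {p : Fin k} {C : CPAlg (G.Y p)} {D : Type u}
  [NonUnitalCStarAlgebra D]

/-- A representation of `Y` extends to its absorption when it is compatible with a representation
of the pivot. -/
lemma ECorrData.exists_rep {Y T T' : Corr A} {mT : (G.Y p).X → Y.X → T.X}
    {mT' : Y.X → (G.Y p).X → T'.X} {θ : T.X → T'.X} {Z : Corr C.O} {m : Y.X → C.O → Z.X}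
    (E : ECorrData (G.Y p) Y T mT T' mT' θ C Z m) (hY : Y.Nondeg) (hT' : IsTensor Y (G.Y p) T' mT')
    (ϖ : C.O →⋆ₙₐ[ℂ] D) {t : Y.X → D} (ht : IsRep Y (ϖ.comp C.piHom) t)
    (hc : ∀ f : T'.X →L[ℂ] D, (∀ y u, f (mT' y u) = t y * ϖ (C.t u)) →
      ∀ x y, ϖ (C.t x) * t y = f (θ (mT x y))) :
    ∃ τ : Z.X →L[ℂ] D, IsRep Z ϖ τ ∧ ∀ y S, t y * ϖ S = τ (m y S) := by
  have mod : MixedMod Y C.O C.piHom Z m := E.mod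
  obtain ⟨τ, h1, h2⟩ := Z.exists_extension_self (fun q : Y.X × C.O => m q.1 q.2)
    (fun q => t q.1 * ϖ q.2) (homCLM ϖ) mod.dense_range (by
      rintro ⟨x, S⟩ ⟨y, S'⟩
      rw [homCLM_apply]
      dsimp only
      rw [mod.inner, star_mul, map_mul, map_mul, map_star]
      have := ht.inner x y
      rw [NonUnitalStarAlgHom.comp_apply] at this
      rw [← this]
      simp only [mul_assoc])
  have h1 : ∀ y S, τ (m y S) = t y * ϖ S := fun y S => h1 (y, S)
  have hpi : ∀ a z, τ (Z.lactL (C.π a) z) = ϖ (C.π a) * τ z := by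
    intro a z
    refine DFunLike.congr_fun (mod.clm_ext (f := τ.comp (Z.lactL (C.π a)))
      (g := (ContinuousLinearMap.mul ℂ D (ϖ (C.π a))).comp τ) fun y S => ?_) z
    change τ (Z.lactL (C.π a) (m y S)) = ϖ (C.π a) * τ (m y S)
    rw [E.lact_pi, h1, h1, ht.lact, mul_assoc]
    rfl
  have htt : ∀ x z, τ (Z.lactL (C.t x) z) = ϖ (C.t x) * τ z := by
    obtain ⟨μ, hμ, hμ1, hμ2⟩ := E.lact_t
    have hp : IsRep (G.Y p) (ϖ.comp C.piHom) fun x => ϖ (C.t x) :=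
      { hom := isStarHom_coe _
        t_add := fun x y => by rw [C.isRep.t_add, map_add]
        t_smul := fun c x => by rw [C.isRep.t_smul, map_smul]
        lact := fun a x => by rw [C.isRep.lact, map_mul]; rfl
        ract := fun x a => by rw [C.isRep.ract, map_mul]; rfl
        inner := fun x y => by rw [← map_star, ← map_mul, C.isRep.inner]; rfl }
    obtain ⟨f, hf, -⟩ := hT'.exists_rep ht hp
    have hfμ : ∀ v S, τ (μ v S) = f v * ϖ S := by
      intro v S
      refine DFunLike.congr_fun (hT'.clm_ext (f := τ.comp (hμ S).toCLM)
        (g := ((ContinuousLinearMap.mul ℂ D).flip (ϖ S)).comp f) fun y u => ?_) v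
      change τ (μ (mT' y u) S) = f (mT' y u) * ϖ S
      rw [hμ1, h1, hf, map_mul, mul_assoc]
    intro x z
    refine DFunLike.congr_fun (mod.clm_ext (f := τ.comp (Z.lactL (C.t x)))
      (g := (ContinuousLinearMap.mul ℂ D (ϖ (C.t x))).comp τ) fun y S => ?_) z
    change τ (Z.lactL (C.t x) (m y S)) = ϖ (C.t x) * τ (m y S)
    rw [hμ2, hfμ, h1, ← hc f hf, mul_assoc]
  have hst : ∀ x z, τ (Z.lactL (star (C.t x)) z) = ϖ (star (C.t x)) * τ z := by
    intro x z
    have key : ∀ (b : C.O) (z : Z.X), b ∈ rightIdeal C.t →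
        τ (Z.lactL (star (C.t x)) (Z.lactL b z)) = ϖ (star (C.t x)) * τ (Z.lactL b z) := by
      intro b z hb
      refine rightIdeal_ext (t := C.t)
        (f := (τ.comp (Z.lactL (star (C.t x)))).comp (Z.lactR z))
        (g := ((ContinuousLinearMap.mul ℂ D (ϖ (star (C.t x)))).comp τ).comp (Z.lactR z))
        (fun x' c => ?_) hb
      change τ (Z.lactL (star (C.t x)) (Z.lactL (C.t x' * c) z)) =
        ϖ (star (C.t x)) * τ (Z.lactL (C.t x' * c) z)
      have e : Z.lactL (star (C.t x)) (Z.lactL (C.t x' * c) z) =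
          Z.lactL (C.π ((G.Y p).inner x x')) (Z.lactL c z) := by
        rw [← C.isRep.inner, Z.lact_mul, Z.lact_mul]
        rfl
      rw [e, hpi, ← C.isRep.inner, Z.lact_mul, map_mul, mul_assoc]
      congr 1
      exact (htt _ _).symm
    refine DFunLike.congr_fun (mod.clm_ext (f := τ.comp (Z.lactL (star (C.t x))))
      (g := (ContinuousLinearMap.mul ℂ D (ϖ (star (C.t x)))).comp τ) fun y S => ?_) z
    refine DFunLike.congr_fun (hY.clm_ext
      (f := (τ.comp (Z.lactL (star (C.t x)))).comp (mod.leftCLM S))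
      (g := ((ContinuousLinearMap.mul ℂ D (ϖ (star (C.t x)))).comp τ).comp (mod.leftCLM S))
      fun a y => ?_) y
    change τ (Z.lactL (star (C.t x)) (m (Y.lactL a y) S)) =
      ϖ (star (C.t x)) * τ (m (Y.lactL a y) S)
    rw [← E.lact_pi]
    exact key _ _ (C.mem_rightIdeal_t (G.reg p).2 a)
  have hall : ∀ b z, τ (Z.lactL b z) = ϖ b * τ z := by
    intro b
    refine C.induction {b | ∀ z, τ (Z.lactL b z) = ϖ b * τ z} ?_ hpi htt hst
      (fun b c hb hc z => ?_) (fun b c hb hc z => ?_) (fun c b hb z => ?_) b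
    · rw [Set.ofPred_forall]
      exact isClosed_iInter fun z => isClosed_eq (τ.comp (Z.lactR z)).continuous
        (((ContinuousLinearMap.mul ℂ D).flip (τ z)).comp (homCLM ϖ)).continuous
    · rw [Z.lact_add, map_add, add_mul, ← hb, ← hc, ← map_add]
      rfl
    · rw [Z.lact_mul, map_mul, mul_assoc, ← hc, ← hb]
      rfl
    · rw [Z.lact_smul, map_smul, smul_mul_assoc, ← hb, ← map_smul]
      rfl
  refine ⟨τ, ⟨isStarHom_coe ϖ, map_add τ, map_smul τ, hall, fun z S => ?_, h2⟩,
    fun y S => (h1 y S).symm⟩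
  refine DFunLike.congr_fun (mod.clm_ext (f := τ.comp (Z.ractL S))
      (g := ((ContinuousLinearMap.mul ℂ D).flip (ϖ S)).comp τ) fun y T => ?_) z
  change τ (Z.ract (m y T) S) = τ (m y T) * ϖ S
  rw [mod.ract, h1, h1, map_mul, mul_assoc]

lemma absorbed_mem_rightIdeal {Y : Corr A} {Z : Corr B} {ρ : A →⋆ₙₐ[ℂ] B} {m : Y.X → B → Z.X}
    {ϖ : B →⋆ₙₐ[ℂ] D} {t : Y.X → D} (ht : IsRep Y (ϖ.comp ρ) t) {τ : Z.X → D}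
    (hτ : ∀ y S, t y * ϖ S = τ (m y S)) (hρ : ∀ b, b ∈ rightIdeal ρ)
    (hc : ∀ a, ϖ (ρ a) ∈ rightIdeal t) (b : B) : ϖ b ∈ rightIdeal τ := by
  have h1 : ∀ y d, t y * d ∈ rightIdeal τ := by
    intro y d
    refine mem_of_dense_span Y.dense_ract
      ((rightIdeal τ).comap (((ContinuousLinearMap.mul ℂ D).flip d).comp ht.toCLM).toLinearMap)
      (isClosed_rightIdeal.preimage (ContinuousLinearMap.continuous _)) ?_ y
    rintro _ ⟨y, a, rfl⟩
    change t (Y.ract y a) * d ∈ rightIdeal τ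
    rw [ht.ract, NonUnitalStarAlgHom.comp_apply, hτ]
    exact mul_mem_rightIdeal _ _
  refine rightIdeal_induction ((rightIdeal τ).comap (homCLM ϖ).toLinearMap)
    (isClosed_rightIdeal.preimage (ContinuousLinearMap.continuous _)) (fun a c => ?_) (hρ b)
  change ϖ (ρ a * c) ∈ rightIdeal τ
  rw [map_mul]
  refine mul_right_mem_rightIdeal ?_ _
  exact rightIdeal_induction (rightIdeal τ) isClosed_rightIdeal h1 (hc a)

end OneStep

section OneStepSystem

variable {k : ℕ} {G : GenSys A k} {p : Fin k} {C : CPAlg (G.Y p)} {Gn : GenSys C.O k}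
  {D : Type u} [NonUnitalCStarAlgebra D] {J : Set (Fin k)}

/-- A representation of a generating system induces one of the absorbed system. -/
lemma EStep.forward (E : EStep G p C Gn) (r : GRep G (insert p J) D) :
    ∃ r' : GRep Gn J D, GRep.Linked C.piHom E.mm r r' ∧ ∀ x, r.t p x = r'.π (C.t x) := by
  have hpJ : p ∈ insert p J := Set.mem_insert _ _
  have hJ : ∀ j ∈ J, j ∈ insert p J := fun j hj => Set.mem_insert_of_mem _ hj
  obtain ⟨ϖ, ⟨hϖ, hϖt⟩, -⟩ := C.universal D r.π (r.t p) (r.isRep p hpJ)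
    (CPCov_of_mem_rightIdeal (r.isRep p hpJ) (r.cov p hpJ))
  have hπ : r.π = ϖ.comp C.piHom := NonUnitalStarAlgHom.ext fun a => (hϖ a).symm
  have key : ∀ j, ∃ τ : (Gn.Y j).X →L[ℂ] D, j ∈ J → IsRep (Gn.Y j) ϖ τ ∧
      ∀ y S, r.t j y * ϖ S = τ (E.mm j y S) := by
    intro j
    by_cases hj : j ∈ J
    · obtain ⟨τ, hτ⟩ := (E.ecorr j).exists_rep (G.reg j).1 (G.isTensor j p) ϖ
        (hπ ▸ r.isRep j (hJ j hj)) (fun f hf x y => by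
          rw [hϖt]
          exact r.comm p hpJ j (hJ j hj) f (fun y u => by rw [hf, hϖt]) x y)
      exact ⟨τ, fun _ => hτ⟩
    · exact ⟨0, fun h => absurd h hj⟩
  choose τ hτ using key
  have mod : ∀ j, MixedMod (G.Y j) C.O C.piHom (Gn.Y j) (E.mm j) := fun j => (E.ecorr j).mod
  refine ⟨⟨ϖ, τ, fun j hj => (hτ j hj).1, fun j hj => ?_, fun i hi j hj f' hf' => ?_⟩,
    ⟨fun a => (hϖ a).symm, fun j hj => (hτ j hj).2⟩, fun x => (hϖt x).symm⟩
  · exact absorbed_mem_rightIdeal (hπ ▸ r.isRep j (hJ j hj)) (hτ j hj).2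
      (C.mem_rightIdeal_pi (G.reg p).1) (fun a => (hϖ a).symm ▸ r.cov j (hJ j hj) a)
  · obtain ⟨R⟩ := E.rθ i j
    obtain ⟨l, l', h1, h2, h3⟩ := RTheta.exists_absorption (π := C.piHom) R (G.isTensor i j)
      (G.isTensor j i) (E.ecorr i).lact_pi (E.ecorr j).lact_pi
    obtain ⟨f, hf, -⟩ := (G.isTensor j i).exists_rep (r.isRep j (hJ j hj)) (r.isRep i (hJ i hi))
    have hf'l : ∀ S v, f' (l' S v) = f v * ϖ S := fun S v =>
      absorption_apply (G.isTensor j i) (hl' := fun y a x => h2 y a x S)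
        (hτ i hi).2 (hτ j hj).2 (fun y a => by rw [(r.isRep j (hJ j hj)).ract, hπ]; rfl) hf hf' v
    obtain ⟨g, hg, -⟩ := (Gn.isTensor i j).exists_rep (hτ i hi).1 (hτ j hj).1
    suffices h : g = f'.comp ((Gn.θ i j).toCLM) by
      intro ξ η
      rw [← hg, h]
      rfl
    refine (Gn.isTensor i j).clm_ext fun ξ η => ?_
    refine DFunLike.congr_fun ((mod i).clm_ext (f := g.comp ((Gn.isTensor i j).leftCLM η))
      (g := (f'.comp (Gn.θ i j).toCLM).comp ((Gn.isTensor i j).leftCLM η)) fun x S₀ => ?_) ξ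
    refine DFunLike.congr_fun (Corr.clm_ext_ract
      (f := (g.comp ((Gn.isTensor i j).leftCLM η)).comp ((mod i).leftCLM S₀))
      (g := ((f'.comp (Gn.θ i j).toCLM).comp ((Gn.isTensor i j).leftCLM η)).comp
        ((mod i).leftCLM S₀)) fun x a => ?_) x
    change g (Gn.tmul i j (E.mm i ((G.Y i).ract x a) S₀) η) =
      f' ((Gn.θ i j).toFun (Gn.tmul i j (E.mm i ((G.Y i).ract x a) S₀) η))
    rw [(mod i).balanced, ← (mod i).ract, (Gn.isTensor i j).balanced]
    generalize (Gn.Y j).lactL S₀ η = η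
    refine DFunLike.congr_fun ((mod j).clm_ext
      (f := g.comp ((Gn.isTensor i j).rightCLM (E.mm i x (C.piHom a))))
      (g := (f'.comp (Gn.θ i j).toCLM).comp
        ((Gn.isTensor i j).rightCLM (E.mm i x (C.piHom a)))) fun y S => ?_) η
    change g (Gn.tmul i j (E.mm i x (C.piHom a)) (E.mm j y S)) =
      f' ((Gn.θ i j).toFun (Gn.tmul i j (E.mm i x (C.piHom a)) (E.mm j y S)))
    rw [hg, ← h1, h3, hf'l, ← r.comm i (hJ i hi) j (hJ j hj) f hf, ← (hτ i hi).2,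
      ← (hτ j hj).2, (r.isRep i (hJ i hi)).ract, hπ]
    simp only [mul_assoc]
    rfl

lemma exists_pullback {Y : Corr A} {Z : Corr B} {ρ : A →⋆ₙₐ[ℂ] B} {m : Y.X → B → Z.X}
    (mod : MixedMod Y B ρ Z m) (hl : ∀ a y S, Z.lactL (ρ a) (m y S) = m (Y.lactL a y) S)
    {ϖ : B →⋆ₙₐ[ℂ] D} {τ : Z.X → D} (hτ : IsRep Z ϖ τ) :
    ∃ t : Y.X →L[ℂ] D, IsRep Y (ϖ.comp ρ) t ∧ ∀ y S, t y * ϖ S = τ (m y S) := by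
  obtain ⟨t, h1, h2⟩ := Y.exists_extension_self (fun q : Y.X × A => Y.ract q.1 q.2)
    (fun q => τ (m q.1 (ρ q.2))) (homCLM (ϖ.comp ρ)) Y.dense_range_ract (by
      rintro ⟨x, a⟩ ⟨y, b⟩
      dsimp only
      rw [hτ.inner, mod.inner, homCLM_apply, NonUnitalStarAlgHom.comp_apply, Y.inner_ract_right,
        Y.inner_ract_left]
      simp only [map_mul, map_star, mul_assoc])
  have h1 : ∀ y a, t (Y.ract y a) = τ (m y (ρ a)) := fun y a => h1 (y, a)
  have h3 : ∀ y S, t y * ϖ S = τ (m y S) := by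
    intro y S
    refine DFunLike.congr_fun (Corr.clm_ext_ract
      (f := ((ContinuousLinearMap.mul ℂ D).flip (ϖ S)).comp t)
      (g := hτ.toCLM.comp (mod.leftCLM S)) fun y a => ?_) y
    change t (Y.ract y a) * ϖ S = τ (m (Y.ract y a) S)
    rw [h1, mod.balanced, ← mod.ract, hτ.ract]
  refine ⟨t, ⟨isStarHom_coe _, map_add t, map_smul t, fun b y => ?_, fun y a => ?_, h2⟩, h3⟩
  · refine DFunLike.congr_fun (Corr.clm_ext_ract
      (f := t.comp (Y.lactL b))
      (g := (ContinuousLinearMap.mul ℂ D (ϖ (ρ b))).comp t) fun y a => ?_) y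
    change t (Y.lactL b (Y.ract y a)) = ϖ (ρ b) * t (Y.ract y a)
    rw [Y.lact_ract, h1, h1, ← hl, hτ.lact]
  · rw [h1, ← h3]
    rfl

end OneStepSystem

section OneStepBackward

variable {k : ℕ} {G : GenSys A k} {p : Fin k} {C : CPAlg (G.Y p)} {Gn : GenSys C.O k}
  {D : Type u} [NonUnitalCStarAlgebra D] {J : Set (Fin k)}

lemma CPAlg.isRep_comp {W : Corr A} (C : CPAlg W) (ϖ : C.O →⋆ₙₐ[ℂ] D) :
    IsRep W (ϖ.comp C.piHom) fun x => ϖ (C.t x) where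
  hom := isStarHom_coe _
  t_add x y := by rw [C.isRep.t_add, map_add]
  t_smul c x := by rw [C.isRep.t_smul, map_smul]
  lact a x := by rw [C.isRep.lact, map_mul]; rfl
  ract x a := by rw [C.isRep.ract, map_mul]; rfl
  inner x y := by rw [← map_star, ← map_mul, C.isRep.inner]; rfl

lemma CPAlg.mem_rightIdeal_comp {W : Corr A} (C : CPAlg W) (hW : W.Regular)
    (ϖ : C.O →⋆ₙₐ[ℂ] D) (a : A) : ϖ (C.π a) ∈ rightIdeal fun x => ϖ (C.t x) := by
  refine rightIdeal_induction
    ((rightIdeal fun x => ϖ (C.t x)).comap (homCLM ϖ).toLinearMap)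
    (isClosed_rightIdeal.preimage (ContinuousLinearMap.continuous _)) (fun x c => ?_)
    (C.mem_rightIdeal_t hW a)
  change ϖ (C.t x * c) ∈ rightIdeal fun x => ϖ (C.t x)
  rw [map_mul]
  exact mul_mem_rightIdeal (t := fun x => ϖ (C.t x)) x _

lemma pulledBack_mem_rightIdeal {Y : Corr A} {Z : Corr B} {ρ : A →⋆ₙₐ[ℂ] B}
    {m : Y.X → B → Z.X} (mod : MixedMod Y B ρ Z m) {ϖ : B →⋆ₙₐ[ℂ] D} {τ : Z.X → D}
    (hτ : IsRep Z ϖ τ) {t : Y.X → D} (h : ∀ y S, t y * ϖ S = τ (m y S))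
    (hc : ∀ b, ϖ b ∈ rightIdeal τ) (a : A) : ϖ (ρ a) ∈ rightIdeal t := by
  refine rightIdeal_induction (rightIdeal t) isClosed_rightIdeal (fun z d => ?_) (hc (ρ a))
  refine mem_of_dense_span mod.dense
    ((rightIdeal t).comap (((ContinuousLinearMap.mul ℂ D).flip d).comp hτ.toCLM).toLinearMap)
    (isClosed_rightIdeal.preimage (ContinuousLinearMap.continuous _)) ?_ z
  rintro _ ⟨y, S, rfl⟩
  change τ (m y S) * d ∈ rightIdeal t
  rw [← h, mul_assoc]
  exact mul_mem_rightIdeal _ _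

lemma IsTensor.map_ract {W V T : Corr A} {m : W.X → V.X → T.X} (hT : IsTensor W V T m)
    {π : A →⋆ₙₐ[ℂ] D} {t : W.X → D} {s : V.X → D} (hs : IsRep V π s) {f : T.X →L[ℂ] D}
    (hf : ∀ x y, f (m x y) = t x * s y) (u : T.X) (a : A) : f (T.ract u a) = f u * π a := by
  refine DFunLike.congr_fun (hT.clm_ext (f := f.comp (T.ractL a))
    (g := ((ContinuousLinearMap.mul ℂ D).flip (π a)).comp f) fun x y => ?_) u
  change f (T.ract (m x y) a) = f (m x y) * π a
  rw [hT.ract, hf, hf, hs.ract, mul_assoc]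

/-- A criterion for the compatibility of two representations with a flip which only needs to be
checked after multiplication by the coefficient algebra. -/
lemma comm_of_mul {k : ℕ} {G : GenSys A k} {π : A →⋆ₙₐ[ℂ] D} {i j : Fin k}
    {ti : (G.Y i).X → D} {tj : (G.Y j).X → D} (hi : IsRep (G.Y i) π ti) (hj : IsRep (G.Y j) π tj)
    {f : (G.T j i).X →L[ℂ] D} (hf : ∀ y x, f (G.tmul j i y x) = tj y * ti x)
    (h : ∀ x b y a, ti ((G.Y i).ract x b) * tj y * π a =
      f ((G.θ i j).toFun (G.tmul i j ((G.Y i).ract x b) y)) * π a)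
    (x : (G.Y i).X) (y : (G.Y j).X) :
    ti x * tj y = f ((G.θ i j).toFun (G.tmul i j x y)) := by
  obtain ⟨g, hg, -⟩ := (G.isTensor i j).exists_rep hi hj
  rw [← hg]
  refine DFunLike.congr_fun (clm_eq_of_mul (f := g) (g := f.comp (G.θ i j).toCLM) (π := π)
    ((G.isTensor i j).map_ract hj hg) (fun u a => ?_) fun u a => ?_) _
  · change f ((G.θ i j).toFun ((G.T i j).ract u a)) = f ((G.θ i j).toFun u) * π a
    rw [(G.θ i j).map_ract, (G.isTensor j i).map_ract hi hf]
  · refine DFunLike.congr_fun ((G.isTensor i j).clm_ext_ract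
      (f := ((ContinuousLinearMap.mul ℂ D).flip (π a)).comp g)
      (g := ((ContinuousLinearMap.mul ℂ D).flip (π a)).comp (f.comp (G.θ i j).toCLM))
      fun x b y => ?_) u
    change g (G.tmul i j _ y) * π a = f ((G.θ i j).toFun _) * π a
    rw [hg, h]

/-- A representation of the absorbed system restricts to one of the original system. -/
lemma EStep.backward (E : EStep G p C Gn) (hp : p ∉ J) (r' : GRep Gn J D) :
    ∃ r : GRep G (insert p J) D, GRep.Linked C.piHom E.mm r r' ∧ ∀ x, r.t p x = r'.π (C.t x) := by
  set ϖ := r'.π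
  have key : ∀ j, ∃ t : (G.Y j).X →L[ℂ] D,
      (j ∈ J → IsRep (G.Y j) (ϖ.comp C.piHom) t ∧ ∀ y S, t y * ϖ S = r'.t j (E.mm j y S)) ∧
      ∀ (h : p = j) (x : (G.Y p).X), t (h ▸ x) = ϖ (C.t x) := by
    intro j
    by_cases hj : j ∈ J
    · obtain ⟨t, ht⟩ := exists_pullback (ρ := C.piHom) (E.ecorr j).mod (E.ecorr j).lact_pi
        (r'.isRep j hj)
      exact ⟨t, fun _ => ht, fun h => absurd (h ▸ hj) hp⟩
    · by_cases h : p = j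
      · subst h
        exact ⟨(C.isRep_comp ϖ).toCLM, fun h => absurd h hj, fun _ _ => rfl⟩
      · exact ⟨0, fun h => absurd h hj, fun h' => absurd h' h⟩
  choose t ht htp using key
  have htp : ∀ x, t p x = ϖ (C.t x) := htp p rfl
  have htp' : (t p : (G.Y p).X → D) = fun x => ϖ (C.t x) := funext htp
  have mod : ∀ j, MixedMod (G.Y j) C.O C.piHom (Gn.Y j) (E.mm j) := fun j => (E.ecorr j).mod
  have hrep : ∀ j ∈ insert p J, IsRep (G.Y j) (ϖ.comp C.piHom) (t j) := by
    rintro j (rfl | hj)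
    · rw [htp']
      exact C.isRep_comp ϖ
    · exact (ht j hj).1
  have hpp := hrep p (Set.mem_insert _ _)
  have comm_p : ∀ j ∈ J, ∀ f : (G.T j p).X →L[ℂ] D,
      (∀ y x, f (G.tmul j p y x) = t j y * t p x) →
      ∀ x y, t p x * t j y = f ((G.θ p j).toFun (G.tmul p j x y)) := by
    intro j hj f hf
    refine comm_of_mul hpp (ht j hj).1 hf fun x b y a => ?_
    generalize (G.Y p).ract x b = x
    obtain ⟨μ, hμ, hμ1, hμ2⟩ := (E.ecorr j).lact_t
    have hfμ : ∀ v S, r'.t j (μ v S) = f v * ϖ S := by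
      intro v S
      refine DFunLike.congr_fun ((G.isTensor j p).clm_ext (f := (r'.t j).comp (hμ S).toCLM)
        (g := ((ContinuousLinearMap.mul ℂ D).flip (ϖ S)).comp f) fun y u => ?_) v
      change r'.t j (μ (G.tmul j p y u) S) = f (G.tmul j p y u) * ϖ S
      rw [hμ1, hf, htp, ← (ht j hj).2, map_mul, mul_assoc]
    rw [NonUnitalStarAlgHom.comp_apply, ← hfμ, ← hμ2, (r'.isRep j hj).lact, mul_assoc,
      (ht j hj).2, htp]
  refine ⟨⟨ϖ.comp C.piHom, t, hrep, ?_, ?_⟩, ⟨fun a => rfl, fun j hj => (ht j hj).2⟩, htp⟩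
  · rintro j (rfl | hj) a
    · rw [htp']
      exact C.mem_rightIdeal_comp (G.reg j).2 ϖ a
    · exact pulledBack_mem_rightIdeal (mod j) (r'.isRep j hj) (ht j hj).2 (r'.cov j hj) a
  · rintro i (rfl | hi) j (rfl | hj)
    · intro f hf x y
      rw [G.θ_diag, hf]
    · exact comm_p j hj
    · exact fun f hf x y => comm_symm hpp (hrep i (Set.mem_insert_of_mem _ hi)) (comm_p i hi) f
        (fun x y => hf x y) x y
    · intro f hf
      refine comm_of_mul (ht i hi).1 (ht j hj).1 hf fun x b y a => ?_
      obtain ⟨R⟩ := E.rθ i j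
      obtain ⟨l, l', h1, h2, h3⟩ := RTheta.exists_absorption (π := C.piHom) R (G.isTensor i j)
        (G.isTensor j i) (E.ecorr i).lact_pi (E.ecorr j).lact_pi
      obtain ⟨f', hf', -⟩ := (Gn.isTensor j i).exists_rep (r'.isRep j hj) (r'.isRep i hi)
      have hf'l : ∀ S v, f' (l' S v) = f v * ϖ S := fun S v =>
        absorption_apply (G.isTensor j i) (hl' := fun y a x => h2 y a x S)
          (ht i hi).2 (ht j hj).2 (fun y a => (ht j hj).1.ract y a) hf hf' v
      rw [NonUnitalStarAlgHom.comp_apply, ← hf'l, ← h3, h1,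
        ← r'.comm i hi j hj f' hf', ← (ht i hi).2, ← (ht j hj).2, (ht i hi).1.ract]
      simp only [mul_assoc]
      rfl

end OneStepBackward

section Absorption

variable {k : ℕ}

/-- Restriction of a representation to a smaller index set. -/
def GRep.mono {G : GenSys A k} {J J' : Set (Fin k)} {D : Type u} [NonUnitalCStarAlgebra D]
    (h : J ⊆ J') (r : GRep G J' D) : GRep G J D where
  π := r.π
  t := r.t
  isRep j hj := r.isRep j (h hj)
  cov j hj := r.cov j (h hj)
  comm i hi j hj := r.comm i (h hi) j (h hj)

/-- A *-homomorphism as a representation indexed by the empty set. -/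
def GRep.ofHom (G : GenSys A k) {D : Type u} [NonUnitalCStarAlgebra D] (π : A →⋆ₙₐ[ℂ] D) :
    GRep G ∅ D where
  π := π
  t _ := 0
  isRep _ h := h.elim
  cov _ h := h.elim
  comm _ h := h.elim

/-- The generating system `G'` over `B` arises from `G` by absorbing the members indexed by
`piv`: its coefficient algebra `B` is generated by `A` and by the pivots, its members are the
mixed tensor products `G.Y j ⊗ B`, and the representations of the two systems correspond to each
other. -/
structure Absorption (piv : Set (Fin k)) (G : GenSys A k) (G' : GenSys B k) where
  ρ : A →⋆ₙₐ[ℂ] B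
  t : ∀ j, (G.Y j).X → B
  m : ∀ j, (G.Y j).X → B → (G'.Y j).X
  gen : ∀ S : Set B, IsClosed S → (∀ a, ρ a ∈ S) → (∀ q ∈ piv, ∀ x, t q x ∈ S) →
    (∀ p q, p ∈ S → q ∈ S → p + q ∈ S) → (∀ p q, p ∈ S → q ∈ S → p * q ∈ S) →
    (∀ (c : ℂ) p, p ∈ S → c • p ∈ S) → (∀ p, p ∈ S → star p ∈ S) → ∀ z, z ∈ S
  mod : ∀ j, MixedMod (G.Y j) B ρ (G'.Y j) (m j)
  lact_pi : ∀ j a y S, (G'.Y j).lactL (ρ a) (m j y S) = m j ((G.Y j).lactL a y) S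
  lact_t : ∀ q ∈ piv, ∀ j b (f : (G.T j q).X →L[ℂ] (G'.Y j).X),
    (∀ y u, f (G.tmul j q y u) = m j y (t q u * b)) →
    ∀ x y, (G'.Y j).lactL (t q x) (m j y b) = f ((G.θ q j).toFun (G.tmul q j x y))
  forward : ∀ {D : Type u} [NonUnitalCStarAlgebra D] (J : Set (Fin k)) (r : GRep G (piv ∪ J) D),
    ∃ r' : GRep G' J D, GRep.Linked ρ m r r' ∧ ∀ q ∈ piv, ∀ x, r.t q x = r'.π (t q x)
  backward : ∀ {D : Type u} [NonUnitalCStarAlgebra D] (J : Set (Fin k)), (∀ j ∈ J, j ∉ piv) →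
    ∀ r' : GRep G' J D, ∃ r : GRep G (piv ∪ J) D,
      GRep.Linked ρ m r r' ∧ ∀ q ∈ piv, ∀ x, r.t q x = r'.π (t q x)

lemma Absorption.isRep {piv : Set (Fin k)} {G : GenSys A k} {G' : GenSys B k}
    (E : Absorption piv G G') {q : Fin k} (hq : q ∈ piv) : IsRep (G.Y q) E.ρ (E.t q) := by
  obtain ⟨r, h1, h2⟩ := E.backward ∅ (fun _ h => h.elim)
    (GRep.ofHom G' (NonUnitalStarAlgHom.id ℂ B))
  have h3 := r.isRep q (Or.inl hq)
  have e1 : r.π = E.ρ := NonUnitalStarAlgHom.ext fun a => h1.pi a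
  have e2 : (r.t q : _ → B) = E.t q := funext fun x => h2 q hq x
  rwa [e1, e2] at h3

/-- The absorption of nothing. -/
def Absorption.refl (G : GenSys A k) {piv : Set (Fin k)} (h : ∀ q, q ∉ piv) :
    Absorption piv G G where
  ρ := NonUnitalStarAlgHom.id ℂ A
  t _ _ := 0
  m j := (G.Y j).ract
  gen S _ h _ _ _ _ _ := h
  mod j :=
    { add_left := (G.Y j).ract_add_left
      add_right := (G.Y j).ract_add_right
      smul_left := fun c x a => (G.Y j).ract_smul c x a
      smul_right := fun c x a => (G.Y j).ract_smul' c x a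
      balanced := fun x a S => ((G.Y j).ract_mul x a S).symm
      ract := fun x S T => ((G.Y j).ract_mul x S T).symm
      inner := fun x S y T => by
        rw [(G.Y j).inner_ract_right, (G.Y j).inner_ract_left, mul_assoc]
        rfl
      dense := by
        rw [← (G.Y j).dense_ract] }
  lact_pi j a y S := (G.Y j).lact_ract a y S
  lact_t q hq := absurd hq (h q)
  forward J r := ⟨r.mono Set.subset_union_right, ⟨fun _ => rfl, fun j hj y S =>
    ((r.isRep j (Or.inr hj)).ract y S).symm⟩, fun q hq => absurd hq (h q)⟩
  backward J _ r' := ⟨r'.mono (fun q hq => hq.resolve_left (h q)), ⟨fun _ => rfl,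
    fun j hj y S => ((r'.isRep j hj).ract y S).symm⟩, fun q hq => absurd hq (h q)⟩

/-- Transitivity of the mixed tensor product. -/
lemma MixedMod.exists_comp {W : Corr A} {ρ₁ : A →⋆ₙₐ[ℂ] B} {Z : Corr B} {m₁ : W.X → B → Z.X}
    (h₁ : MixedMod W B ρ₁ Z m₁) (hl₁ : ∀ a y S, Z.lactL (ρ₁ a) (m₁ y S) = m₁ (W.lactL a y) S)
    {O : Type u} [NonUnitalCStarAlgebra O] {ρ₂ : B →⋆ₙₐ[ℂ] O} {V : Corr O} {m₂ : Z.X → O → V.X}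
    (h₂ : MixedMod Z O ρ₂ V m₂) (hl₂ : ∀ a y S, V.lactL (ρ₂ a) (m₂ y S) = m₂ (Z.lactL a y) S) :
    ∃ m : W.X → O → V.X, MixedMod W O (ρ₂.comp ρ₁) V m ∧
      (∀ a y S, V.lactL (ρ₂ (ρ₁ a)) (m y S) = m (W.lactL a y) S) ∧
      ∀ y S b, m y (ρ₂ S * b) = m₂ (m₁ y S) b := by
  have key : ∀ b : O, ∃ f : W.X →L[ℂ] V.X, ∀ y a, f (W.ract y a) = m₂ (m₁ y (ρ₁ a)) b := by
    intro b
    obtain ⟨f, hf, -⟩ := Corr.exists_extension W V (fun q : W.X × A => W.ract q.1 q.2)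
      (fun q => m₂ (m₁ q.1 (ρ₁ q.2)) b)
      ((ContinuousLinearMap.mul ℂ O (star b)).comp
        (((ContinuousLinearMap.mul ℂ O).flip b).comp (homCLM (ρ₂.comp ρ₁))))
      W.dense_range_ract (by
        rintro ⟨x, a⟩ ⟨y, a'⟩
        change V.inner (m₂ (m₁ x (ρ₁ a)) b) (m₂ (m₁ y (ρ₁ a')) b) =
          star b * (ρ₂ (ρ₁ (W.inner (W.ract x a) (W.ract y a'))) * b)
        rw [h₂.inner, h₁.inner, W.inner_ract_left, W.inner_ract_right]
        simp only [map_mul, map_star])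
    exact ⟨f, fun y a => hf (y, a)⟩
  choose m hm using key
  have h3 : ∀ y S b, m (ρ₂ S * b) y = m₂ (m₁ y S) b := by
    intro y S b
    refine DFunLike.congr_fun (Corr.clm_ext_ract (f := m (ρ₂ S * b))
      (g := (h₂.leftCLM b).comp (h₁.leftCLM S)) fun y a => ?_) y
    change _ = m₂ (m₁ (W.ract y a) S) b
    rw [hm, h₁.balanced, ← h₁.ract, h₂.balanced]
  refine ⟨fun y b => m b y, ⟨fun x x' S => map_add _ _ _, fun x S S' => ?_,
    fun c x S => map_smul _ _ _, fun c x S => ?_, fun x a S => ?_, fun x S T => ?_,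
    fun x S y T => ?_, ?_⟩, fun a y S => ?_, h3⟩
  · refine DFunLike.congr_fun (Corr.clm_ext_ract (f := m (S + S')) (g := m S + m S')
      fun y a => ?_) x
    simp only [add_apply, hm, h₂.add_right]
  · refine DFunLike.congr_fun (Corr.clm_ext_ract (f := m (c • S)) (g := c • m S)
      fun y a => ?_) x
    simp only [smul_apply, hm, h₂.smul_right]
  · rw [NonUnitalStarAlgHom.comp_apply, h3, hm]
  · refine DFunLike.congr_fun (Corr.clm_ext_ract (f := (V.ractL T).comp (m S)) (g := m (S * T))
      fun y a => ?_) x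
    change V.ract (m S _) T = _
    rw [hm, hm, h₂.ract]
  · have e1 : ∀ x a y a', V.inner (m S (W.ract x a)) (m T (W.ract y a')) =
        star S * (ρ₂ (ρ₁ (W.inner (W.ract x a) (W.ract y a'))) * T) := by
      intro x a y a'
      rw [hm, hm, h₂.inner, h₁.inner, W.inner_ract_left, W.inner_ract_right]
      simp only [map_mul, map_star]
    have e2 : ∀ x a y, V.inner (m S (W.ract x a)) (m T y) =
        star S * (ρ₂ (ρ₁ (W.inner (W.ract x a) y)) * T) := by
      intro x a y
      refine DFunLike.congr_fun (Corr.clm_ext_ract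
        (f := (V.innerR (m S (W.ract x a))).comp (m T))
        (g := (ContinuousLinearMap.mul ℂ O (star S)).comp
          (((ContinuousLinearMap.mul ℂ O).flip T).comp ((homCLM (ρ₂.comp ρ₁)).comp
            (W.innerR (W.ract x a))))) fun y a' => e1 x a y a') y
    rw [← star_inj, V.inner_star, star_mul, star_mul, ← map_star, NonUnitalStarAlgHom.comp_apply,
      W.inner_star, star_star, mul_assoc]
    refine DFunLike.congr_fun (Corr.clm_ext_ract
        (f := (V.innerR (m T y)).comp (m S))
        (g := (ContinuousLinearMap.mul ℂ O (star T)).comp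
          (((ContinuousLinearMap.mul ℂ O).flip S).comp ((homCLM (ρ₂.comp ρ₁)).comp
            (W.innerR y)))) fun x a => ?_) x
    change V.inner (m T y) (m S (W.ract x a)) =
      star T * (ρ₂ (ρ₁ (W.inner y (W.ract x a))) * S)
    rw [← star_inj, V.inner_star, e2]
    simp only [star_mul, ← map_star, W.inner_star, star_star, mul_assoc]
  · refine dense_span_of_subset h₂.dense ?_
    rintro _ ⟨z, b, rfl⟩
    refine mem_of_dense_span h₁.dense
      ((Submodule.span ℂ {z | ∃ x S, z = m S x}).topologicalClosure.comap
        (h₂.leftCLM b).toLinearMap)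
      ((Submodule.isClosed_topologicalClosure _).preimage (ContinuousLinearMap.continuous _)) ?_ z
    rintro _ ⟨y, S, rfl⟩
    refine Submodule.le_topologicalClosure _ (Submodule.subset_span ⟨y, ρ₂ S * b, ?_⟩)
    rw [h3]
    rfl
  · refine DFunLike.congr_fun (Corr.clm_ext_ract (f := (V.lactL (ρ₂ (ρ₁ a))).comp (m S))
      (g := (m S).comp (W.lactL a)) fun y a' => ?_) y
    change V.lactL _ (m S (W.ract y a')) = m S (W.lactL a (W.ract y a'))
    rw [W.lact_ract, hm, hm, hl₂, hl₁]

end Absorption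

section AbsorptionStep

variable {k : ℕ}

lemma IsTensor.exists_mixed {W V T : Corr A} {m : W.X → V.X → T.X} (hT : IsTensor W V T m)
    {ρ : A →⋆ₙₐ[ℂ] B} {Z : Corr B} {mm : W.X → B → Z.X} (mod : MixedMod W B ρ Z mm)
    {t : V.X → B} (ht : IsRep V ρ t) (b : B) :
    ∃ f : T.X →L[ℂ] Z.X, ∀ y u, f (m y u) = mm y (t u * b) := by
  obtain ⟨f, hf, -⟩ := Corr.exists_extension T Z (fun q : W.X × V.X => m q.1 q.2)
    (fun q => mm q.1 (t q.2 * b))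
    ((ContinuousLinearMap.mul ℂ B (star b)).comp
      (((ContinuousLinearMap.mul ℂ B).flip b).comp (homCLM ρ))) hT.dense_range (by
      rintro ⟨y, u⟩ ⟨y', u'⟩
      change Z.inner (mm y (t u * b)) (mm y' (t u' * b)) =
        star b * (ρ (T.inner (m y u) (m y' u')) * b)
      rw [mod.inner, hT.inner, ← ht.inner, ht.lact, star_mul]
      simp only [mul_assoc])
  exact ⟨f, fun y u => hf (y, u)⟩

lemma GRep.Linked.mono {G : GenSys A k} {G' : GenSys B k} {D : Type u}
    [NonUnitalCStarAlgebra D] {J₀ J J' : Set (Fin k)} {ρ : A →⋆ₙₐ[ℂ] B}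
    {m : ∀ j, (G.Y j).X → B → (G'.Y j).X} {r : GRep G J D} {r' : GRep G' J' D}
    (h : GRep.Linked ρ m r r') (h₀ : J₀ ⊆ J) : GRep.Linked ρ m (r.mono h₀) r' :=
  ⟨h.pi, h.mul⟩

lemma GRep.Linked.of_mono {G : GenSys A k} {G' : GenSys B k} {D : Type u}
    [NonUnitalCStarAlgebra D] {J₀ J J' : Set (Fin k)} {ρ : A →⋆ₙₐ[ℂ] B}
    {m : ∀ j, (G.Y j).X → B → (G'.Y j).X} {r : GRep G J D} {r' : GRep G' J' D} {h₀ : J₀ ⊆ J}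
    (h : GRep.Linked ρ m (r.mono h₀) r') : GRep.Linked ρ m r r' :=
  ⟨h.pi, h.mul⟩

/-- Consecutive links between representations compose. -/
lemma GRep.Linked.comp {C : Type u} [NonUnitalCStarAlgebra C] {G : GenSys A k} {G₁ : GenSys B k}
    {G₂ : GenSys C k} {D : Type u} [NonUnitalCStarAlgebra D] {J₀ J₁ J₂ : Set (Fin k)}
    {ρ₁ : A →⋆ₙₐ[ℂ] B} {ρ₂ : B →⋆ₙₐ[ℂ] C} {m₁ : ∀ j, (G.Y j).X → B → (G₁.Y j).X}
    {m₂ : ∀ j, (G₁.Y j).X → C → (G₂.Y j).X} {m : ∀ j, (G.Y j).X → C → (G₂.Y j).X}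
    (hm : ∀ j, MixedMod (G.Y j) C (ρ₂.comp ρ₁) (G₂.Y j) (m j))
    (hmm : ∀ j y S b, m j y (ρ₂ S * b) = m₂ j (m₁ j y S) b)
    {r : GRep G J₀ D} {r₁ : GRep G₁ J₁ D} {r₂ : GRep G₂ J₂ D}
    (h₁ : GRep.Linked ρ₁ m₁ r r₁) (h₂ : GRep.Linked ρ₂ m₂ r₁ r₂)
    (h₀ : J₂ ⊆ J₀) (h : J₂ ⊆ J₁) : GRep.Linked (ρ₂.comp ρ₁) m r r₂ where
  pi a := by rw [h₁.pi, h₂.pi]; rfl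
  mul j hj y S := by
    refine DFunLike.congr_fun (Corr.clm_ext_ract
      (f := ((ContinuousLinearMap.mul ℂ D).flip (r₂.π S)).comp (r.isRep j (h₀ hj)).toCLM)
      (g := (r₂.isRep j hj).toCLM.comp ((hm j).leftCLM S)) fun y a => ?_) y
    change r.t j ((G.Y j).ract y a) * r₂.π S = r₂.t j (m j ((G.Y j).ract y a) S)
    rw [(r.isRep j (h₀ hj)).ract, (hm j).balanced, NonUnitalStarAlgHom.comp_apply, hmm,
      ← h₂.mul j hj, ← h₁.mul j (h hj), h₁.pi]

/-- If `r` and `s` are linked to representations which agree on a member, then they agree on that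
member as well. -/
lemma GRep.Linked.apply_eq {G : GenSys A k} {G₁ : GenSys B k} {C D : Type u}
    [NonUnitalCStarAlgebra C] [NonUnitalCStarAlgebra D] {J₀ J₁ J₀' J₁' : Set (Fin k)}
    {ρ₁ : A →⋆ₙₐ[ℂ] B} {m₁ : ∀ j, (G.Y j).X → B → (G₁.Y j).X}
    {r : GRep G J₀ D} {r₁ : GRep G₁ J₁ D} (h₁ : GRep.Linked ρ₁ m₁ r r₁)
    {s : GRep G J₀' C} {s₁ : GRep G₁ J₁' C} (h₂ : GRep.Linked ρ₁ m₁ s s₁) (ϖ : C →⋆ₙₐ[ℂ] D)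
    {q : Fin k} (hq₀ : q ∈ J₀) (hq₁ : q ∈ J₁) (hq₀' : q ∈ J₀') (hq₁' : q ∈ J₁')
    (h : ∀ x, r₁.t q x = ϖ (s₁.t q x)) (x : (G.Y q).X) : r.t q x = ϖ (s.t q x) := by
  refine DFunLike.congr_fun (Corr.clm_ext_ract (f := (r.isRep q hq₀).toCLM)
    (g := (homCLM ϖ).comp (s.isRep q hq₀').toCLM) fun x a => ?_) x
  change r.t q ((G.Y q).ract x a) = ϖ (s.t q ((G.Y q).ract x a))
  rw [(r.isRep q hq₀).ract, (s.isRep q hq₀').ract, h₁.pi, h₂.pi, h₁.mul q hq₁, h₂.mul q hq₁', h]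

variable {G : GenSys A k} {p : Fin k} {C : CPAlg (G.Y p)} {G₁ : GenSys C.O k}

/-- The left action by the first pivot on the twofold absorption. -/
lemma EStep.lact_pivot (E : EStep G p C G₁) {piv : Set (Fin k)} {G' : GenSys B k}
    (F : Absorption piv G₁ G') {j : Fin k} {m : (G.Y j).X → B → (G'.Y j).X}
    (hm : MixedMod (G.Y j) B (F.ρ.comp C.piHom) (G'.Y j) m)
    (hmm : ∀ y S b, m y (F.ρ S * b) = F.m j (E.mm j y S) b) (b : B)
    (f : (G.T j p).X →L[ℂ] (G'.Y j).X)
    (hf : ∀ y u, f (G.tmul j p y u) = m y (F.ρ (C.t u) * b)) (x : (G.Y p).X) (y : (G.Y j).X) :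
    (G'.Y j).lactL (F.ρ (C.t x)) (m y b) = f ((G.θ p j).toFun (G.tmul p j x y)) := by
  refine DFunLike.congr_fun (Corr.clm_ext_ract
    (f := ((G'.Y j).lactL (F.ρ (C.t x))).comp (hm.leftCLM b))
    (g := (f.comp (G.θ p j).toCLM).comp ((G.isTensor p j).rightCLM x)) fun y a => ?_) y
  change (G'.Y j).lactL (F.ρ (C.t x)) (m ((G.Y j).ract y a) b) =
    f ((G.θ p j).toFun (G.tmul p j x ((G.Y j).ract y a)))
  obtain ⟨μ, hμ, hμ1, hμ2⟩ := (E.ecorr j).lact_t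
  have key : ∀ v, F.m j (μ v (C.π a)) b = f ((G.T j p).ract v a) := by
    intro v
    refine DFunLike.congr_fun ((G.isTensor j p).clm_ext
      (f := ((F.mod j).leftCLM b).comp (hμ (C.π a)).toCLM)
      (g := f.comp ((G.T j p).ractL a)) fun y u => ?_) v
    change F.m j (μ (G.tmul j p y u) (C.π a)) b = f ((G.T j p).ract (G.tmul j p y u) a)
    rw [hμ1, (G.isTensor j p).ract, hf, C.isRep.ract, hmm]
  rw [hm.balanced, NonUnitalStarAlgHom.comp_apply, hmm, F.lact_pi, C.piHom_apply, hμ2, key,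
    ← (G.θ p j).map_ract, (G.isTensor p j).ract]

/-- The left action by a later pivot on the twofold absorption. -/
lemma EStep.lact_later (E : EStep G p C G₁) {piv : Set (Fin k)} {G' : GenSys B k}
    (F : Absorption piv G₁ G') {m : ∀ j, (G.Y j).X → B → (G'.Y j).X}
    (hm : ∀ j, MixedMod (G.Y j) B (F.ρ.comp C.piHom) (G'.Y j) (m j))
    (hmm : ∀ j y S b, m j y (F.ρ S * b) = F.m j (E.mm j y S) b) {q : Fin k} (hq : q ∈ piv)
    {t : (G.Y q).X → B} (ht : IsRep (G.Y q) (F.ρ.comp C.piHom) t)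
    (ht' : ∀ x S, t x * F.ρ S = F.t q (E.mm q x S)) (j : Fin k) (b : B)
    (f : (G.T j q).X →L[ℂ] (G'.Y j).X)
    (hf : ∀ y u, f (G.tmul j q y u) = m j y (t u * b)) (x : (G.Y q).X) (y : (G.Y j).X) :
    (G'.Y j).lactL (t x) (m j y b) = f ((G.θ q j).toFun (G.tmul q j x y)) := by
  refine DFunLike.congr_fun (Corr.clm_ext_ract
    (f := ((G'.Y j).lactL (t x)).comp ((hm j).leftCLM b))
    (g := (f.comp (G.θ q j).toCLM).comp ((G.isTensor q j).rightCLM x)) fun y c => ?_) y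
  change (G'.Y j).lactL (t x) (m j ((G.Y j).ract y c) b) =
    f ((G.θ q j).toFun (G.tmul q j x ((G.Y j).ract y c)))
  refine DFunLike.congr_fun (Corr.clm_ext_ract
    (f := ((G'.Y j).lactR (m j ((G.Y j).ract y c) b)).comp ht.toCLM)
    (g := (f.comp (G.θ q j).toCLM).comp ((G.isTensor q j).leftCLM ((G.Y j).ract y c)))
    fun x a => ?_) x
  change (G'.Y j).lactL (t ((G.Y q).ract x a)) (m j ((G.Y j).ract y c) b) =
    f ((G.θ q j).toFun (G.tmul q j ((G.Y q).ract x a) ((G.Y j).ract y c)))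
  obtain ⟨f₂, hf₂⟩ := (G₁.isTensor j q).exists_mixed (F.mod j) (F.isRep hq) b
  obtain ⟨R⟩ := E.rθ q j
  obtain ⟨l, l', h1, h2, h3⟩ := RTheta.exists_absorption (π := C.piHom) R (G.isTensor q j)
    (G.isTensor j q) (E.ecorr q).lact_pi (E.ecorr j).lact_pi
  have key : ∀ v, f₂ (l' (C.π c) v) = f ((G.T j q).ract v c) := by
    intro v
    refine DFunLike.congr_fun ((G.isTensor j q).clm_ext_ract (f := f₂.comp (l' (C.π c)))
      (g := f.comp ((G.T j q).ractL c)) fun y a u => ?_) v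
    change f₂ (l' (C.π c) (G.tmul j q ((G.Y j).ract y a) u)) =
      f ((G.T j q).ract (G.tmul j q ((G.Y j).ract y a) u) c)
    rw [h2, hf₂, ← ht', (G.isTensor j q).ract, hf, ht.ract, (hm j).balanced,
      NonUnitalStarAlgHom.comp_apply, hmm]
    rfl
  rw [(hm j).balanced, NonUnitalStarAlgHom.comp_apply, hmm, ht.ract,
    NonUnitalStarAlgHom.comp_apply, ht', F.lact_t q hq j b f₂ hf₂, ← h1, h3]
  refine (key _).trans ?_
  rw [← (G.θ q j).map_ract, (G.isTensor q j).ract]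

/-- Absorbing one pivot and then further ones. -/
lemma EStep.exists_absorption (E : EStep G p C G₁) {piv : Set (Fin k)} (hp : p ∉ piv)
    {G' : GenSys B k} (F : Absorption piv G₁ G') :
    Nonempty (Absorption (insert p piv) G G') := by
  obtain ⟨s₁, hs₁, hs₁t⟩ := F.backward ∅ (fun _ h => h.elim)
    (GRep.ofHom G' (NonUnitalStarAlgHom.id ℂ B))
  obtain ⟨s, hs, hsp⟩ := E.backward hp (s₁.mono Set.subset_union_left)
  have hsπ : s.π = F.ρ.comp C.piHom := NonUnitalStarAlgHom.ext fun a => by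
    rw [hs.pi]
    exact hs₁.pi _
  have hsp : ∀ x, s.t p x = F.ρ (C.t x) := fun x => (hsp x).trans (hs₁.pi _)
  have hst : ∀ q ∈ piv, ∀ x S, s.t q x * F.ρ S = F.t q (E.mm q x S) := by
    intro q hq x S
    refine Eq.trans ?_ ((hs.mul q hq x S).trans (hs₁t q hq _))
    exact congrArg (s.t q x * ·) (hs₁.pi S).symm
  have hsrep : ∀ q ∈ insert p piv, IsRep (G.Y q) (F.ρ.comp C.piHom) (s.t q) := fun q hq =>
    hsπ ▸ s.isRep q hq
  have hF : ∀ j, _ := fun j => MixedMod.exists_comp (ρ₁ := C.piHom) (E.ecorr j).mod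
    (E.ecorr j).lact_pi (F.mod j) (F.lact_pi j)
  choose m hm hml hmm using hF
  refine ⟨⟨F.ρ.comp C.piHom, fun j => s.t j, m, ?_, hm, hml, ?_, ?_, ?_⟩⟩
  · intro S hS hρ ht hadd hmul hsmul hstar
    have h0 : ∀ z, F.ρ z ∈ S := by
      refine C.gen (F.ρ ⁻¹' S) (hS.preimage (homCLM F.ρ).continuous) hρ (fun x => ?_)
        (fun p q hp hq => ?_) (fun p q hp hq => ?_) (fun c p hp => ?_) (fun p hp => ?_)
      · rw [Set.mem_preimage, ← hsp]
        exact ht p (Set.mem_insert _ _) x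
      · rw [Set.mem_preimage, map_add]
        exact hadd _ _ hp hq
      · rw [Set.mem_preimage, map_mul]
        exact hmul _ _ hp hq
      · rw [Set.mem_preimage, map_smul]
        exact hsmul _ _ hp
      · rw [Set.mem_preimage, map_star]
        exact hstar _ hp
    refine F.gen S hS h0 (fun q hq ξ => ?_) hadd hmul hsmul hstar
    refine mem_of_dense_span (E.ecorr q).mod.dense
      { carrier := {ξ | F.t q ξ ∈ S}
        add_mem' := fun {x y} hx hy => ?_
        zero_mem' := ?_
        smul_mem' := fun c x hx => ?_ } (hS.preimage (F.isRep hq).toCLM.continuous) ?_ ξ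
    · change F.t q (x + y) ∈ S
      rw [(F.isRep hq).t_add]
      exact hadd _ _ hx hy
    · change (F.isRep hq).toCLM 0 ∈ S
      rw [map_zero, ← map_zero F.ρ]
      exact h0 0
    · change F.t q (c • x) ∈ S
      rw [(F.isRep hq).t_smul]
      exact hsmul _ _ hx
    · rintro _ ⟨y, S', rfl⟩
      change F.t q (E.mm q y S') ∈ S
      rw [← hst q hq]
      exact hmul _ _ (ht q (Set.mem_insert_of_mem _ hq) y) (h0 S')
  · intro q hq j b f hf x y
    by_cases h : q = p
    · subst h
      simp only [hsp] at hf
      rw [hsp]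
      exact E.lact_pivot F (hm j) (hmm j) b f hf x y
    · exact E.lact_later F hm hmm (hq.resolve_left h) (hsrep q hq) (hst q (hq.resolve_left h)) j b
        f hf x y
  · intro D _ J r
    obtain ⟨r₁, h₁, h₁p⟩ := E.forward (J := piv ∪ J)
      (r.mono (Set.insert_union).superset)
    obtain ⟨r₂, h₂, h₂t⟩ := F.forward J r₁
    refine ⟨r₂, .of_mono (h₁.comp hm hmm h₂ (fun j hj => Or.inr (Or.inr hj)) (fun j hj => Or.inr hj)), ?_⟩
    intro q hq x
    by_cases h : q = p
    · subst h
      rw [hsp, ← h₂.pi]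
      exact h₁p x
    · have hq' := hq.resolve_left h
      refine h₁.apply_eq hs r₂.π (Or.inr (Or.inl hq')) (Or.inl hq') hq hq' (fun ξ => ?_) x
      rw [h₂t q hq']
      exact congrArg r₂.π (hs₁t q hq' ξ).symm
  · intro D _ J hJ r₂
    obtain ⟨r₁, h₂, h₂t⟩ := F.backward J (fun j hj h => hJ j hj (Or.inr h)) r₂
    obtain ⟨r, h₁, h₁p⟩ := E.backward (J := piv ∪ J)
      (fun h => h.elim hp fun h => hJ p h (Set.mem_insert _ _)) r₁
    refine ⟨r.mono (Set.insert_union).subset,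
      (h₁.comp hm hmm h₂ (fun j hj => Or.inr (Or.inr hj)) (fun j hj => Or.inr hj)).mono _, ?_⟩
    intro q hq x
    by_cases h : q = p
    · subst h
      rw [hsp, ← h₂.pi]
      exact h₁p x
    · have hq' := hq.resolve_left h
      refine h₁.apply_eq hs r₂.π (Or.inr (Or.inl hq')) (Or.inl hq') hq hq' (fun ξ => ?_) x
      rw [h₂t q hq']
      exact congrArg r₂.π (hs₁t q hq' ξ).symm

end AbsorptionStep

section Iteration

/-- The system at the top of a tower arises by absorbing all of its pivots. -/
lemma Tower.exists_absorption (k : ℕ) : ∀ (s start : ℕ) (h : start + s ≤ k) (A : Type u)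
    (instA : NonUnitalCStarAlgebra A) (G : GenSys A k) (tw : Tower k s start h A instA G)
    (B : Type u) (instB : NonUnitalCStarAlgebra B) (G' : GenSys B k),
    TowerLast k s start h A instA G tw = ⟨B, instB, G'⟩ →
    Nonempty (Absorption {q : Fin k | start ≤ q.1 ∧ q.1 < start + s} G G')
  | 0, start, h, A, instA, G, tw, B, instB, G', hlast => by
    cases hlast
    exact ⟨Absorption.refl G fun q hq => by
      simp only [Set.mem_ofPred_eq] at hq
      omega⟩
  | s + 1, start, h, A, instA, G, ⟨C, G₁, E, tw⟩, B, instB, G', hlast => by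
    obtain ⟨F⟩ := Tower.exists_absorption k s (start + 1) (by omega) C.O inferInstance G₁ tw B
      instB G' hlast
    have hs : {q : Fin k | start ≤ q.1 ∧ q.1 < start + (s + 1)} =
        insert (⟨start, by omega⟩ : Fin k)
          {q : Fin k | start + 1 ≤ q.1 ∧ q.1 < start + 1 + s} := by
      ext q
      simp only [Set.mem_ofPred_eq, Set.mem_insert_iff, Fin.ext_iff]
      omega
    rw [hs]
    exact E.exists_absorption (by
      simp only [Set.mem_ofPred_eq]
      omega) F

end Iteration

section ProductSystem

variable {m : ℕ} {Xs : PSys A m} {D : Type u} [NonUnitalCStarAlgebra D]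

/-- Continuous linear maps on equal fibres agree if they agree on corresponding dense families. -/
lemma PSys.heq_clm {s s' : Fin m → ℕ} (h : s = s') {I : Type*} (w : I → (Xs.fib s).X)
    (w' : I → (Xs.fib s').X) (hw : ∀ i, HEq (w i) (w' i))
    (hd : closure (Submodule.span ℂ (Set.range w) : Set (Xs.fib s).X) = Set.univ)
    {f : (Xs.fib s).X →L[ℂ] D} {f' : (Xs.fib s').X →L[ℂ] D} (hf : ∀ i, f (w i) = f' (w' i)) :
    HEq f f' := by
  subst h
  refine heq_of_eq (clm_ext_of_dense hd ?_)
  rintro _ ⟨i, rfl⟩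
  rw [hf, eq_of_heq (hw i)]

/-- `q` is the tensor product of `f` and `g`. -/
def PSys.IsProd {s t : Fin m → ℕ} (f : (Xs.fib s).X →L[ℂ] D) (g : (Xs.fib t).X →L[ℂ] D)
    (q : (Xs.fib (s + t)).X →L[ℂ] D) : Prop :=
  ∀ x y, q (Xs.mul s t x y) = f x * g y

lemma PSys.IsProd.heq {s t s' t' : Fin m → ℕ} (hs : s = s') (ht : t = t')
    {f : (Xs.fib s).X →L[ℂ] D} {g : (Xs.fib t).X →L[ℂ] D} {q : (Xs.fib (s + t)).X →L[ℂ] D}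
    {f' : (Xs.fib s').X →L[ℂ] D} {g' : (Xs.fib t').X →L[ℂ] D}
    {q' : (Xs.fib (s' + t')).X →L[ℂ] D} (h : IsProd f g q) (h' : IsProd f' g' q')
    (hf : HEq f f') (hg : HEq g g') : HEq q q' := by
  subst hs ht
  rw [eq_of_heq hf, eq_of_heq hg] at h
  exact heq_of_eq ((Xs.isTensor s t).clm_ext fun x y => by rw [h, h'])

lemma PSys.IsProd.heq_assoc {s t u : Fin m → ℕ} {f : (Xs.fib s).X →L[ℂ] D}
    {g : (Xs.fib t).X →L[ℂ] D} {e : (Xs.fib u).X →L[ℂ] D} {fg : (Xs.fib (s + t)).X →L[ℂ] D}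
    {ge : (Xs.fib (t + u)).X →L[ℂ] D} {q : (Xs.fib (s + t + u)).X →L[ℂ] D}
    {q' : (Xs.fib (s + (t + u))).X →L[ℂ] D} (h₁ : IsProd f g fg) (h₂ : IsProd fg e q)
    (h₃ : IsProd g e ge) (h₄ : IsProd f ge q') : HEq q q' := by
  refine PSys.heq_clm (add_assoc s t u)
    (fun p : (Xs.fib s).X × (Xs.fib t).X × (Xs.fib u).X =>
      Xs.mul (s + t) u (Xs.mul s t p.1 p.2.1) p.2.2)
    (fun p => Xs.mul s (t + u) p.1 (Xs.mul t u p.2.1 p.2.2))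
    (fun p => Xs.assoc _ _ _ _ _ _) ?_ fun p => ?_
  · refine dense_span_of_subset (Xs.isTensor (s + t) u).dense ?_
    rintro _ ⟨v, z, rfl⟩
    refine mem_of_dense_span (Xs.isTensor s t).dense
      ((Submodule.span ℂ _).topologicalClosure.comap
        ((Xs.isTensor (s + t) u).leftCLM z).toLinearMap)
      ((Submodule.isClosed_topologicalClosure _).preimage (ContinuousLinearMap.continuous _)) ?_ v
    rintro _ ⟨x, y, rfl⟩
    exact Submodule.le_topologicalClosure _ (Submodule.subset_span ⟨(x, y, z), rfl⟩)
  · rw [h₂, h₁, h₄, h₃, mul_assoc]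

/-- The degree of a word in the generators. -/
def wordDeg : List (Fin m) → Fin m → ℕ
  | [] => 0
  | i :: w => egen i + wordDeg w

lemma wordDeg_append (w v : List (Fin m)) : wordDeg (w ++ v) = wordDeg w + wordDeg v := by
  induction w with
  | nil => exact (zero_add _).symm
  | cons i w ih => exact (congrArg (egen i + ·) ih).trans (add_assoc _ _ _).symm

lemma wordDeg_apply (w : List (Fin m)) (j : Fin m) : wordDeg w j = w.count j := by
  induction w with
  | nil => rfl
  | cons i w ih =>
    rw [List.count_cons, ← ih, add_comm]
    change (egen i) j + _ = _
    congr 1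
    by_cases h : j = i
    · simp [egen, h]
    · simp [egen, h, Ne.symm h]

lemma exists_wordDeg_eq (s : Fin m → ℕ) : ∃ w, wordDeg w = s := by
  have hadd : ∀ s t : Fin m → ℕ, (∃ w, wordDeg w = s) → (∃ w, wordDeg w = t) →
      ∃ w, wordDeg w = s + t := by
    rintro _ _ ⟨w, rfl⟩ ⟨v, rfl⟩
    exact ⟨w ++ v, wordDeg_append w v⟩
  rw [← Finset.univ_sum_single s]
  refine Finset.sum_induction _ (fun s => ∃ w, wordDeg w = s) hadd ⟨[], rfl⟩ fun i _ => ?_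
  induction s i with
  | zero => exact ⟨[], (Pi.single_zero i).symm⟩
  | succ n ih =>
    rw [Pi.single_add]
    exact hadd _ _ ih ⟨[i], add_zero _⟩

lemma PSys.exists_rep_zero (Xs : PSys A m) (π : A →⋆ₙₐ[ℂ] D) :
    ∃ f : (Xs.fib 0).X →L[ℂ] D, (∀ a, f (Xs.unit a) = π a) ∧ IsRep (Xs.fib 0) π f := by
  obtain ⟨f, hf, hi⟩ := (Xs.fib 0).exists_extension_self Xs.unit π (homCLM π)
    (by rw [Xs.unit_bij.2.range_eq]; simp) (fun a b => by
      rw [Xs.unit_inner, homCLM_apply, map_mul, map_star])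
  refine ⟨f, hf, isStarHom_coe _, map_add f, map_smul f, fun a x => ?_, fun x a => ?_, hi⟩
  · obtain ⟨b, rfl⟩ := Xs.unit_bij.2 x
    rw [Xs.unit_lact, hf, hf, map_mul]
  · obtain ⟨b, rfl⟩ := Xs.unit_bij.2 x
    rw [Xs.unit_ract, hf, hf, map_mul]

variable {H : GenSys A m}

/-- The representation of a generating fibre induced by a representation of the generating
system. -/
def Generates.repGen (gen : Generates H Xs) (r : GRep H Set.univ D) (i : Fin m) :
    (Xs.fib (egen i)).X →L[ℂ] D :=
  (r.t i).comp (gen.ι i).symm.toCLM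

lemma Generates.repGen_ι (gen : Generates H Xs) (r : GRep H Set.univ D) (i : Fin m)
    (x : (H.Y i).X) : gen.repGen r i ((gen.ι i).toFun x) = r.t i x :=
  congrArg (r.t i) ((gen.ι i).left_inv x)

lemma Generates.isRep_repGen (gen : Generates H Xs) (r : GRep H Set.univ D) (i : Fin m) :
    IsRep (Xs.fib (egen i)) r.π (gen.repGen r i) :=
  (gen.ι i).symm.isRep_comp (r.isRep i trivial)

lemma Generates.mem_rightIdeal_repGen (gen : Generates H Xs) (r : GRep H Set.univ D) (i : Fin m)
    (a : A) : r.π a ∈ rightIdeal (gen.repGen r i) :=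
  ((gen.ι i).symm.rightIdeal_comp (t := r.t i)).symm ▸ r.cov i trivial a

/-- The representation of the fibre over a word. -/
def Generates.wordRep (gen : Generates H Xs) (r : GRep H Set.univ D) : ∀ w : List (Fin m),
    {f : (Xs.fib (wordDeg w)).X →L[ℂ] D // IsRep (Xs.fib (wordDeg w)) r.π f}
  | [] => ⟨(Xs.exists_rep_zero r.π).choose, (Xs.exists_rep_zero r.π).choose_spec.2⟩
  | i :: w =>
    ⟨((Xs.isTensor (egen i) (wordDeg w)).exists_rep (gen.isRep_repGen r i)
      (gen.wordRep r w).2).choose,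
    ((Xs.isTensor (egen i) (wordDeg w)).exists_rep (gen.isRep_repGen r i)
      (gen.wordRep r w).2).choose_spec.2⟩

variable (gen : Generates H Xs) (r : GRep H Set.univ D)

lemma Generates.wordRep_nil (a : A) : (gen.wordRep r []).1 (Xs.unit a) = r.π a :=
  (Xs.exists_rep_zero r.π).choose_spec.1 a

lemma Generates.wordRep_cons (i : Fin m) (w : List (Fin m)) :
    PSys.IsProd (gen.repGen r i) (gen.wordRep r w).1 (gen.wordRep r (i :: w)).1 :=
  ((Xs.isTensor (egen i) (wordDeg w)).exists_rep (gen.isRep_repGen r i)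
    (gen.wordRep r w).2).choose_spec.1

lemma Generates.mem_rightIdeal_wordRep (w : List (Fin m)) (a : A) :
    r.π a ∈ rightIdeal (gen.wordRep r w).1 := by
  induction w generalizing a with
  | nil =>
    refine rightIdeal_induction (rightIdeal _) isClosed_rightIdeal (fun a c => ?_)
      (mem_rightIdeal_self r.π a)
    rw [← gen.wordRep_nil r a]
    exact mul_mem_rightIdeal _ _
  | cons i w ih =>
    exact IsTensor.mem_rightIdeal (m := Xs.mul (egen i) (wordDeg w)) (gen.isRep_repGen r i)
      (gen.mem_rightIdeal_repGen r i) ih (gen.wordRep_cons r i w) a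

lemma Generates.heq_swap (i j : Fin m) {f : (Xs.fib (egen i + egen j)).X →L[ℂ] D}
    {g : (Xs.fib (egen j + egen i)).X →L[ℂ] D}
    (hf : PSys.IsProd (gen.repGen r i) (gen.repGen r j) f)
    (hg : PSys.IsProd (gen.repGen r j) (gen.repGen r i) g) : HEq f g := by
  have e : f.comp (gen.κ i j).toCLM =
      (g.comp (gen.κ j i).toCLM).comp (H.θ i j).toCLM := by
    refine (H.isTensor i j).clm_ext fun x y => ?_
    change f ((gen.κ i j).toFun (H.tmul i j x y)) = _
    rw [gen.κ_mul, hf, gen.repGen_ι, gen.repGen_ι]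
    refine r.comm i trivial j trivial (g.comp (gen.κ j i).toCLM) (fun y x => ?_) x y
    change g ((gen.κ j i).toFun (H.tmul j i y x)) = _
    rw [gen.κ_mul, hg, gen.repGen_ι, gen.repGen_ι]
  refine PSys.heq_clm (add_comm _ _) (fun z => (gen.κ i j).toFun z)
    (fun z => (gen.κ j i).toFun ((H.θ i j).toFun z)) (fun z => (gen.θ_compat i j z).symm) ?_
    fun z => DFunLike.congr_fun e z
  have hs : Set.range (fun z => (gen.κ i j).toFun z) = Set.univ :=
    Set.range_eq_univ.2 fun y => ⟨_, (gen.κ i j).right_inv y⟩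
  rw [hs]
  simp

lemma Generates.wordRep_perm {w v : List (Fin m)} (h : w.Perm v) :
    HEq (gen.wordRep r w).1 (gen.wordRep r v).1 := by
  have hdeg : ∀ {w v : List (Fin m)}, w.Perm v → wordDeg w = wordDeg v := fun h =>
    funext fun j => by rw [wordDeg_apply, wordDeg_apply, h.count_eq]
  induction h with
  | nil => rfl
  | cons i h ih =>
    exact PSys.IsProd.heq rfl (hdeg h) (gen.wordRep_cons r i _) (gen.wordRep_cons r i _) HEq.rfl ih
  | swap j i w =>
    obtain ⟨f, hf, hfr⟩ := (Xs.isTensor (egen i) (egen j)).exists_rep (gen.isRep_repGen r i)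
      (gen.isRep_repGen r j)
    obtain ⟨g, hg, hgr⟩ := (Xs.isTensor (egen j) (egen i)).exists_rep (gen.isRep_repGen r j)
      (gen.isRep_repGen r i)
    obtain ⟨f₁, hf₁, -⟩ := (Xs.isTensor (egen i + egen j) (wordDeg w)).exists_rep hfr
      (gen.wordRep r w).2
    obtain ⟨g₁, hg₁, -⟩ := (Xs.isTensor (egen j + egen i) (wordDeg w)).exists_rep hgr
      (gen.wordRep r w).2
    refine (PSys.IsProd.heq_assoc hf hf₁ (gen.wordRep_cons r j w)
      (gen.wordRep_cons r i (j :: w))).symm.trans (HEq.trans ?_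
      (PSys.IsProd.heq_assoc hg hg₁ (gen.wordRep_cons r i w) (gen.wordRep_cons r j (i :: w))))
    exact PSys.IsProd.heq (add_comm _ _) rfl hf₁ hg₁ (gen.heq_swap r i j hf hg) HEq.rfl
  | trans _ _ h1 h2 => exact h1.trans h2

lemma Generates.wordRep_append (w v : List (Fin m))
    {q : (Xs.fib (wordDeg w + wordDeg v)).X →L[ℂ] D}
    (hq : PSys.IsProd (gen.wordRep r w).1 (gen.wordRep r v).1 q) :
    HEq q (gen.wordRep r (w ++ v)).1 := by
  induction w with
  | nil =>
    refine PSys.heq_clm (zero_add (wordDeg v))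
      (fun p : (Xs.fib 0).X × (Xs.fib (wordDeg v)).X => Xs.mul 0 (wordDeg v) p.1 p.2)
      (fun p => (Xs.fib (wordDeg v)).lactL (Function.surjInv Xs.unit_bij.2 p.1) p.2)
      (fun p => ?_) (Xs.isTensor 0 (wordDeg v)).dense_range fun p => ?_
    · have := Xs.unit_mul_left (wordDeg v) (Function.surjInv Xs.unit_bij.2 p.1) p.2
      rwa [Function.surjInv_eq Xs.unit_bij.2 p.1] at this
    · refine (hq p.1 p.2).trans (Eq.trans ?_ ((gen.wordRep r v).2.lact _ _).symm)
      exact congrArg (· * _) ((congrArg _ (Function.surjInv_eq Xs.unit_bij.2 p.1).symm).trans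
        (gen.wordRep_nil r _))
  | cons i w ih =>
    obtain ⟨q₁, hq₁, hq₁r⟩ := (Xs.isTensor (wordDeg w) (wordDeg v)).exists_rep
      (gen.wordRep r w).2 (gen.wordRep r v).2
    obtain ⟨q₂, hq₂, -⟩ := (Xs.isTensor (egen i) (wordDeg w + wordDeg v)).exists_rep
      (gen.isRep_repGen r i) hq₁r
    refine (PSys.IsProd.heq_assoc (gen.wordRep_cons r i w) hq hq₁ hq₂).trans ?_
    exact PSys.IsProd.heq rfl (wordDeg_append w v).symm hq₂ (gen.wordRep_cons r i (w ++ v)) HEq.rfl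
      (ih hq₁)

/-- A representation of a generating system extends to the product system it generates. -/
lemma Generates.exists_psRep : ∃ R : PSRep Xs D, R.π = r.π ∧ PSCPCov R ∧
    ∀ j x, R.ψ (egen j) ((gen.ι j).toFun x) = r.t j x := by
  have key : ∀ s, ∃ f : (Xs.fib s).X →L[ℂ] D, IsRep (Xs.fib s) r.π f ∧
      (∀ a, r.π a ∈ rightIdeal f) ∧ ∀ w, wordDeg w = s → HEq f (gen.wordRep r w).1 := by
    intro s
    obtain ⟨w, rfl⟩ := exists_wordDeg_eq s
    refine ⟨(gen.wordRep r w).1, (gen.wordRep r w).2, gen.mem_rightIdeal_wordRep r w,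
      fun v hv => gen.wordRep_perm r (List.perm_iff_count.2 fun j => ?_)⟩
    rw [← wordDeg_apply, ← wordDeg_apply, hv]
  choose ψ hψ hψc hψw using key
  refine ⟨⟨r.π, fun s => ψ s, hψ, fun a => ?_, fun s t x y => ?_⟩, rfl,
    fun s => CPCov_of_mem_rightIdeal (hψ s) (hψc s), fun j x => ?_⟩
  · rw [eq_of_heq (hψw 0 [] rfl)]
    exact gen.wordRep_nil r a
  · obtain ⟨w, rfl⟩ := exists_wordDeg_eq s
    obtain ⟨v, rfl⟩ := exists_wordDeg_eq t
    obtain ⟨q, hq, -⟩ := (Xs.isTensor (wordDeg w) (wordDeg v)).exists_rep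
      (gen.wordRep r w).2 (gen.wordRep r v).2
    rw [eq_of_heq (hψw _ w rfl), eq_of_heq (hψw _ v rfl), ← hq]
    congr 1
    exact eq_of_heq ((gen.wordRep_append r w v hq).trans
      (hψw _ (w ++ v) (wordDeg_append w v)).symm)
  · have h1 : HEq (gen.wordRep r [j]).1 (gen.repGen r j) := by
      refine PSys.heq_clm (add_zero (egen j))
        (fun p : (Xs.fib (egen j)).X × (Xs.fib 0).X => Xs.mul (egen j) 0 p.1 p.2)
        (fun p => (Xs.fib (egen j)).ract p.1 (Function.surjInv Xs.unit_bij.2 p.2))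
        (fun p => ?_) (Xs.isTensor (egen j) 0).dense_range fun p => ?_
      · have := Xs.unit_mul_right (egen j) p.1 (Function.surjInv Xs.unit_bij.2 p.2)
        rwa [Function.surjInv_eq Xs.unit_bij.2 p.2] at this
      · refine (gen.wordRep_cons r j [] p.1 p.2).trans
          (Eq.trans ?_ ((gen.isRep_repGen r j).ract _ _).symm)
        exact congrArg (_ * ·) ((congrArg _ (Function.surjInv_eq Xs.unit_bij.2 p.2).symm).trans
          (gen.wordRep_nil r _))
    change ψ (egen j) ((gen.ι j).toFun x) = r.t j x
    rw [eq_of_heq ((hψw _ [j] (add_zero _)).trans h1), gen.repGen_ι]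

end ProductSystem

section ProductSystemAlgebra

variable {m k : ℕ} {Xs : PSys A m} {D : Type u} [NonUnitalCStarAlgebra D]

/-- The coefficient map of a representation of a product system as a *-homomorphism. -/
def PSRep.piHom (R : PSRep Xs D) : A →⋆ₙₐ[ℂ] D := (R.isRep 0).hom.toHom

lemma PSRep.isRep_piHom (R : PSRep Xs D) (s : Fin m → ℕ) :
    IsRep (Xs.fib s) R.piHom (R.ψ s) := R.isRep s

lemma PSRep.ψ_heq (R : PSRep Xs D) {s s' : Fin m → ℕ} (h : s = s') {x : (Xs.fib s).X}
    {x' : (Xs.fib s').X} (hx : HEq x x') : R.ψ s x = R.ψ s' x' := by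
  subst h
  rw [eq_of_heq hx]

variable {H : GenSys A m} (gen : Generates H Xs) (C : PSCPAlg Xs)

/-- Homomorphisms out of the Cuntz–Pimsner algebra of a product system are determined by their
values on the coefficients and on the generating fibres. -/
lemma Generates.hom_ext {f g : C.O →⋆ₙₐ[ℂ] D} (hπ : ∀ a, f (C.rep.π a) = g (C.rep.π a))
    (ht : ∀ j x, f (C.rep.ψ (egen j) ((gen.ι j).toFun x)) =
      g (C.rep.ψ (egen j) ((gen.ι j).toFun x))) (z : C.O) : f z = g z := by
  have key : ∀ w x, f (C.rep.ψ (wordDeg w) x) = g (C.rep.ψ (wordDeg w) x) := by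
    intro w
    induction w with
    | nil =>
      intro x
      obtain ⟨a, rfl⟩ := Xs.unit_bij.2 x
      have h := C.rep.ψ_zero a
      exact (congrArg f h).trans ((hπ a).trans (congrArg g h).symm)
    | cons i w ih =>
      refine fun x => DFunLike.congr_fun ((Xs.isTensor (egen i) (wordDeg w)).clm_ext
        (f := (homCLM f).comp (C.rep.isRep_piHom _).toCLM)
        (g := (homCLM g).comp (C.rep.isRep_piHom _).toCLM) fun x y => ?_) x
      change f (C.rep.ψ (egen i + wordDeg w) _) = g (C.rep.ψ (egen i + wordDeg w) _)
      rw [← C.rep.mul, map_mul, map_mul, ih, ← (gen.ι i).right_inv x, ht]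
  refine C.gen {z | f z = g z} (isClosed_eq (homCLM f).continuous (homCLM g).continuous) hπ
    (fun s x => ?_) (fun p q hp hq => ?_) (fun p q hp hq => ?_) (fun c p hp => ?_)
    (fun p hp => ?_) z
  · obtain ⟨w, rfl⟩ := exists_wordDeg_eq s
    exact key w x
  all_goals simp_all [map_star]

/-- The representation of a generating system in the Cuntz–Pimsner algebra of the product system
it generates. -/
def Generates.canonicalRep : GRep H Set.univ C.O where
  π := C.rep.piHom
  t j := ((gen.ι j).isRep_comp (C.rep.isRep_piHom (egen j))).toCLM
  isRep j _ := (gen.ι j).isRep_comp (C.rep.isRep_piHom (egen j))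
  cov j _ a := by
    have h := (gen.ι j).rightIdeal_comp (t := C.rep.ψ (egen j))
    have h' := mem_rightIdeal_of_CPCov (π := C.rep.piHom) (Xs.reg (egen j)).2
      (C.covariant (egen j)) a
    rw [← h] at h'
    exact h'
  comm i _ j _ f hf x y := by
    have e : f = (C.rep.isRep_piHom (egen j + egen i)).toCLM.comp (gen.κ j i).toCLM := by
      refine (H.isTensor j i).clm_ext fun y x => ?_
      rw [hf]
      change C.rep.ψ (egen j) _ * C.rep.ψ (egen i) _ = C.rep.ψ _ ((gen.κ j i).toFun _)
      rw [gen.κ_mul, C.rep.mul]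
    rw [e]
    change C.rep.ψ (egen i) _ * C.rep.ψ (egen j) _ = C.rep.ψ _ ((gen.κ j i).toFun _)
    rw [C.rep.mul, ← gen.κ_mul]
    exact C.rep.ψ_heq (add_comm _ _) (gen.θ_compat i j _).symm

/-- The universal property of the Cuntz–Pimsner algebra of a product system in terms of a
generating system. -/
lemma Generates.exists_hom (r : GRep H Set.univ D) : ∃ f : C.O →⋆ₙₐ[ℂ] D,
    (∀ a, f (C.rep.π a) = r.π a) ∧
    ∀ j x, f (C.rep.ψ (egen j) ((gen.ι j).toFun x)) = r.t j x := by
  obtain ⟨R, hπ, hc, ht⟩ := gen.exists_psRep r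
  obtain ⟨f, ⟨h1, h2⟩, -⟩ := C.universal D R hc
  exact ⟨f, fun a => by rw [h1, hπ], fun j x => by rw [h2, ht]⟩

variable {G : GenSys A k} {hm : m ≤ k}

/-- A representation of an initial part of a generating system on one of its members. -/
def GRep.part (r : GRep (G.restrict m hm) Set.univ D) (j : Fin k) (h : j.1 < m) :
    (G.Y j).X →L[ℂ] D :=
  r.t ⟨j.1, h⟩

/-- Extension by zero of a representation of an initial part of a generating system. -/
def GRep.extend (r : GRep (G.restrict m hm) Set.univ D) {J : Set (Fin k)}
    (hJ : ∀ j ∈ J, j.1 < m) : GRep G J D where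
  π := r.π
  t j := if h : j.1 < m then r.part j h else 0
  isRep j hj := by
    rw [dif_pos (hJ j hj)]
    exact r.isRep ⟨j.1, hJ j hj⟩ trivial
  cov j hj := by
    rw [dif_pos (hJ j hj)]
    exact r.cov ⟨j.1, hJ j hj⟩ trivial
  comm i hi j hj := by
    rw [dif_pos (hJ i hi), dif_pos (hJ j hj)]
    exact r.comm ⟨i.1, hJ i hi⟩ trivial ⟨j.1, hJ j hj⟩ trivial

lemma GRep.extend_t (r : GRep (G.restrict m hm) Set.univ D) {J : Set (Fin k)}
    (hJ : ∀ j ∈ J, j.1 < m) (j : Fin m) : (r.extend hJ).t (Fin.castLE hm j) = r.t j :=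
  dif_pos j.2

/-- The initial part of a representation of a generating system. -/
def GRep.initial {J : Set (Fin k)} (r : GRep G J D) (hJ : ∀ j, Fin.castLE hm j ∈ J) :
    GRep (G.restrict m hm) Set.univ D where
  π := r.π
  t j := r.t (Fin.castLE hm j)
  isRep j _ := r.isRep _ (hJ j)
  cov j _ := r.cov _ (hJ j)
  comm i _ j _ := r.comm _ (hJ i) _ (hJ j)

/-- The universal covariant representation of one member of a generating system. -/
lemma CPAlg.exists_gRep {p : Fin k} (C : CPAlg (G.Y p)) : ∃ r : GRep G {p} C.O,
    r.π = C.piHom ∧ ∀ x, r.t p x = C.t x := by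
  classical
  refine ⟨⟨C.piHom, Function.update (fun _ => 0) p C.isRep_piHom.toCLM, ?_, ?_, ?_⟩, rfl,
    fun x => ?_⟩
  · rintro _ rfl
    rw [Function.update_self]
    exact C.isRep
  · rintro _ rfl a
    rw [Function.update_self]
    exact C.mem_rightIdeal_t (G.reg _).2 a
  · rintro _ rfl _ rfl f hf x y
    rw [G.θ_diag, hf]
  · exact DFunLike.congr_fun
      (Function.update_self (β := fun j => (G.Y j).X →L[ℂ] C.O) p C.isRep_piHom.toCLM _) x

end ProductSystemAlgebra

section Final

/-- Mixed tensor products over isomorphic algebras are isomorphic. -/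
lemma MixedMod.exists_iso {O : Type u} [NonUnitalCStarAlgebra O] {W : Corr A} {ρ : A →⋆ₙₐ[ℂ] B}
    {Z : Corr B} {m : W.X → B → Z.X} (h : MixedMod W B ρ Z m) {π : A →⋆ₙₐ[ℂ] O} {V : Corr O}
    {n : W.X → O → V.X} (hV : MixedMod W O π V n) (Φ : B ≃⋆ₐ[ℂ] O) (hΦ : ∀ a, Φ (ρ a) = π a) :
    ∃ f : Z.X →L[ℂ] V.X, Function.Bijective f ∧ (∀ y S, f (m y S) = n y (Φ S)) ∧
      (∀ x y, V.inner (f x) (f y) = Φ (Z.inner x y)) ∧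
      ∀ x b, f (Z.ract x b) = V.ract (f x) (Φ b) := by
  obtain ⟨f, hf, hfi⟩ := Corr.exists_extension Z V (fun p : W.X × B => m p.1 p.2)
    (fun p => n p.1 (Φ p.2)) (homCLM (Φ : B →⋆ₙₐ[ℂ] O)) h.dense_range (by
      rintro ⟨x, S⟩ ⟨y, T⟩
      change V.inner (n x (Φ S)) (n y (Φ T)) = Φ (Z.inner (m x S) (m y T))
      rw [hV.inner, h.inner, map_mul, map_mul, map_star, hΦ])
  obtain ⟨g, hg, -⟩ := Corr.exists_extension V Z (fun p : W.X × O => n p.1 p.2)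
    (fun p => m p.1 (Φ.symm p.2)) (homCLM (Φ.symm : O →⋆ₙₐ[ℂ] B)) hV.dense_range (by
      rintro ⟨x, S⟩ ⟨y, T⟩
      change Z.inner (m x (Φ.symm S)) (m y (Φ.symm T)) = Φ.symm (V.inner (n x S) (n y T))
      rw [hV.inner, h.inner, map_mul, map_mul, map_star, ← hΦ, Φ.symm_apply_apply])
  have hf' : ∀ y S, f (m y S) = n y (Φ S) := fun y S => hf (y, S)
  have hg' : ∀ y S, g (n y S) = m y (Φ.symm S) := fun y S => hg (y, S)
  have hgf : g.comp f = ContinuousLinearMap.id ℂ _ := h.clm_ext fun y S => by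
    change g (f (m y S)) = m y S
    rw [hf', hg', Φ.symm_apply_apply]
  have hfg : f.comp g = ContinuousLinearMap.id ℂ _ := hV.clm_ext fun y S => by
    change f (g (n y S)) = n y S
    rw [hg', hf', Φ.apply_symm_apply]
  refine ⟨f, Function.bijective_iff_has_inverse.2 ⟨g, DFunLike.congr_fun hgf,
    DFunLike.congr_fun hfg⟩, hf', hfi, fun x b => ?_⟩
  refine DFunLike.congr_fun (h.clm_ext (f := f.comp (Z.ractL b)) (g := (V.ractL (Φ b)).comp f)
    fun y S => ?_) x
  change f (Z.ract (m y S) b) = V.ract (f (m y S)) (Φ b)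
  rw [h.ract, hf', hf', hV.ract, map_mul]

/-- The elements whose left action is intertwined by an isomorphism of Hilbert modules form a
C*-algebra. -/
lemma Absorption.lact_induction {O : Type u} [NonUnitalCStarAlgebra O] {k : ℕ}
    {piv : Set (Fin k)} {G : GenSys A k} {G' : GenSys B k} (E : Absorption piv G G')
    {Z : Corr B} {V : Corr O} (Φ : B ≃⋆ₐ[ℂ] O) (f : Z.X →L[ℂ] V.X) (hb : Function.Bijective f)
    (hi : ∀ x y, V.inner (f x) (f y) = Φ (Z.inner x y))
    (hρ : ∀ a x, f (Z.lactL (E.ρ a) x) = V.lactL (Φ (E.ρ a)) (f x))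
    (ht : ∀ q ∈ piv, ∀ u x, f (Z.lactL (E.t q u) x) = V.lactL (Φ (E.t q u)) (f x))
    (b : B) (x : Z.X) : f (Z.lactL b x) = V.lactL (Φ b) (f x) := by
  refine E.gen {b | ∀ x, f (Z.lactL b x) = V.lactL (Φ b) (f x)} ?_ hρ ht ?_ ?_ ?_ ?_ b x
  · rw [Set.ofPred_forall]
    exact isClosed_iInter fun x => isClosed_eq (f.comp (Z.lactR x)).continuous
      ((V.lactR (f x)).comp (homCLM (Φ : B →⋆ₙₐ[ℂ] O))).continuous
  · intro p q hp hq x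
    rw [Z.lact_add, map_add, V.lact_add]
    simp only [add_apply, map_add, hp x, hq x]
  · intro p q hp hq x
    rw [Z.lact_mul, map_mul, V.lact_mul]
    exact (hp _).trans (congrArg _ (hq x))
  · intro c p hp x
    rw [Z.lact_smul, map_smul, V.lact_smul]
    simp only [smul_apply, map_smul, hp x]
  · intro p hp x
    refine V.ext_inner _ _ fun z => ?_
    obtain ⟨z, rfl⟩ := hb.2 z
    have e : V.inner (f z) (V.lactL (Φ (star p)) (f x)) = V.inner (V.lactL (Φ p) (f z)) (f x) := by
      rw [V.lact_adjoint, map_star]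
    rw [e, ← hp, hi, hi, Z.lact_adjoint]

variable {k : ℕ} {G : GenSys A k} {G' : GenSys B k} {i : ℕ}

/-- The coefficient algebra of the absorbed system is the Cuntz–Pimsner algebra of the product
system generated by the pivots. -/
lemma Absorption.exists_equiv
    (E : Absorption {q : Fin k | 0 ≤ q.1 ∧ q.1 < 0 + i} G G') {hik : i ≤ k} {Xi : PSys A i}
    (gen : Generates (G.restrict i hik) Xi) (C : PSCPAlg Xi) :
    ∃ Φ : B ≃⋆ₐ[ℂ] C.O, (∀ a, Φ (E.ρ a) = C.rep.π a) ∧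
      ∀ (q : Fin i) x, Φ (E.t (Fin.castLE hik q) x) = C.rep.ψ (egen q) ((gen.ι q).toFun x) := by
  have hJ : ∀ j ∈ {q : Fin k | 0 ≤ q.1 ∧ q.1 < 0 + i} ∪ ∅, j.1 < i := by
    rintro j (hj | hj)
    · simpa using hj
    · exact hj.elim
  have hmem : ∀ q : Fin i, Fin.castLE hik q ∈ {q : Fin k | 0 ≤ q.1 ∧ q.1 < 0 + i} := fun q => by
    simp
  obtain ⟨r', h1, h2⟩ := E.forward ∅ ((gen.canonicalRep C).extend hJ)
  obtain ⟨r, h3, h4⟩ := E.backward ∅ (fun _ h => h.elim)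
    (GRep.ofHom G' (NonUnitalStarAlgHom.id ℂ B))
  obtain ⟨g, h5, h6⟩ := gen.exists_hom C (r.initial fun j => Or.inl (hmem j))
  have hπ : ∀ a, r'.π (E.ρ a) = C.rep.π a := fun a => (h1.pi a).symm
  have ht : ∀ (q : Fin i) x, r'.π (E.t (Fin.castLE hik q) x) =
      C.rep.ψ (egen q) ((gen.ι q).toFun x) := fun q x => by
    rw [← h2 _ (hmem q), GRep.extend_t]
    rfl
  have hπ' : ∀ a, g (C.rep.π a) = E.ρ a := fun a => (h5 a).trans (h3.pi a)
  have ht' : ∀ (q : Fin i) x, g (C.rep.ψ (egen q) ((gen.ι q).toFun x)) =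
      E.t (Fin.castLE hik q) x := fun q x => (h6 q x).trans (h4 _ (hmem q) x)
  have hgr : ∀ b, g (r'.π b) = b := by
    refine E.gen {b | g (r'.π b) = b}
      (isClosed_eq ((homCLM g).comp (homCLM r'.π)).continuous continuous_id) ?_ ?_ ?_ ?_ ?_ ?_
    · intro a
      change g (r'.π (E.ρ a)) = E.ρ a
      rw [hπ, hπ']
    · intro q hq x
      change g (r'.π (E.t q x)) = E.t q x
      have hq' : q.1 < i := by simpa using hq
      exact (congrArg g (ht ⟨q.1, hq'⟩ x)).trans (ht' ⟨q.1, hq'⟩ x)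
    all_goals simp_all [map_star]
  have hrg : ∀ z, r'.π (g z) = z := by
    refine gen.hom_ext C (f := r'.π.comp g) (g := NonUnitalStarAlgHom.id ℂ _) (fun a => ?_)
      fun q x => ?_
    · change r'.π (g _) = C.rep.π a
      rw [hπ', hπ]
    · exact (congrArg r'.π (ht' q x)).trans (ht q x)
  exact ⟨StarAlgEquiv.ofBijective r'.π
    (Function.bijective_iff_has_inverse.2 ⟨g, hgr, hrg⟩), hπ, ht⟩

/-- The members of the absorbed system are the correspondences over the Cuntz–Pimsner algebra of
the product system generated by the pivots. -/
lemma Absorption.exists_isoOver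
    (E : Absorption {q : Fin k | 0 ≤ q.1 ∧ q.1 < 0 + i} G G') {hik : i ≤ k} {Xi : PSys A i}
    (gen : Generates (G.restrict i hik) Xi) (C : PSCPAlg Xi) {j : Fin k} {Z : Corr C.O}
    {n : (G.Y j).X → C.O → Z.X} (h : EPCorr G hik Xi gen C j Z n) :
    ∃ Φ : B ≃⋆ₐ[ℂ] C.O, Nonempty (CorrIsoOver (fun b => Φ b) (G'.Y j) Z) := by
  obtain ⟨Φ, hΦ, hΦt⟩ := E.exists_equiv gen C
  obtain ⟨f, hb, hm, hi, hr⟩ := (E.mod j).exists_iso (π := C.rep.piHom) h.mod Φ hΦ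
  refine ⟨Φ, ⟨⟨f, hb, map_add f, map_smul f, hi, hr, E.lact_induction Φ f hb hi ?_ ?_⟩⟩⟩
  · intro a x
    refine DFunLike.congr_fun ((E.mod j).clm_ext (f := f.comp ((G'.Y j).lactL (E.ρ a)))
      (g := (Z.lactL (Φ (E.ρ a))).comp f) fun y S => ?_) x
    change f ((G'.Y j).lactL (E.ρ a) (E.m j y S)) = Z.lactL (Φ (E.ρ a)) (f (E.m j y S))
    rw [E.lact_pi, hm, hm, hΦ, h.lact_pi]
  · intro q hq u x
    have hq' : q.1 < i := by simpa using hq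
    obtain ⟨μ, hμ, hμ1, hμ2⟩ := h.lact_t ⟨q.1, hq'⟩
    refine DFunLike.congr_fun ((E.mod j).clm_ext (f := f.comp ((G'.Y j).lactL (E.t q u)))
      (g := (Z.lactL (Φ (E.t q u))).comp f) fun y S => ?_) x
    change f ((G'.Y j).lactL (E.t q u) (E.m j y S)) = Z.lactL (Φ (E.t q u)) (f (E.m j y S))
    obtain ⟨F, hF⟩ := (G.isTensor j q).exists_mixed (E.mod j) (E.isRep hq) S
    have e : f.comp F = (hμ (Φ S)).toCLM := (G.isTensor j q).clm_ext fun y v => by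
      change f (F (G.tmul j q y v)) = μ (G.tmul j q y v) (Φ S)
      rw [hF, hm, map_mul]
      exact (congrArg (fun c => n y (c * Φ S)) (hΦt ⟨q.1, hq'⟩ v)).trans (hμ1 y v (Φ S)).symm
    rw [E.lact_t q hq j S F hF, hm]
    refine (DFunLike.congr_fun e _).trans ((hμ2 u y (Φ S)).symm.trans ?_)
    exact congrArg (fun c => Z.lactL c (n y (Φ S))) (hΦt ⟨q.1, hq'⟩ u).symm

/-- The Cuntz–Pimsner algebra of the next member of the absorbed system is the Cuntz–Pimsner
algebra of the product system generated by the pivots together with that member. -/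
lemma Absorption.nonempty_equiv
    (E : Absorption {q : Fin k | 0 ≤ q.1 ∧ q.1 < 0 + i} G G') {hik : i < k}
    (C : CPAlg (G'.Y ⟨i, hik⟩)) {Xs : PSys A (i + 1)}
    (gen : Generates (G.restrict (i + 1) hik) Xs) (P : PSCPAlg Xs) :
    Nonempty (C.O ≃⋆ₐ[ℂ] P.O) := by
  have hJ : ∀ j ∈ {q : Fin k | 0 ≤ q.1 ∧ q.1 < 0 + i} ∪ {⟨i, hik⟩}, j.1 < i + 1 := by
    rintro j (hj | rfl)
    · simp only [Set.mem_ofPred_eq] at hj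
      omega
    · exact Nat.lt_succ_self i
  have hmem : ∀ q : Fin (i + 1),
      Fin.castLE hik q ∈ {q : Fin k | 0 ≤ q.1 ∧ q.1 < 0 + i} ∪ {⟨i, hik⟩} := by
    intro q
    simp only [Set.mem_union, Set.mem_ofPred_eq, Set.mem_singleton_iff, Fin.ext_iff,
      Fin.val_castLE]
    omega
  obtain ⟨c, hc⟩ : ∃ c : GRep G _ P.O, c = (gen.canonicalRep P).extend hJ := ⟨_, rfl⟩
  have hcπ : ∀ a, c.π a = P.rep.π a := fun a => by rw [hc]; rfl
  have hct : ∀ (q : Fin (i + 1)) x, c.t (Fin.castLE hik q) x =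
      P.rep.ψ (egen q) ((gen.ι q).toFun x) := fun q x => by
    rw [hc, GRep.extend_t]
    rfl
  obtain ⟨c', h1, h2⟩ := E.forward {⟨i, hik⟩} c
  obtain ⟨s', hs'π, hs't⟩ := C.exists_gRep
  obtain ⟨s, h3, h4⟩ := E.backward {⟨i, hik⟩} (by simp) s'
  obtain ⟨f, ⟨hfπ, hft⟩, -⟩ := C.universal P.O c'.π (c'.t ⟨i, hik⟩) (c'.isRep _ rfl)
    (CPCov_of_mem_rightIdeal (c'.isRep _ rfl) (c'.cov _ rfl))
  obtain ⟨g, hgπ, hgt⟩ := gen.exists_hom P (s.initial hmem)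
  have hgπ' : ∀ a, g (c.π a) = s.π a := fun a => (congrArg g (hcπ a)).trans (hgπ a)
  have hgt' : ∀ j ∈ {q : Fin k | 0 ≤ q.1 ∧ q.1 < 0 + i} ∪ {⟨i, hik⟩}, ∀ x,
      g (c.t j x) = s.t j x := fun j hj x =>
    (congrArg g (hct ⟨j.1, hJ j hj⟩ x)).trans (hgt ⟨j.1, hJ j hj⟩ x)
  have hs'π' : ∀ b, s'.π b = C.π b := fun b => by rw [hs'π]; rfl
  have hB : ∀ b, g (c'.π b) = C.π b := by
    have h : ∀ b, g (c'.π b) = s'.π b := by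
      refine E.gen {b | g (c'.π b) = s'.π b}
        (isClosed_eq ((homCLM g).comp (homCLM c'.π)).continuous (homCLM s'.π).continuous)
        ?_ ?_ ?_ ?_ ?_ ?_
      · intro a
        change g (c'.π (E.ρ a)) = s'.π (E.ρ a)
        rw [← h1.pi, hgπ', h3.pi]
      · intro q hq x
        change g (c'.π (E.t q x)) = s'.π (E.t q x)
        rw [← h2 q hq, hgt' q (Or.inl hq), h4 q hq]
      · intro p q hp hq
        exact (map_add (g.comp c'.π) p q).trans ((congrArg₂ _ hp hq).trans (map_add _ _ _).symm)
      · intro p q hp hq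
        exact (map_mul (g.comp c'.π) p q).trans ((congrArg₂ _ hp hq).trans (map_mul _ _ _).symm)
      · intro z p hp
        exact (map_smul (g.comp c'.π) z p).trans ((congrArg _ hp).trans (map_smul _ _ _).symm)
      · intro p hp
        exact (map_star (g.comp c'.π) p).trans ((congrArg _ hp).trans (map_star _ _).symm)
    exact fun b => (h b).trans (hs'π' b)
  have hgf : ∀ z, g (f z) = z := by
    refine CPAlg.hom_ext (f := g.comp f) (g := NonUnitalStarAlgHom.id ℂ _) (fun b => ?_)
      fun z => ?_
    · change g (f (C.π b)) = C.π b
      rw [hfπ, hB]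
    · refine DFunLike.congr_fun ((E.mod ⟨i, hik⟩).clm_ext
        (f := (homCLM (g.comp f)).comp C.isRep_piHom.toCLM) (g := C.isRep_piHom.toCLM)
        fun y S => ?_) z
      change g (f (C.t (E.m _ y S))) = C.t (E.m _ y S)
      rw [hft, ← h1.mul _ rfl, map_mul, hgt' _ (Or.inr rfl), hB, ← hs'π', h3.mul _ rfl, hs't]
  have hfs : ∀ j ∈ {q : Fin k | 0 ≤ q.1 ∧ q.1 < 0 + i} ∪ {⟨i, hik⟩}, ∀ x,
      f (s.t j x) = c.t j x := by
    rintro j (hj | rfl) x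
    · rw [h4 j hj, hs'π', hfπ, h2 j hj]
    · refine (h1.apply_eq h3 f (Or.inr rfl) rfl (Or.inr rfl) rfl (fun z => ?_) x).symm
      rw [hs't, hft]
  have hfg : ∀ z, f (g z) = z := by
    refine gen.hom_ext P (f := f.comp g) (g := NonUnitalStarAlgHom.id ℂ _) (fun a => ?_)
      fun q x => ?_
    · change f (g (P.rep.π a)) = P.rep.π a
      rw [hgπ]
      change f (s.π a) = _
      rw [h3.pi, hs'π', hfπ, ← h1.pi, hcπ]
    · change f (g (P.rep.ψ (egen q) ((gen.ι q).toFun x))) = P.rep.ψ (egen q) ((gen.ι q).toFun x)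
      exact (congrArg f (hgt q x)).trans ((hfs _ (hmem q) x).trans (hct q x))
  exact ⟨StarAlgEquiv.ofBijective f (Function.bijective_iff_has_inverse.2 ⟨g, hgf, hfg⟩)⟩

end Final

/-- Theorem `for product`.  Let `(Y, θ)` be a generating
system of `k` nondegenerate regular `A`-correspondences and `i < k`.
Let `ℰ^i Y` be the generating system obtained by `i` iterations of the
construction `ℰ` (with pivots `Y₁, …, Y_i`).  Then for every `j` there is
an isomorphism `ℰ^i Y_j ≅ Y_j ⊗_A 𝒪(Y₁ ∗ ⋯ ∗ Y_i)` of correspondences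
lying over an isomorphism of the coefficient algebras, and (taking
`j = i + 1`) `𝒪(ℰ^i Y_{i+1}) ≅ 𝒪(Y₁ ∗ ⋯ ∗ Y_{i+1})`. -/
theorem iterated_Cuntz_Pimsner_theorem
    {A : Type u} [instA : NonUnitalCStarAlgebra A]
    {k : ℕ} (G : GenSys A k) (i : ℕ) (hik : i < k)
    (tw : Tower k i 0 (by omega) A instA G)
    (B' : Type u) [instB' : NonUnitalCStarAlgebra B'] (G' : GenSys B' k)
    (hlast : TowerLast k i 0 (by omega) A instA G tw = ⟨B', instB', G'⟩)
    (Xi : PSys A i) (geni : Generates (G.restrict i (le_of_lt hik)) Xi)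
    (Ci : PSCPAlg Xi) :
    (∀ (j : Fin k) (Zj : Corr Ci.O) (mmj : (G.Y j).X → Ci.O → Zj.X),
      EPCorr G (le_of_lt hik) Xi geni Ci j Zj mmj →
      ∃ Φ : B' ≃⋆ₐ[ℂ] Ci.O, Nonempty (CorrIsoOver (fun b => Φ b) (G'.Y j) Zj)) ∧
    ∀ (C' : CPAlg (G'.Y ⟨i, hik⟩))
      (Xi1 : PSys A (i + 1)) (geni1 : Generates (G.restrict (i + 1) hik) Xi1)
      (Ci1 : PSCPAlg Xi1),
      Nonempty (C'.O ≃⋆ₐ[ℂ] Ci1.O) := by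
  obtain ⟨E⟩ := Tower.exists_absorption k i 0 (by omega) A instA G tw B' instB' G' hlast
  exact ⟨fun j Zj mmj h => E.exists_isoOver geni Ci h,
    fun C' Xi1 geni1 Ci1 => E.nonempty_equiv C' geni1 Ci1⟩
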